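/- arXiv:1707.00412 — 2 statements merged into one kernel-verified Lean document; each statement's English description precedes it below -/
import Mathlib

section
/- Let q = q₁q₂ with gcd(q₁, q₂) = 1, let a and d be integers with gcd(ad, q) = 1, and let χ₂ be a non-principal Dirichlet character modulo q₂. Then for any C > 0 and all x ≥ 2, ∑_{n ≤ x, gcd(n,d)=1, n ≡ a (mod q₁)} μ²(n)·χ₂(n)/τ(n) ≪_C τ(d)·q·x·(log x)^{−C}, where τ is the number-of-divisors function and the implied constant depends only on C. -/
section

open Filter Topology

/-- Tail of a Dirichlet series, summed by parts: it converges for `0 < s.re` as soon as the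
partial sums of the coefficients are bounded. -/
noncomputable def abelTail (f : ℕ → ℂ) (N : ℕ) (s : ℂ) : ℂ :=
  ∑' n : ℕ, (∑ i ∈ Finset.Ico N (N + n + 1), f i) *
    (((N + n : ℕ) : ℂ) ^ (-s) - ((N + n + 1 : ℕ) : ℂ) ^ (-s))

/-- Initial segment of a Dirichlet series. -/
noncomputable def dirichletHead (f : ℕ → ℂ) (N : ℕ) (s : ℂ) : ℂ :=
  ∑ n ∈ Finset.Ico 1 N, f n * (n : ℂ) ^ (-s)

/-- The value of the zeta series at `1 + ε`. -/
noncomputable def zetaConst (ε : ℝ) : ℝ := ∑' n : ℕ, (n : ℝ) ^ (-(1 + ε))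

lemma summable_zetaConst {ε : ℝ} (hε : 0 < ε) : Summable fun n : ℕ => (n : ℝ) ^ (-(1 + ε)) :=
  Real.summable_nat_rpow.2 (by linarith)

lemma one_le_zetaConst {ε : ℝ} (hε : 0 < ε) : 1 ≤ zetaConst ε := by
  have := (summable_zetaConst hε).le_tsum 1 (fun n _ => by positivity)
  simpa [zetaConst] using this

lemma norm_natCast_cpow_neg {n : ℕ} (hn : 0 < n) (s : ℂ) :
    ‖(n : ℂ) ^ (-s)‖ = (n : ℝ) ^ (-s.re) := by
  rw [Complex.norm_natCast_cpow_of_pos hn, Complex.neg_re]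

lemma hasDerivAt_ofReal_cpow_neg {t : ℝ} (ht : 0 < t) (s : ℂ) :
    HasDerivAt (fun u : ℝ => (u : ℂ) ^ (-s)) (-s * (t : ℂ) ^ (-s - 1)) t := by
  have := (hasDerivAt_id (t : ℂ)).cpow_const (c := -s) (by simp [Complex.slitPlane, ht])
  simpa using this.comp_ofReal

lemma norm_cpow_neg_sub_le {m : ℝ} (hm : 0 < m) {t : ℝ} (ht : m ≤ t) {s : ℂ} (hs : 0 < s.re) :
    ‖(t : ℂ) ^ (-s) - (m : ℂ) ^ (-s)‖ ≤ ‖s‖ * m ^ (-s.re - 1) * (t - m) := by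
  have key := Convex.norm_image_sub_le_of_norm_hasDerivWithin_le
    (f := fun u : ℝ => (u : ℂ) ^ (-s)) (f' := fun u => -s * (u : ℂ) ^ (-s - 1))
    (s := Set.Ici m) (x := m) (y := t) (C := ‖s‖ * m ^ (-s.re - 1))
    (fun x hx => (hasDerivAt_ofReal_cpow_neg (lt_of_lt_of_le hm hx) s).hasDerivWithinAt)
    (fun x hx => ?_) (convex_Ici m) (Set.self_mem_Ici) ht
  · simpa [abs_of_nonneg (sub_nonneg.2 ht)] using key
  · have hx' : 0 < x := lt_of_lt_of_le hm hx
    rw [norm_mul, norm_neg, Complex.norm_cpow_eq_rpow_re_of_pos hx']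
    gcongr ‖s‖ * ?_
    simp only [Complex.sub_re, Complex.neg_re, Complex.one_re]
    exact Real.rpow_le_rpow_of_nonpos hm hx (by linarith)

lemma norm_natCast_cpow_sub_succ_le {m : ℕ} (hm : 0 < m) {s : ℂ} (hs : 0 < s.re) :
    ‖(m : ℂ) ^ (-s) - ((m + 1 : ℕ) : ℂ) ^ (-s)‖ ≤ ‖s‖ * (m : ℝ) ^ (-s.re - 1) := by
  have := norm_cpow_neg_sub_le (m := m) (by exact_mod_cast hm) (t := (m : ℝ) + 1) (by linarith) hs
  rw [norm_sub_rev]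
  simpa using this

lemma summable_shift_rpow (N : ℕ) {σ : ℝ} (hσ : 0 < σ) :
    Summable fun n : ℕ => ((N + n : ℕ) : ℝ) ^ (-σ - 1) := by
  have := (summable_nat_add_iff (f := fun n : ℕ => (n : ℝ) ^ (-σ - 1)) N).2
    (Real.summable_nat_rpow.2 (by linarith))
  simpa [add_comm] using this

lemma norm_tsum_shift_le {N : ℕ} (hN : 0 < N) {ε : ℝ} (hε : 0 < ε) (hε1 : ε ≤ 1 / 4) {s : ℂ}
    (hs : 1 - ε ≤ s.re) {c : ℕ → ℂ} {A : ℝ} (hA : 0 ≤ A)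
    (hc : ∀ n, ‖c n‖ ≤ A * ((N + n : ℕ) : ℝ) ^ (-s.re - 1)) :
    ‖∑' n, c n‖ ≤ zetaConst ε * (A * (N : ℝ) ^ (2 * ε - 1)) := by
  have hsum : Summable fun n : ℕ => ((N + n : ℕ) : ℝ) ^ (-(1 + ε)) := by
    have := summable_shift_rpow N hε
    refine this.congr fun n => by congr 1; ring
  have hle : ∑' n : ℕ, ((N + n : ℕ) : ℝ) ^ (-(1 + ε)) ≤ zetaConst ε := by
    have := (summable_zetaConst hε).sum_add_tsum_nat_add N
    have h0 : 0 ≤ ∑ i ∈ Finset.range N, (i : ℝ) ^ (-(1 + ε)) :=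
      Finset.sum_nonneg fun _ _ => by positivity
    rw [zetaConst, ← this]
    simp only [add_comm N]
    linarith
  calc ‖∑' n, c n‖ ≤ ∑' n : ℕ, A * (N : ℝ) ^ (2 * ε - 1) *
        ((N + n : ℕ) : ℝ) ^ (-(1 + ε)) := by
        refine tsum_of_norm_bounded ((hsum.mul_left _).hasSum) fun n => ?_
        refine (hc n).trans ?_
        rw [mul_assoc]
        gcongr A * ?_
        have hNn : (1 : ℝ) ≤ ((N + n : ℕ) : ℝ) := by exact_mod_cast (by omega : 1 ≤ N + n)
        calc ((N + n : ℕ) : ℝ) ^ (-s.re - 1) ≤ ((N + n : ℕ) : ℝ) ^ ((2 * ε - 1) + (-(1 + ε))) := by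
              apply Real.rpow_le_rpow_of_exponent_le hNn; linarith
          _ = ((N + n : ℕ) : ℝ) ^ (2 * ε - 1) * ((N + n : ℕ) : ℝ) ^ (-(1 + ε)) := by
              rw [Real.rpow_add (by linarith)]
          _ ≤ _ := by
              gcongr ?_ * _
              exact Real.rpow_le_rpow_of_nonpos (by exact_mod_cast hN)
                (by exact_mod_cast (by omega : N ≤ N + n)) (by linarith)
    _ = A * (N : ℝ) ^ (2 * ε - 1) * ∑' n : ℕ, ((N + n : ℕ) : ℝ) ^ (-(1 + ε)) := tsum_mul_left
    _ ≤ A * (N : ℝ) ^ (2 * ε - 1) * zetaConst ε := by gcongr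
    _ = _ := by ring

section AbelTail

variable {f : ℕ → ℂ} {q : ℝ}

lemma norm_abelTail_term_le (hf : ∀ N M, ‖∑ i ∈ Finset.Ico N M, f i‖ ≤ q)
    {N : ℕ} (hN : 0 < N) {s : ℂ} (hs : 0 < s.re) (n : ℕ) :
    ‖(∑ i ∈ Finset.Ico N (N + n + 1), f i) *
      (((N + n : ℕ) : ℂ) ^ (-s) - ((N + n + 1 : ℕ) : ℂ) ^ (-s))‖ ≤
      q * (‖s‖ * ((N + n : ℕ) : ℝ) ^ (-s.re - 1)) := by
  rw [norm_mul]
  have hq : 0 ≤ q := (norm_nonneg _).trans (hf 0 0)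
  gcongr
  · exact hf _ _
  · exact norm_natCast_cpow_sub_succ_le (by omega) hs

lemma summable_abelTail (hf : ∀ N M, ‖∑ i ∈ Finset.Ico N M, f i‖ ≤ q)
    {N : ℕ} (hN : 0 < N) {s : ℂ} (hs : 0 < s.re) :
    Summable fun n : ℕ => (∑ i ∈ Finset.Ico N (N + n + 1), f i) *
      (((N + n : ℕ) : ℂ) ^ (-s) - ((N + n + 1 : ℕ) : ℂ) ^ (-s)) := by
  refine Summable.of_norm_bounded ?_ (norm_abelTail_term_le hf hN hs)
  exact ((summable_shift_rpow N hs).mul_left _).mul_left _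

lemma norm_abelTail_le (hf : ∀ N M, ‖∑ i ∈ Finset.Ico N M, f i‖ ≤ q)
    {N : ℕ} (hN : 0 < N) {ε : ℝ} (hε : 0 < ε) (hε1 : ε ≤ 1 / 4) {s : ℂ}
    (hs : 1 - ε ≤ s.re) :
    ‖abelTail f N s‖ ≤ zetaConst ε * (q * ‖s‖ * (N : ℝ) ^ (2 * ε - 1)) := by
  have hq : 0 ≤ q := (norm_nonneg _).trans (hf 0 0)
  refine norm_tsum_shift_le hN hε hε1 hs (by positivity) fun n => ?_
  rw [mul_assoc]
  exact norm_abelTail_term_le hf hN (by linarith) n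

lemma differentiableOn_abelTail (hf : ∀ N M, ‖∑ i ∈ Finset.Ico N M, f i‖ ≤ q)
    {N : ℕ} (hN : 0 < N) :
    DifferentiableOn ℂ (abelTail f N) {s : ℂ | 0 < s.re} := by
  intro s hs
  have hs : 0 < s.re := hs
  refine DifferentiableAt.differentiableWithinAt ?_
  have hopen : IsOpen ({z : ℂ | s.re / 2 < z.re} ∩ Metric.ball 0 (‖s‖ + 1)) :=
    (isOpen_lt continuous_const Complex.continuous_re).inter Metric.isOpen_ball
  have hq : 0 ≤ q := (norm_nonneg _).trans (hf 0 0)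
  have : DifferentiableOn ℂ (abelTail f N)
      ({z : ℂ | s.re / 2 < z.re} ∩ Metric.ball 0 (‖s‖ + 1)) := by
    refine Complex.differentiableOn_tsum_of_summable_norm
      (u := fun n => q * ((‖s‖ + 1) * ((N + n : ℕ) : ℝ) ^ (-(s.re / 2) - 1))) ?_ ?_ hopen ?_
    · exact ((summable_shift_rpow N (by linarith)).mul_left _).mul_left _
    · intro n
      refine DifferentiableOn.const_mul (DifferentiableOn.sub ?_ ?_) _
      · exact (differentiable_neg.const_cpow (Or.inl (by norm_cast; omega))).differentiableOn
      · exact (differentiable_neg.const_cpow (Or.inl (by norm_cast))).differentiableOn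
    · rintro n z ⟨hz, hz'⟩
      have hz : s.re / 2 < z.re := hz
      refine (norm_abelTail_term_le hf hN (by linarith) n).trans ?_
      rw [mem_ball_zero_iff] at hz'
      gcongr
      exact_mod_cast (by omega : 1 ≤ N + n)
  exact (this s ⟨by simp only [Set.mem_ofPred_eq]; linarith, by simp⟩).differentiableAt
    (hopen.mem_nhds ⟨by simp only [Set.mem_ofPred_eq]; linarith, by simp⟩)

lemma sum_by_parts_eq (N : ℕ) (g : ℕ → ℂ) (K : ℕ) :
    ∑ k ∈ Finset.range K, (∑ i ∈ Finset.Ico N (N + k + 1), f i) * (g (N + k) - g (N + k + 1)) =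
      ∑ k ∈ Finset.Ico N (N + K), f k * g k - (∑ i ∈ Finset.Ico N (N + K), f i) * g (N + K) := by
  induction K with
  | zero => simp
  | succ K ih =>
    rw [Finset.sum_range_succ, ih, ← add_assoc, Finset.sum_Ico_succ_top (by omega),
      Finset.sum_Ico_succ_top (by omega)]
    ring

lemma LSeries_eq_head_add_abelTail (hf : ∀ N M, ‖∑ i ∈ Finset.Ico N M, f i‖ ≤ q)
    {N : ℕ} (hN : 0 < N) {s : ℂ} (hs : 0 < s.re)
    (hsum : LSeriesSummable f s) :
    LSeries f s = dirichletHead f N s + abelTail f N s := by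
  have h1 : Tendsto (fun K => ∑ k ∈ Finset.range K, (∑ i ∈ Finset.Ico N (N + k + 1), f i) *
      (((N + k : ℕ) : ℂ) ^ (-s) - ((N + k + 1 : ℕ) : ℂ) ^ (-s))) atTop (𝓝 (abelTail f N s)) :=
    (summable_abelTail hf hN hs).hasSum.tendsto_sum_nat
  have h2 : Tendsto (fun K : ℕ => ∑ i ∈ Finset.range (N + K), LSeries.term f s i) atTop
      (𝓝 (LSeries f s)) := by
    have := hsum.hasSum.tendsto_sum_nat.comp (tendsto_add_atTop_nat N)
    simpa [LSeries, Function.comp_def, add_comm N] using this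
  have h3 : Tendsto (fun K : ℕ => (∑ i ∈ Finset.Ico N (N + K), f i) *
      ((N + K : ℕ) : ℂ) ^ (-s)) atTop (𝓝 0) := by
    have hz : Tendsto (fun K : ℕ => q * ((N + K : ℕ) : ℝ) ^ (-s.re)) atTop (𝓝 (q * 0)) := by
      refine Tendsto.const_mul _ ?_
      have := (tendsto_rpow_neg_atTop hs).comp
        (tendsto_natCast_atTop_atTop.comp (tendsto_add_atTop_nat N))
      simpa [Function.comp_def, add_comm N] using this
    rw [mul_zero] at hz
    refine squeeze_zero_norm (fun K => ?_) hz
    rw [norm_mul, norm_natCast_cpow_neg (by omega)]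
    gcongr
    exact hf _ _
  have h4 : ∀ K : ℕ, ∑ i ∈ Finset.range (N + K), LSeries.term f s i =
      dirichletHead f N s + ∑ k ∈ Finset.Ico N (N + K), f k * (k : ℂ) ^ (-s) := by
    intro K
    rw [dirichletHead, Finset.sum_Ico_consecutive _ hN (by omega), Finset.range_eq_Ico,
      ← Finset.sum_Ico_consecutive _ (Nat.zero_le 1) (by omega : 1 ≤ N + K)]
    simp only [Nat.Ico_zero_eq_range, Finset.range_one, Finset.sum_singleton, LSeries.term_zero, zero_add]
    refine Finset.sum_congr rfl fun i hi => ?_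
    rw [LSeries.term_of_ne_zero (by simp at hi; omega), Complex.cpow_neg, div_eq_mul_inv]
  refine tendsto_nhds_unique h2 ?_
  have := (h1.add h3).const_add (dirichletHead f N s)
  rw [add_zero] at this
  refine this.congr fun K => ?_
  rw [h4 K, sum_by_parts_eq N (fun k => (k : ℂ) ^ (-s)) K]
  ring

end AbelTail

lemma norm_dirichletHead_le {f : ℕ → ℂ} (hf : ∀ n, ‖f n‖ ≤ 1) (N : ℕ) {ε : ℝ} (hε : 0 < ε)
    {s : ℂ} (hs : 1 - ε ≤ s.re) :
    ‖dirichletHead f N s‖ ≤ zetaConst ε * (N : ℝ) ^ (2 * ε) := by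
  calc ‖dirichletHead f N s‖ ≤ ∑ n ∈ Finset.Ico 1 N, (n : ℝ) ^ (-(1 + ε)) * (N : ℝ) ^ (2 * ε) := by
        refine norm_sum_le_of_le _ fun n hn => ?_
        rw [Finset.mem_Ico] at hn
        rw [norm_mul, norm_natCast_cpow_neg (by omega)]
        have hn1 : (1 : ℝ) ≤ n := by exact_mod_cast hn.1
        calc ‖f n‖ * (n : ℝ) ^ (-s.re) ≤ 1 * (n : ℝ) ^ (-(1 + ε) + 2 * ε) := by
              gcongr
              · exact hf n
              · linarith
          _ = (n : ℝ) ^ (-(1 + ε)) * (n : ℝ) ^ (2 * ε) := by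
              rw [one_mul, Real.rpow_add (by linarith)]
          _ ≤ _ := by
              gcongr
              exact hn.2.le
    _ = (∑ n ∈ Finset.Ico 1 N, (n : ℝ) ^ (-(1 + ε))) * (N : ℝ) ^ (2 * ε) := by
        rw [Finset.sum_mul]
    _ ≤ _ := by
        gcongr
        exact (summable_zetaConst hε).sum_le_tsum _ (fun _ _ => by positivity)

/-- A truncation parameter adapted to the size `q * ‖s‖`. -/
lemma exists_truncation {q : ℝ} (hq : 1 ≤ q) (z : ℝ) (hz : 0 ≤ z) :
    ∃ N : ℕ, 0 < N ∧ q * z ≤ N ∧ (N : ℝ) ≤ 2 * (q * (z + 1)) := by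
  refine ⟨⌈q * (z + 1)⌉₊, Nat.ceil_pos.2 (by positivity), ?_, ?_⟩
  · exact le_trans (by nlinarith) (Nat.le_ceil _)
  · refine (Nat.ceil_lt_add_one (by positivity)).le.trans ?_
    nlinarith

lemma rpow_truncation_le {q : ℝ} (hq : 1 ≤ q) {z : ℝ} (hz : 0 ≤ z) {ε : ℝ} (hε : 0 < ε)
    (hε1 : ε ≤ 1 / 4) {N : ℕ} (hN : 0 < N) (h1 : q * z ≤ N) (h2 : (N : ℝ) ≤ 2 * (q * (z + 1))) :
    zetaConst ε * (N : ℝ) ^ (2 * ε) + zetaConst ε * (q * z * (N : ℝ) ^ (2 * ε - 1)) ≤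
      4 * zetaConst ε * (q * (z + 1)) ^ (2 * ε) := by
  have hN0 : (0 : ℝ) < N := by exact_mod_cast hN
  have hZ := one_le_zetaConst hε
  have h3 : q * z * (N : ℝ) ^ (2 * ε - 1) ≤ (N : ℝ) ^ (2 * ε) := by
    calc q * z * (N : ℝ) ^ (2 * ε - 1) ≤ N * (N : ℝ) ^ (2 * ε - 1) := by gcongr
      _ = (N : ℝ) ^ (2 * ε) := by
        rw [Real.rpow_sub_one hN0.ne']; field_simp
  have h4 : (N : ℝ) ^ (2 * ε) ≤ 2 * (q * (z + 1)) ^ (2 * ε) := by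
    calc (N : ℝ) ^ (2 * ε) ≤ (2 * (q * (z + 1))) ^ (2 * ε) := by gcongr
      _ = 2 ^ (2 * ε) * (q * (z + 1)) ^ (2 * ε) := by
        rw [Real.mul_rpow (by norm_num) (by positivity)]
      _ ≤ (2 : ℝ) ^ (1 : ℝ) * (q * (z + 1)) ^ (2 * ε) := by
        gcongr
        · norm_num
        · linarith
      _ = _ := by rw [Real.rpow_one]
  nlinarith

lemma norm_head_add_tail_le {f : ℕ → ℂ} {q : ℝ} (hq : 1 ≤ q) (hf1 : ∀ n, ‖f n‖ ≤ 1)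
    (hf : ∀ N M, ‖∑ i ∈ Finset.Ico N M, f i‖ ≤ q) {ε : ℝ} (hε : 0 < ε) (hε1 : ε ≤ 1 / 4)
    {s : ℂ} (hs : 1 - ε ≤ s.re) :
    ∃ N : ℕ, 0 < N ∧ ‖dirichletHead f N s + abelTail f N s‖ ≤
      4 * zetaConst ε * (q * (‖s‖ + 1)) ^ (2 * ε) := by
  obtain ⟨N, hN, h1, h2⟩ := exists_truncation hq ‖s‖ (norm_nonneg s)
  refine ⟨N, hN, (norm_add_le _ _).trans (le_trans (add_le_add (norm_dirichletHead_le hf1 N hε hs)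
    (norm_abelTail_le hf hN hε hε1 hs)) ?_)⟩
  exact rpow_truncation_le hq (norm_nonneg s) hε hε1 hN h1 h2

namespace DirichletCharacter

variable {q : ℕ} [NeZero q]

/-- Sums of a function on `ZMod q` over a block of `q` consecutive integers. -/
lemma sum_Ico_block (f : ZMod q → ℂ) (N : ℕ) :
    ∑ i ∈ Finset.Ico N (N + q), f (i : ZMod q) = ∑ a : ZMod q, f a := by
  refine Finset.sum_bij (fun i _ => (i : ZMod q)) (fun _ _ => Finset.mem_univ _) ?_ ?_ ?_
  · intro i hi j hj h
    rw [ZMod.natCast_eq_natCast_iff] at h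
    rw [Finset.mem_Ico] at hi hj
    have := (Nat.modEq_iff_dvd.1 h)
    obtain ⟨c, hc⟩ := this
    have hq := NeZero.pos q
    have : c = 0 := by
      by_contra h0
      rcases lt_or_gt_of_ne h0 with h0 | h0
      · have : (q : ℤ) * c ≤ q * (-1) := by gcongr; omega
        omega
      · have : (q : ℤ) * 1 ≤ q * c := by gcongr; omega
        omega
    subst this
    omega
  · intro a _
    have hq := NeZero.pos q
    refine ⟨N + (a - (N : ZMod q)).val, ?_, ?_⟩
    · have := ZMod.val_lt (a - (N : ZMod q))
      simp only [Finset.mem_Ico]; omega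
    · simp
  · intros; rfl

lemma norm_sum_Ico_le_of_sum_eq_zero (f : ZMod q → ℂ) (hf1 : ∀ a, ‖f a‖ ≤ 1)
    (hf : ∑ a, f a = 0) (N M : ℕ) : ‖∑ i ∈ Finset.Ico N M, f (i : ZMod q)‖ ≤ q := by
  induction M using Nat.strong_induction_on with
  | _ M ih =>
    by_cases h : M ≤ N + q
    · calc ‖∑ i ∈ Finset.Ico N M, f (i : ZMod q)‖ ≤ ∑ i ∈ Finset.Ico N M, (1 : ℝ) :=
            norm_sum_le_of_le _ fun i _ => hf1 _
        _ = ((M - N : ℕ) : ℝ) := by simp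
        _ ≤ q := by exact_mod_cast (by omega : M - N ≤ q)
    · obtain ⟨M', rfl⟩ : ∃ M', M = M' + q := ⟨M - q, by omega⟩
      rw [← Finset.sum_Ico_consecutive _ (by omega : N ≤ M') (by omega), sum_Ico_block, hf,
        add_zero]
      exact ih M' (by have := NeZero.pos q; omega)

lemma norm_sum_Ico_le {χ : DirichletCharacter ℂ q} (hχ : χ ≠ 1) (N M : ℕ) :
    ‖∑ i ∈ Finset.Ico N M, χ (i : ZMod q)‖ ≤ q :=
  norm_sum_Ico_le_of_sum_eq_zero χ χ.norm_le_one (MulChar.sum_eq_zero_of_ne_one hχ) N M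

lemma one_le_modulus : (1 : ℝ) ≤ q := by exact_mod_cast NeZero.one_le

lemma LFunction_eq_head_add_abelTail {χ : DirichletCharacter ℂ q} (hχ : χ ≠ 1) {N : ℕ}
    (hN : 0 < N) {s : ℂ} (hs : 0 < s.re) :
    LFunction χ s = dirichletHead (fun n => χ n) N s + abelTail (fun n => χ n) N s := by
  have hopen : IsOpen {s : ℂ | 0 < s.re} := isOpen_lt continuous_const Complex.continuous_re
  have hd : DifferentiableOn ℂ (fun s => dirichletHead (fun n => χ n) N s +
      abelTail (fun n => χ n) N s) {s : ℂ | 0 < s.re} := by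
    refine DifferentiableOn.add ?_ (differentiableOn_abelTail (norm_sum_Ico_le hχ) hN)
    refine DifferentiableOn.fun_sum fun n hn => DifferentiableOn.const_mul ?_ _
    refine (differentiable_neg.const_cpow (Or.inl ?_)).differentiableOn
    rw [Finset.mem_Ico] at hn
    norm_cast; omega
  refine AnalyticOnNhd.eqOn_of_preconnected_of_eventuallyEq (U := {s : ℂ | 0 < s.re}) (z₀ := 2)
    ((differentiable_LFunction hχ).differentiableOn.analyticOnNhd hopen)
    (hd.analyticOnNhd hopen) (convex_halfSpace_re_gt 0).isPreconnected (by simp) ?_ hs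
  have : {s : ℂ | 1 < s.re} ∈ 𝓝 (2 : ℂ) :=
    (isOpen_lt continuous_const Complex.continuous_re).mem_nhds (by simp)
  filter_upwards [this] with z hz
  have hz : 1 < z.re := hz
  rw [LFunction_eq_LSeries χ hz]
  exact LSeries_eq_head_add_abelTail (norm_sum_Ico_le hχ) hN (by linarith)
    (LSeriesSummable_of_one_lt_re χ hz)

/-- Bound for `L(s, χ)` slightly to the left of the line `re s = 1`. -/
lemma norm_LFunction_le {χ : DirichletCharacter ℂ q} (hχ : χ ≠ 1) {ε : ℝ} (hε : 0 < ε)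
    (hε1 : ε ≤ 1 / 4) {s : ℂ} (hs : 1 - ε ≤ s.re) :
    ‖LFunction χ s‖ ≤ 4 * zetaConst ε * (q * (‖s‖ + 1)) ^ (2 * ε) := by
  obtain ⟨N, hN, h⟩ := norm_head_add_tail_le (f := fun n => χ n) one_le_modulus
    (fun n => χ.norm_le_one _) (norm_sum_Ico_le hχ) hε hε1 hs
  rwa [LFunction_eq_head_add_abelTail hχ hN (by linarith)]

/-- Bounds for the derivatives of `L(s, χ)` in the closed half plane `1 ≤ re s`. -/
lemma exists_norm_iteratedDeriv_LFunction_le (k : ℕ) {ε : ℝ} (hε : 0 < ε) :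
    ∃ K : ℝ, 1 ≤ K ∧ ∀ (q : ℕ) [NeZero q] (χ : DirichletCharacter ℂ q), χ ≠ 1 → ∀ s : ℂ,
      1 ≤ s.re → ‖iteratedDeriv k (LFunction χ) s‖ ≤ K * (q * (‖s‖ + 1)) ^ ε := by
  set δ := min (ε / 2) (1 / 4) with hδ
  have hδ0 : 0 < δ := by positivity
  have hδ1 : δ ≤ 1 / 4 := min_le_right _ _
  have hδ2 : 2 * δ ≤ ε := by have := min_le_left (ε / 2) (1 / 4 : ℝ); rw [← hδ] at this; linarith
  refine ⟨max 1 (k.factorial * (4 * zetaConst δ * 2 ^ ε) / δ ^ k), le_max_left _ _, ?_⟩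
  intro q _ χ hχ s hs
  have hq : (1 : ℝ) ≤ q := one_le_modulus
  have hZ := one_le_zetaConst hδ0
  have h1 : ‖iteratedDeriv k (LFunction χ) s‖ ≤
      k.factorial * (4 * zetaConst δ * (q * (2 * (‖s‖ + 1))) ^ ε) / δ ^ k := by
    refine Complex.norm_iteratedDeriv_le_of_forall_mem_sphere_norm_le k hδ0
      (differentiable_LFunction hχ).diffContOnCl fun z hz => ?_
    rw [mem_sphere_iff_norm] at hz
    have hre : 1 - δ ≤ z.re := by
      have := Complex.abs_re_le_norm (z - s)
      rw [hz, abs_le, Complex.sub_re] at this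
      linarith
    refine (norm_LFunction_le hχ hδ0 hδ1 hre).trans ?_
    have hzs : ‖z‖ ≤ ‖s‖ + 1 := by
      have := norm_add_le s (z - s)
      rw [add_sub_cancel, hz] at this
      linarith
    gcongr 4 * zetaConst δ * ?_
    calc (q * (‖z‖ + 1)) ^ (2 * δ) ≤ (q * (‖z‖ + 1)) ^ ε := by
          apply Real.rpow_le_rpow_of_exponent_le _ hδ2
          nlinarith [norm_nonneg z]
      _ ≤ _ := by
        gcongr
        linarith [norm_nonneg s]
  refine h1.trans ?_
  rw [show (q : ℝ) * (2 * (‖s‖ + 1)) = 2 * (q * (‖s‖ + 1)) by ring,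
    Real.mul_rpow (by norm_num) (by positivity)]
  calc _ = (k.factorial * (4 * zetaConst δ * 2 ^ ε) / δ ^ k) * (q * (‖s‖ + 1)) ^ ε := by ring
    _ ≤ _ := by gcongr; exact le_max_right _ _

end DirichletCharacter

lemma norm_zeta_term_sub_le {m : ℕ} (hm : 0 < m) {s : ℂ} (hs : 0 < s.re) (hs1 : s ≠ 1) :
    ‖(m : ℂ) ^ (-s) - ((m : ℂ) ^ (1 - s) - ((m + 1 : ℕ) : ℂ) ^ (1 - s)) / (s - 1)‖ ≤
      ‖s‖ * (m : ℝ) ^ (-s.re - 1) := by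
  have hm0 : (0 : ℝ) < m := by exact_mod_cast hm
  have hs1' : s - 1 ≠ 0 := sub_ne_zero.2 hs1
  have hder : ∀ t : ℝ, 0 < t → HasDerivAt (fun u : ℝ => (u : ℂ) * (m : ℂ) ^ (-s) +
      (u : ℂ) ^ (-(s - 1)) / (s - 1)) ((m : ℂ) ^ (-s) - (t : ℂ) ^ (-s)) t := by
    intro t ht
    have h1 : HasDerivAt (fun u : ℝ => (u : ℂ)) 1 t := (hasDerivAt_id (t : ℂ)).comp_ofReal
    have := (h1.mul_const ((m : ℂ) ^ (-s))).add
      ((hasDerivAt_ofReal_cpow_neg ht (s - 1)).div_const (s - 1))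
    refine this.congr_deriv ?_
    rw [show -(s - 1) - 1 = -s by ring]
    field_simp
    ring
  have key := Convex.norm_image_sub_le_of_norm_hasDerivWithin_le
    (f := fun u : ℝ => (u : ℂ) * (m : ℂ) ^ (-s) + (u : ℂ) ^ (-(s - 1)) / (s - 1))
    (f' := fun t => (m : ℂ) ^ (-s) - (t : ℂ) ^ (-s))
    (s := Set.Icc (m : ℝ) (m + 1)) (x := m) (y := (m : ℝ) + 1) (C := ‖s‖ * (m : ℝ) ^ (-s.re - 1))
    (fun x hx => (hder x (lt_of_lt_of_le hm0 hx.1)).hasDerivWithinAt)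
    (fun x hx => ?_) (convex_Icc _ _) (by simp) (by simp)
  · refine le_trans (le_of_eq ?_) (key.trans (by simp))
    congr 1
    push_cast
    rw [show 1 - s = -(s - 1) by ring]
    ring
  · rw [norm_sub_rev]
    have := norm_cpow_neg_sub_le hm0 hx.1 hs
    push_cast at this
    refine this.trans (mul_le_of_le_one_right (by positivity) (by linarith [hx.2]))

/-- Growth of the zeta function on `1 < re s`, away from its pole. -/
lemma norm_riemannZeta_le {ε : ℝ} (hε : 0 < ε) (hε1 : ε ≤ 1 / 4) {s : ℂ} (hs : 1 < s.re) :
    ‖riemannZeta s‖ ≤ 4 * zetaConst ε * (‖s‖ + 1) ^ (2 * ε) + ‖s - 1‖⁻¹ := by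
  have hs0 : 0 < s.re := by linarith
  have hs1 : s ≠ 1 := by rintro rfl; simp at hs
  obtain ⟨N, hN, h1, h2⟩ := exists_truncation le_rfl ‖s‖ (norm_nonneg s)
  have hN1 : (1 : ℝ) ≤ N := by exact_mod_cast hN
  set d : ℕ → ℂ := fun n => ((N + n : ℕ) : ℂ) ^ (-s) - (((N + n : ℕ) : ℂ) ^ (1 - s) -
    ((N + n + 1 : ℕ) : ℂ) ^ (1 - s)) / (s - 1) with hd
  have hdb : ∀ n, ‖d n‖ ≤ 1 * (‖s‖ * ((N + n : ℕ) : ℝ) ^ (-s.re - 1)) := fun n => by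
    rw [one_mul]; exact norm_zeta_term_sub_le (by omega) hs0 hs1
  have hdsum : Summable d := Summable.of_norm_bounded
    (((summable_shift_rpow N hs0).mul_left _).mul_left _) hdb
  have hz : Tendsto (fun K : ℕ => ∑ i ∈ Finset.range (N + K), LSeries.term 1 s i) atTop
      (𝓝 (riemannZeta s)) := by
    have hsum := (LSeriesSummable_one_iff.2 hs).hasSum.tendsto_sum_nat.comp
      (tendsto_add_atTop_nat N)
    rw [← LSeries_one_eq_riemannZeta hs]
    simpa [LSeries, Function.comp_def, add_comm N] using hsum
  have hz' : Tendsto (fun K : ℕ => ((N + K : ℕ) : ℂ) ^ (1 - s)) atTop (𝓝 0) := by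
    rw [tendsto_zero_iff_norm_tendsto_zero]
    have := (tendsto_rpow_neg_atTop (show 0 < s.re - 1 by linarith)).comp
        (tendsto_natCast_atTop_atTop.comp (tendsto_add_atTop_nat N))
    refine this.congr fun K => ?_
    rw [Complex.norm_natCast_cpow_of_pos (by omega)]
    simp [add_comm]
  have heq : riemannZeta s = dirichletHead 1 N s + ∑' n, d n + (N : ℂ) ^ (1 - s) / (s - 1) := by
    refine tendsto_nhds_unique hz ?_
    have := ((hdsum.hasSum.tendsto_sum_nat.const_add (dirichletHead 1 N s)).add_const
      ((N : ℂ) ^ (1 - s) / (s - 1))).sub (hz'.div_const (s - 1))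
    rw [zero_div, sub_zero] at this
    refine this.congr fun K => ?_
    have hfin : ∑ n ∈ Finset.range K, d n = ∑ k ∈ Finset.Ico N (N + K), (k : ℂ) ^ (-s) -
        ((N : ℂ) ^ (1 - s) - ((N + K : ℕ) : ℂ) ^ (1 - s)) / (s - 1) := by
      induction K with
      | zero => simp
      | succ K ih =>
        rw [Finset.sum_range_succ, ih, ← add_assoc, Finset.sum_Ico_succ_top (by omega)]
        simp only [hd]
        ring
    rw [hfin, dirichletHead, Finset.range_eq_Ico,
      ← Finset.sum_Ico_consecutive _ (Nat.zero_le 1) (by omega : 1 ≤ N + K),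
      ← Finset.sum_Ico_consecutive _ (show 1 ≤ N from hN) (by omega : N ≤ N + K)]
    simp only [Nat.Ico_zero_eq_range, Finset.range_one, Finset.sum_singleton, LSeries.term_zero,
      zero_add]
    have hterm : ∀ A B : ℕ, 0 < A → ∑ i ∈ Finset.Ico A B, LSeries.term 1 s i =
        ∑ i ∈ Finset.Ico A B, (i : ℂ) ^ (-s) := by
      intro A B hA
      refine Finset.sum_congr rfl fun i hi => ?_
      rw [LSeries.term_of_ne_zero (by simp at hi; omega), Complex.cpow_neg]
      simp
    rw [hterm _ _ one_pos, hterm _ _ hN]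
    simp only [Pi.one_apply, one_mul]
    ring
  have hhead := norm_dirichletHead_le (f := 1) (by simp) N hε (s := s) (by linarith)
  have htail : ‖∑' n, d n‖ ≤ zetaConst ε * (1 * ‖s‖ * (N : ℝ) ^ (2 * ε - 1)) := by
    refine norm_tsum_shift_le hN hε hε1 (by linarith) (by positivity) fun n => ?_
    rw [mul_assoc]
    exact hdb n
  have hlast : ‖(N : ℂ) ^ (1 - s) / (s - 1)‖ ≤ ‖s - 1‖⁻¹ := by
    rw [norm_div, Complex.norm_natCast_cpow_of_pos hN, div_eq_mul_inv]
    refine mul_le_of_le_one_left (by positivity) ?_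
    exact Real.rpow_le_one_of_one_le_of_nonpos hN1 (by simp; linarith)
  rw [heq]
  refine (norm_add_le _ _).trans (add_le_add ((norm_add_le _ _).trans ?_) hlast)
  refine (add_le_add hhead htail).trans ?_
  simpa using rpow_truncation_le le_rfl (norm_nonneg s) hε hε1 hN h1 h2

lemma riemannZeta_one_add_eq_zetaConst {δ : ℝ} (hδ : 0 < δ) :
    riemannZeta (1 + δ) = zetaConst δ := by
  rw [zeta_eq_tsum_one_div_nat_cpow (by simpa using hδ), zetaConst, Complex.ofReal_tsum]
  refine tsum_congr fun n => ?_
  rw [Complex.ofReal_cpow (by positivity), one_div, ← Complex.cpow_neg]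
  push_cast
  rfl

/-- The zeta function has at most a simple pole at `1`, quantitatively. -/
lemma exists_zetaConst_le : ∃ K : ℝ, 1 ≤ K ∧ ∀ δ : ℝ, 0 < δ → δ ≤ 1 → zetaConst δ ≤ K / δ := by
  have hZ := one_le_zetaConst (ε := 1 / 4) (by norm_num)
  refine ⟨12 * zetaConst (1 / 4) + 1, by linarith, fun δ hδ hδ1 => ?_⟩
  have h := norm_riemannZeta_le (ε := 1 / 4) (by norm_num) le_rfl (s := 1 + δ) (by simpa using hδ)
  have hn : ‖(1 + δ : ℂ)‖ ≤ 2 := by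
    refine (norm_add_le _ _).trans ?_
    rw [Complex.norm_of_nonneg hδ.le, norm_one]
    linarith
  rw [riemannZeta_one_add_eq_zetaConst hδ, add_sub_cancel_left,
    Complex.norm_of_nonneg hδ.le, Complex.norm_of_nonneg
      (zero_le_one.trans (one_le_zetaConst hδ))] at h
  have h3 : (‖(1 + δ : ℂ)‖ + 1) ^ (2 * (1 / 4) : ℝ) ≤ 3 := by
    calc (‖(1 + δ : ℂ)‖ + 1) ^ (2 * (1 / 4) : ℝ) ≤ 3 ^ (2 * (1 / 4) : ℝ) := by
          gcongr; linarith
      _ ≤ (3 : ℝ) ^ (1 : ℝ) := by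
          apply Real.rpow_le_rpow_of_exponent_le <;> norm_num
      _ = 3 := Real.rpow_one 3
  rw [le_div_iff₀ hδ]
  have h4 : zetaConst δ ≤ 12 * zetaConst (1 / 4) + δ⁻¹ := by
    refine h.trans ?_
    nlinarith
  calc zetaConst δ * δ ≤ (12 * zetaConst (1 / 4) + δ⁻¹) * δ := by gcongr
    _ = 12 * zetaConst (1 / 4) * δ + 1 := by field_simp
    _ ≤ _ := by nlinarith

lemma LSeriesSummable_of_norm_le_one {f : ℕ → ℂ} (hf : ∀ n, ‖f n‖ ≤ 1) {s : ℂ} (hs : 1 < s.re) :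
    LSeriesSummable f s :=
  LSeriesSummable_of_bounded_of_one_lt_re (m := 1) (fun n _ => hf n) hs

lemma norm_LSeries_le_zetaConst {f : ℕ → ℂ} (hf : ∀ n, ‖f n‖ ≤ 1) {s : ℂ} (hs : 1 < s.re) :
    ‖LSeries f s‖ ≤ zetaConst (s.re - 1) := by
  refine tsum_of_norm_bounded (summable_zetaConst (by linarith)).hasSum fun n => ?_
  rcases Nat.eq_zero_or_pos n with rfl | hn
  · simp only [LSeries.term_zero, norm_zero]; positivity
  · rw [LSeries.term_of_ne_zero hn.ne', div_eq_mul_inv, ← Complex.cpow_neg, norm_mul,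
      norm_natCast_cpow_neg hn]
    rw [show -(1 + (s.re - 1)) = -s.re by ring]
    exact mul_le_of_le_one_left (by positivity) (hf n)

namespace DirichletCharacter

lemma norm_LFunction_one_le {q : ℕ} [NeZero q] {ε : ℝ} (hε : 0 < ε) (hε1 : ε ≤ 1 / 4) {s : ℂ}
    (hs : 1 < s.re) :
    ‖LFunction (1 : DirichletCharacter ℂ q) s‖ ≤
      8 * zetaConst ε * (q * (‖s‖ + 1)) ^ (2 * ε) + ‖s - 1‖⁻¹ := by
  have hq : (1 : ℝ) ≤ q := one_le_modulus
  set r : ℂ := (q.totient : ℂ) / q with hr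
  have hr' : r = (((q.totient : ℝ) / q : ℝ) : ℂ) := by rw [hr]; push_cast; rfl
  have hr0 : 0 ≤ (q.totient : ℝ) / q := by positivity
  have hr1 : (q.totient : ℝ) / q ≤ 1 :=
    div_le_one_of_le₀ (by exact_mod_cast Nat.totient_le q) (by positivity)
  have hrn : ‖r‖ ≤ 1 := by rw [hr', Complex.norm_of_nonneg hr0]; exact hr1
  set g : ZMod q → ℂ := fun a => (1 : DirichletCharacter ℂ q) a - r with hg
  have hg1 : ∀ a, ‖g a‖ ≤ 1 := by
    intro a
    by_cases ha : IsUnit a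
    · simp only [hg, MulChar.one_apply ha]
      rw [hr', ← Complex.ofReal_one, ← Complex.ofReal_sub, Complex.norm_of_nonneg (by linarith)]
      linarith
    · simpa only [hg, MulChar.map_nonunit _ ha, zero_sub, norm_neg] using hrn
  have hg0 : ∑ a, g a = 0 := by
    simp only [hg, Finset.sum_sub_distrib, MulChar.sum_one_eq_card_units, Finset.sum_const,
      Finset.card_univ, ZMod.card, ZMod.card_units_eq_totient, nsmul_eq_mul]
    rw [hr]
    have : (q : ℂ) ≠ 0 := by exact_mod_cast NeZero.ne q
    field_simp
    ring
  obtain ⟨N, hN, hb⟩ := norm_head_add_tail_le (f := fun n => g n) hq (fun n => hg1 _)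
    (norm_sum_Ico_le_of_sum_eq_zero g hg1 hg0) hε hε1 (s := s) (by linarith)
  have hsum1 : LSeriesSummable (fun n => (1 : DirichletCharacter ℂ q) n) s :=
    LSeriesSummable_of_one_lt_re _ hs
  have hsum2 : LSeriesSummable (r • (1 : ℕ → ℂ)) s := (LSeriesSummable_one_iff.2 hs).smul r
  have hgf : (fun n : ℕ => g n) = (fun n : ℕ => (1 : DirichletCharacter ℂ q) n) - r • 1 := by
    ext n; simp [hg]
  rw [← LSeries_eq_head_add_abelTail (norm_sum_Ico_le_of_sum_eq_zero g hg1 hg0) hN (by linarith)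
    (by rw [hgf]; exact hsum1.sub hsum2), hgf, LSeries_sub hsum1 hsum2,
    LSeries_smul, LSeries_one_eq_riemannZeta hs, ← LFunction_eq_LSeries _ hs] at hb
  have hz := norm_riemannZeta_le hε hε1 hs
  have hZ := one_le_zetaConst hε
  calc ‖LFunction (1 : DirichletCharacter ℂ q) s‖ = ‖(LFunction (1 : DirichletCharacter ℂ q) s -
        r • riemannZeta s) + r • riemannZeta s‖ := by rw [sub_add_cancel]
    _ ≤ 4 * zetaConst ε * (q * (‖s‖ + 1)) ^ (2 * ε) + 1 * ‖riemannZeta s‖ := by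
        refine (norm_add_le _ _).trans (add_le_add hb ?_)
        rw [smul_eq_mul, norm_mul]
        gcongr
    _ ≤ 4 * zetaConst ε * (q * (‖s‖ + 1)) ^ (2 * ε) +
        (4 * zetaConst ε * (q * (‖s‖ + 1)) ^ (2 * ε) + ‖s - 1‖⁻¹) := by
        rw [one_mul]
        gcongr
        refine hz.trans ?_
        gcongr
        exact le_mul_of_one_le_left (by positivity) hq
    _ = _ := by ring

/-- Lipschitz bound for `L(s, χ)` in the strip `1 ≤ re s ≤ 2`. -/
lemma exists_norm_LFunction_sub_le {ε : ℝ} (hε : 0 < ε) :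
    ∃ K : ℝ, 1 ≤ K ∧ ∀ (q : ℕ) [NeZero q] (χ : DirichletCharacter ℂ q), χ ≠ 1 → ∀ (Y : ℝ)
      (s w : ℂ), s.re ∈ Set.Icc 1 2 → w.re ∈ Set.Icc 1 2 → |s.im| ≤ Y → |w.im| ≤ Y →
      ‖LFunction χ s - LFunction χ w‖ ≤ K * (q * (Y + 3)) ^ ε * ‖s - w‖ := by
  obtain ⟨K, hK, h⟩ := exists_norm_iteratedDeriv_LFunction_le 1 hε
  refine ⟨K, hK, fun q _ χ hχ Y s w hs hw hsY hwY => ?_⟩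
  have hq : (1 : ℝ) ≤ q := one_le_modulus
  have hconv : Convex ℝ (Complex.re ⁻¹' Set.Icc 1 2 ∩ Complex.im ⁻¹' Set.Icc (-Y) Y) :=
    ((convex_Icc _ _).linear_preimage Complex.reLm).inter
      ((convex_Icc _ _).linear_preimage Complex.imLm)
  refine hconv.norm_image_sub_le_of_norm_deriv_le (𝕜 := ℂ)
    (fun x _ => (differentiable_LFunction hχ).differentiableAt) (fun z hz => ?_)
    ⟨hw, abs_le.1 hwY⟩ ⟨hs, abs_le.1 hsY⟩
  have hz1 := h q χ hχ z hz.1.1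
  rw [iteratedDeriv_one] at hz1
  refine hz1.trans ?_
  have hzn : ‖z‖ ≤ 2 + Y := by
    refine (Complex.norm_le_abs_re_add_abs_im z).trans ?_
    gcongr
    · rw [abs_of_nonneg (by linarith [hz.1.1])]; exact hz.1.2
    · exact abs_le.2 hz.2
  gcongr K * (q * ?_) ^ ε
  linarith

/-- The `3-4-1` inequality turns upper bounds into a lower bound. -/
lemma exists_norm_LFunction_ge_of_upper_bounds :
    ∃ c : ℝ, 0 < c ∧ ∀ (q : ℕ) [NeZero q] (χ : DirichletCharacter ℂ q) (y M : ℝ), 1 ≤ M →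
      (∀ x : ℝ, 0 < x → x ≤ 1 → ‖LFunction (χ ^ 2) (1 + x + 2 * Complex.I * y)‖ ≤ M) →
      (∀ x x' : ℝ, 0 < x → x ≤ 1 → 0 < x' → x' ≤ 1 → ‖LFunction χ (1 + x + Complex.I * y) -
        LFunction χ (1 + x' + Complex.I * y)‖ ≤ M * |x - x'|) →
      ∀ x : ℝ, 0 < x → x ≤ 1 → c / M ^ 4 ≤ ‖LFunction χ (1 + x + Complex.I * y)‖ := by
  obtain ⟨A, hA, hζ⟩ := exists_zetaConst_le
  refine ⟨1 / (16 * A ^ 3), by positivity, fun q _ χ y M hM h2 hlip => ?_⟩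
  have hA0 : 0 < A := by linarith
  have hM0 : 0 < M := by linarith
  set δ : ℝ := 1 / (16 * A ^ 3 * M ^ 5) with hδ
  have hδ0 : 0 < δ := by positivity
  have hδ1 : δ ≤ 1 := by
    rw [hδ, div_le_one (by positivity)]
    nlinarith [one_le_pow₀ hA (n := 3), one_le_pow₀ hM (n := 5)]
  have hbig : ∀ x : ℝ, δ ≤ x → x ≤ 1 → 2 * δ * M ≤ ‖LFunction χ (1 + x + Complex.I * y)‖ := by
    intro x hx hx1
    have hx0 : 0 < x := lt_of_lt_of_le hδ0 hx
    have h := norm_LFunction_product_ge_one χ hx0 y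
    have htriv : ‖LFunctionTrivChar q (1 + x)‖ ≤ A / x := by
      rw [LFunctionTrivChar, LFunction_eq_LSeries _ (by simpa using hx0)]
      refine (norm_LSeries_le_zetaConst (fun n => DirichletCharacter.norm_le_one _ _)
        (by simpa using hx0)).trans ?_
      simpa using hζ x hx0 hx1
    rw [norm_mul, norm_mul, norm_pow, norm_pow] at h
    have h' : 1 ≤ (A / x) ^ 3 * ‖LFunction χ (1 + x + Complex.I * y)‖ ^ 4 * M :=
      h.le.trans (by gcongr; exact h2 x hx0 hx1)
    refine le_of_pow_le_pow_left₀ (n := 4) (by norm_num) (norm_nonneg _) ?_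
    have e1 : (2 * δ * M) ^ 4 = δ ^ 3 / (A ^ 3 * M) := by
      have : δ * (16 * A ^ 3 * M ^ 5) = 1 := by rw [hδ]; field_simp
      rw [eq_div_iff (by positivity)]
      calc _ = δ ^ 3 * (δ * (16 * A ^ 3 * M ^ 5)) := by ring
        _ = _ := by rw [this, mul_one]
    rw [e1, div_le_iff₀ (by positivity)]
    have h'' : 1 * x ^ 3 ≤ (A / x) ^ 3 * ‖LFunction χ (1 + x + Complex.I * y)‖ ^ 4 * M * x ^ 3 := by
      gcongr
    calc δ ^ 3 ≤ 1 * x ^ 3 := by rw [one_mul]; gcongr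
      _ ≤ _ := h''
      _ = _ := by field_simp
  intro x hx hx1
  have hgoal : 1 / (16 * A ^ 3) / M ^ 4 = δ * M := by
    rw [hδ]; field_simp
  rw [hgoal]
  rcases le_or_gt δ x with h | h
  · refine le_trans ?_ (hbig x h hx1)
    nlinarith [mul_pos hδ0 hM0]
  · have h1 := hbig δ le_rfl hδ1
    have h3 := hlip δ x hδ0 hδ1 hx hx1
    have h4 := norm_sub_norm_le (LFunction χ (1 + δ + Complex.I * y))
      (LFunction χ (1 + x + Complex.I * y))
    rw [abs_of_nonneg (by linarith)] at h3
    nlinarith [mul_pos hM0 hx]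

end DirichletCharacter

lemma iteratedDeriv_sub_one_inv (k : ℕ) :
    iteratedDeriv k (fun z : ℂ => (z - 1)⁻¹) 2 = (-1) ^ k * (k.factorial : ℂ) := by
  have := congrFun (iteratedDeriv_comp_sub_const k (Inv.inv : ℂ → ℂ) 1) 2
  rw [this, iteratedDeriv_eq_iterate, iter_deriv_inv]
  norm_num

lemma iteratedDeriv_add_polar {h f : ℂ → ℂ} {lam : ℂ} (hh : Differentiable ℂ h)
    (heq : ∀ᶠ s in 𝓝 (2 : ℂ), f s = h s + lam * (s - 1)⁻¹) (k : ℕ) :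
    iteratedDeriv k f 2 = iteratedDeriv k h 2 + lam * ((-1) ^ k * (k.factorial : ℂ)) := by
  rw [Filter.EventuallyEq.iteratedDeriv_eq k heq, ← iteratedDeriv_sub_one_inv k]
  have hinv : ContDiffAt ℂ k (fun z : ℂ => (z - 1)⁻¹) 2 :=
    (contDiffAt_id.sub contDiffAt_const).inv (by norm_num)
  have := iteratedDeriv_add (n := k) (hh.contDiff.contDiffAt (x := 2)) (contDiffAt_const (c := lam) |>.mul hinv)
  have h2 := iteratedDeriv_const_mul (n := k) lam hinv
  rw [← h2]
  exact this

lemma polar_residue_lower_bound {h f : ℂ → ℂ} {lam : ℂ} {A c β : ℝ} (hh : Differentiable ℂ h)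
    (heq : ∀ᶠ s in 𝓝 (2 : ℂ), f s = h s + lam * (s - 1)⁻¹)
    (hpos : ∀ k, 0 ≤ ((-1) ^ k * iteratedDeriv k f 2).re) (hc : 0 < c) (hcf : c ≤ (f 2).re)
    (hA : ∀ z ∈ Metric.sphere (2 : ℂ) (5 / 4), ‖h z‖ ≤ A) (hcA : c ≤ 14 * A)
    (hβ : 15 / 16 ≤ β) (hβ1 : β < 1) (hle : (h β).re ≤ lam.re / (1 - β)) :
    c / 6 * (1 - β) * (14 * A / c) ^ (-(7 * (1 - β))) ≤ ‖lam‖ := by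
  set y : ℝ := 2 - β with hy
  have hy1 : 1 < y := by linarith
  have hA0 : 0 < A := by linarith
  have hsum := Complex.hasSum_re (Complex.hasSum_taylorSeries_of_entire hh 2 (β : ℂ))
  set b : ℕ → ℝ := fun k => (k.factorial : ℝ)⁻¹ * ((-1) ^ k * iteratedDeriv k f 2).re with hb
  have hb0 : ∀ k, 0 ≤ b k := fun k => mul_nonneg (by positivity) (hpos k)
  have hterm : ∀ k : ℕ, (((k.factorial : ℂ))⁻¹ • ((β : ℂ) - 2) ^ k • iteratedDeriv k h 2).re =
      (b k - lam.re) * y ^ k := by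
    intro k
    have e1 : iteratedDeriv k h 2 =
        iteratedDeriv k f 2 - lam * ((-1) ^ k * (k.factorial : ℂ)) := by
      rw [iteratedDeriv_add_polar hh heq k]; ring
    have hk : (k.factorial : ℂ) ≠ 0 := by exact_mod_cast k.factorial_ne_zero
    have e3 : ((-1 : ℂ) ^ k) * (-1) ^ k = 1 := by rw [← mul_pow]; simp
    have e2 : ((k.factorial : ℂ))⁻¹ • ((β : ℂ) - 2) ^ k • iteratedDeriv k h 2 =
        (((k.factorial : ℝ)⁻¹ * y ^ k : ℝ) : ℂ) * ((-1) ^ k * iteratedDeriv k f 2) -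
          ((y ^ k : ℝ) : ℂ) * lam := by
      have : ((β : ℂ) - 2) ^ k = ((y ^ k : ℝ) : ℂ) * (-1) ^ k := by
        rw [hy]; push_cast; rw [← mul_pow]; ring
      rw [e1, this, smul_eq_mul, smul_eq_mul]
      push_cast
      field_simp
      linear_combination (-(y : ℂ) ^ k * lam * (k.factorial : ℂ)) * e3
    rw [e2, Complex.sub_re, Complex.re_ofReal_mul, Complex.re_ofReal_mul, hb]
    ring
  simp_rw [hterm] at hsum
  have hcoef : ∀ k : ℕ, -(A * (17 / 20) ^ k) ≤ (b k - lam.re) * y ^ k := by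
    intro k
    rw [← hterm k]
    have h1 := Complex.norm_iteratedDeriv_le_of_forall_mem_sphere_norm_le k
      (by norm_num : (0 : ℝ) < 5 / 4) (hh.diffContOnCl) hA
    have h2 : ‖((k.factorial : ℂ))⁻¹ • ((β : ℂ) - 2) ^ k • iteratedDeriv k h 2‖ ≤
        A * (17 / 20) ^ k := by
      rw [norm_smul, norm_smul, norm_inv, norm_pow, Complex.norm_natCast]
      have : ‖(β : ℂ) - 2‖ = y := by
        rw [show (β : ℂ) - 2 = ((β - 2 : ℝ) : ℂ) by push_cast; ring, Complex.norm_real,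
          Real.norm_eq_abs, abs_of_neg (by linarith)]
        ring
      rw [this]
      have hk : (0 : ℝ) < k.factorial := by exact_mod_cast k.factorial_pos
      calc (k.factorial : ℝ)⁻¹ * (y ^ k * ‖iteratedDeriv k h 2‖)
          ≤ (k.factorial : ℝ)⁻¹ * (y ^ k * (k.factorial * A / (5 / 4) ^ k)) := by gcongr
        _ = A * (y / (5 / 4)) ^ k := by
          rw [div_pow y]
          generalize (5 / 4 : ℝ) ^ k = w
          field_simp
        _ ≤ _ := by
          have : y / (5 / 4) ≤ 17 / 20 := by
            rw [div_le_iff₀ (by norm_num)]; linarith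
          gcongr
    have h3 := (abs_le.1 (Complex.abs_re_le_norm
      (((k.factorial : ℂ))⁻¹ • ((β : ℂ) - 2) ^ k • iteratedDeriv k h 2))).1
    linarith
  have hD : 1 ≤ 14 * A / c := by rw [le_div_iff₀ hc]; linarith
  set D := 14 * A / c with hDdef
  set N : ℕ := ⌈7 * Real.log D⌉₊ + 1 with hN
  have hN1 : 7 * Real.log D ≤ N := by
    rw [hN]; push_cast; linarith [Nat.le_ceil (7 * Real.log D)]
  have hlogD : 0 ≤ Real.log D := Real.log_nonneg hD
  have hN2 : (N : ℝ) ≤ 7 * Real.log D + 2 := by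
    rw [hN]; push_cast; linarith [Nat.ceil_lt_add_one (by positivity : 0 ≤ 7 * Real.log D)]
  have hs := hsum.summable
  have hsplit := hs.sum_add_tsum_nat_add N
  rw [hsum.tsum_eq] at hsplit
  have hgeo : HasSum (fun k : ℕ => -(A * (17 / 20 : ℝ) ^ (k + N)))
      (-(A * (17 / 20) ^ N * (20 / 3))) := by
    have := ((hasSum_geometric_of_lt_one (r := (17 / 20 : ℝ)) (by norm_num) (by norm_num)).mul_left
      (A * (17 / 20) ^ N)).neg
    have e1 : (fun k : ℕ => -(A * (17 / 20 : ℝ) ^ (k + N))) =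
        fun k : ℕ => -(A * (17 / 20) ^ N * (17 / 20) ^ k) := by
      ext k; rw [pow_add]; ring
    rw [e1, show (20 / 3 : ℝ) = (1 - 17 / 20)⁻¹ by norm_num]
    exact this
  have htail : -(A * (17 / 20) ^ N * (20 / 3)) ≤
      ∑' k, (b (k + N) - lam.re) * y ^ (k + N) := by
    rw [← hgeo.tsum_eq]
    exact hgeo.summable.tsum_le_tsum (fun k => hcoef (k + N)) ((summable_nat_add_iff N).2 hs)
  have hhead : c - lam.re * ((y ^ N - 1) / (y - 1)) ≤
      ∑ k ∈ Finset.range N, (b k - lam.re) * y ^ k := by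
    rw [← geom_sum_eq hy1.ne', Finset.mul_sum]
    simp_rw [sub_mul]
    rw [Finset.sum_sub_distrib]
    have : c ≤ ∑ k ∈ Finset.range N, b k * y ^ k := by
      have h0 : b 0 * y ^ 0 ≤ ∑ k ∈ Finset.range N, b k * y ^ k :=
        Finset.single_le_sum (f := fun k => b k * y ^ k)
          (fun k _ => mul_nonneg (hb0 k) (by positivity)) (by simp [hN])
      have h00 : b 0 = (f 2).re := by simp [hb]
      rw [h00, pow_zero, mul_one] at h0
      linarith
    linarith
  have hpow : (17 / 20 : ℝ) ^ N ≤ 1 / D := by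
    rw [← Real.rpow_natCast]
    have hl : Real.log (17 / 20) ≤ -3 / 20 := by
      linarith [Real.log_le_sub_one_of_pos (by norm_num : (0 : ℝ) < 17 / 20)]
    have hD' : 1 / D = Real.exp (-Real.log D) := by
      rw [Real.exp_neg, Real.exp_log (by positivity), one_div]
    rw [Real.rpow_def_of_pos (by norm_num), hD']
    apply Real.exp_le_exp.2
    nlinarith
  have htail2 : A * (17 / 20) ^ N * (20 / 3) ≤ c / 2 := by
    have : A * (1 / D) = c / 14 := by rw [hDdef]; field_simp
    nlinarith
  have hmain : c / 2 ≤ lam.re * (y ^ N / (1 - β)) := by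
    have e : y - 1 = 1 - β := by rw [hy]; ring
    rw [e, sub_div] at hhead
    have : lam.re / (1 - β) = lam.re * (1 / (1 - β)) := by ring
    rw [this] at hle
    linarith
  have hyN : y ^ N ≤ 3 * D ^ (7 * (1 - β)) := by
    calc y ^ N ≤ (Real.exp (1 - β)) ^ N := by
          gcongr; linarith [Real.add_one_le_exp (1 - β)]
      _ = Real.exp ((1 - β) * N) := by rw [← Real.exp_nat_mul, mul_comm]
      _ ≤ Real.exp (1 + Real.log D * (7 * (1 - β))) := Real.exp_le_exp.2 (by nlinarith)
      _ = Real.exp 1 * D ^ (7 * (1 - β)) := by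
          rw [Real.exp_add, Real.rpow_def_of_pos (by positivity)]
      _ ≤ _ := by gcongr; linarith [Real.exp_one_lt_d9]
  have h1β : 0 < 1 - β := by linarith
  have hfin : c / 2 ≤ ‖lam‖ * (3 * D ^ (7 * (1 - β)) / (1 - β)) :=
    hmain.trans (by
      have := Complex.re_le_norm lam
      gcongr)
  rw [Real.rpow_neg (by positivity)]
  have hDp : 0 < D ^ (7 * (1 - β)) := by positivity
  rw [mul_div_assoc', le_div_iff₀ h1β] at hfin
  rw [← div_eq_mul_inv, div_le_iff₀ hDp]
  linarith

section ComplexOrder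

open scoped ComplexOrder

lemma iteratedDeriv_alternating_of_deriv_eq_neg_mul {f : ℂ → ℂ} {w : ℕ → ℂ} (hw : 0 ≤ w)
    (hws : ∀ s : ℂ, 1 < s.re → LSeriesSummable w s)
    (hf : DifferentiableOn ℂ f {s | 1 < s.re})
    (hfw : ∀ s : ℂ, 1 < s.re → deriv f s = -(f s * LSeries w s)) (h2 : 0 ≤ f 2) (k : ℕ) :
    0 ≤ (-1) ^ k * iteratedDeriv k f 2 := by
  have habs : LSeries.abscissaOfAbsConv w ≤ (1 : ℝ) :=
    LSeries.abscissaOfAbsConv_le_of_forall_lt_LSeriesSummable fun y hy => hws y (by simpa using hy)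
  have hlt : LSeries.abscissaOfAbsConv w < ((2 : ℝ) : EReal) :=
    lt_of_le_of_lt habs (by exact_mod_cast one_lt_two)
  have hopen : IsOpen {s : ℂ | 1 < s.re} := isOpen_lt continuous_const Complex.continuous_re
  have hmem : (2 : ℂ) ∈ {s : ℂ | 1 < s.re} := by simp
  have hnhds := hopen.mem_nhds hmem
  have hfa : AnalyticAt ℂ f 2 := hf.analyticAt hnhds
  have hva : AnalyticAt ℂ (LSeries w) 2 := LSeries_analyticOnNhd w 2 (by simpa using hlt)
  have hev : deriv f =ᶠ[𝓝 2] -(f * LSeries w) := by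
    filter_upwards [hnhds] with s hs
    simpa using hfw s hs
  induction k using Nat.strong_induction_on with
  | _ k ih =>
    rcases k with _ | k
    · simpa using h2
    · rw [iteratedDeriv_succ', hev.iteratedDeriv_eq k, iteratedDeriv_neg,
        iteratedDeriv_mul hfa.contDiffAt hva.contDiffAt]
      rw [mul_neg, ← neg_mul, pow_succ, mul_neg_one, neg_neg, Finset.mul_sum]
      refine Finset.sum_nonneg fun i hi => ?_
      have hik : i ≤ k := by simpa [Nat.lt_succ_iff] using hi
      have h1 := ih i (by omega)
      have h3 := LSeries.iteratedDeriv_alternating hw hlt (k - i)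
      have : (-1 : ℂ) ^ k * ((k.choose i : ℂ) * iteratedDeriv i f 2 *
          iteratedDeriv (k - i) (LSeries w) 2) = (k.choose i : ℂ) *
          (((-1) ^ i * iteratedDeriv i f 2) * ((-1) ^ (k - i) * iteratedDeriv (k - i) (LSeries w) 2)) := by
        rw [show (-1 : ℂ) ^ k = (-1) ^ i * (-1) ^ (k - i) by rw [← pow_add]; congr 1; omega]
        ring
      rw [this]
      exact mul_nonneg (by exact_mod_cast Nat.zero_le _) (mul_nonneg h1 (by simpa using h3))

namespace DirichletCharacter

lemma apply_im_eq_zero {q : ℕ} {χ : DirichletCharacter ℂ q} (hχ : χ ^ 2 = 1) (a : ZMod q) :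
    (χ a).im = 0 := by
  rcases MulChar.isQuadratic_iff_sq_eq_one.mpr hχ a with h | h | h <;> simp [h]

lemma one_add_apply_nonneg {q : ℕ} {χ : DirichletCharacter ℂ q} (hχ : χ ^ 2 = 1) (a : ZMod q) :
    0 ≤ 1 + χ a := by
  rcases MulChar.isQuadratic_iff_sq_eq_one.mpr hχ a with h | h | h
  · simp [h]
  · rw [h]; exact add_nonneg zero_le_one zero_le_one
  · simp [h]

variable {q₁ q₂ : ℕ}

/-- The product of two characters, as a character modulo the product of the moduli. -/
noncomputable def prodChar (χ₁ : DirichletCharacter ℂ q₁) (χ₂ : DirichletCharacter ℂ q₂) :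
    DirichletCharacter ℂ (q₁ * q₂) :=
  changeLevel (Nat.dvd_mul_right q₁ q₂) χ₁ * changeLevel (Nat.dvd_mul_left q₂ q₁) χ₂

lemma prodChar_apply (χ₁ : DirichletCharacter ℂ q₁) (χ₂ : DirichletCharacter ℂ q₂) (n : ℕ) :
    prodChar χ₁ χ₂ n = χ₁ n * χ₂ n := by
  by_cases hn : n.Coprime (q₁ * q₂)
  · have hu : (n : ZMod (q₁ * q₂)) = ((ZMod.unitOfCoprime n hn : (ZMod (q₁ * q₂))ˣ) : ZMod _) := by
      simp
    rw [prodChar, MulChar.mul_apply, hu, changeLevel_eq_cast_of_dvd, changeLevel_eq_cast_of_dvd,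
      ← hu, ZMod.cast_natCast (Nat.dvd_mul_right q₁ q₂), ZMod.cast_natCast (Nat.dvd_mul_left q₂ q₁)]
  · have h1 : prodChar χ₁ χ₂ n = 0 :=
      MulChar.map_nonunit _ (by rwa [ZMod.isUnit_iff_coprime])
    rw [h1]
    rw [Nat.coprime_mul_iff_right, not_and_or] at hn
    rcases hn with hn | hn
    · rw [MulChar.map_nonunit χ₁ (by rwa [ZMod.isUnit_iff_coprime]), zero_mul]
    · rw [MulChar.map_nonunit χ₂ (by rwa [ZMod.isUnit_iff_coprime]), mul_zero]

lemma prodChar_sq {χ₁ : DirichletCharacter ℂ q₁} {χ₂ : DirichletCharacter ℂ q₂}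
    (h₁ : χ₁ ^ 2 = 1) (h₂ : χ₂ ^ 2 = 1) : prodChar χ₁ χ₂ ^ 2 = 1 := by
  rw [prodChar, mul_pow, ← map_pow, ← map_pow, h₁, h₂, map_one, map_one, one_mul]

variable {q : ℕ} [NeZero q]

lemma riemannZeta_pos {σ : ℝ} (hσ : 1 < σ) : 0 < riemannZeta σ := by
  have := riemannZeta_one_add_eq_zetaConst (δ := σ - 1) (by linarith)
  rw [show (1 : ℂ) + ((σ - 1 : ℝ) : ℂ) = σ by push_cast; ring] at this
  rw [this]
  exact_mod_cast lt_of_lt_of_le one_pos (one_le_zetaConst (by linarith))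

lemma LFunction_pos_of_one_lt {χ : DirichletCharacter ℂ q} (hχ : χ ^ 2 = 1) {σ : ℝ}
    (hσ : 1 < σ) : 0 < LFunction χ σ := by
  have hs : 1 < (σ : ℂ).re := by simpa
  have hprod : LSeries χ.zetaMul σ = riemannZeta σ * LFunction χ σ := by
    rw [zetaMul, ← ArithmeticFunction.coe_mul, LSeries_convolution']
    · rw [χ.LFunction_eq_LSeries hs]
      congr 1
      · simp_rw [← ArithmeticFunction.LSeries_zeta_eq_riemannZeta hs,
          ← ArithmeticFunction.natCoe_apply]
      · exact (LSeries_congr χ.apply_eq_toArithmeticFunction_apply _).symm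
    · exact ArithmeticFunction.LSeriesSummable_zeta_iff.mpr hs
    · exact (LSeriesSummable_congr _ fun h ↦ (χ.apply_eq_toArithmeticFunction_apply h).symm).mpr <|
        ZMod.LSeriesSummable_of_one_lt_re χ hs
  have habs : LSeries.abscissaOfAbsConv χ.zetaMul ≤ (1 : ℝ) :=
    LSeries.abscissaOfAbsConv_le_of_forall_lt_LSeriesSummable
      fun y hy => χ.LSeriesSummable_zetaMul (by simpa using hy)
  have hpos : 0 < LSeries χ.zetaMul σ :=
    LSeries.positive (fun n => zetaMul_nonneg hχ n)
      (χ.isMultiplicative_zetaMul.map_one ▸ zero_lt_one) (lt_of_le_of_lt habs (by exact_mod_cast hσ))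
  rw [hprod] at hpos
  exact pos_of_mul_pos_right hpos (riemannZeta_pos hσ).le

lemma LFunction_ofReal_im {χ : DirichletCharacter ℂ q} (hχ : χ ^ 2 = 1) (hχ1 : χ ≠ 1) {σ : ℝ}
    (hσ : 0 < σ) : (LFunction χ σ).im = 0 := by
  rw [LFunction_eq_head_add_abelTail hχ1 one_pos (by simpa using hσ), dirichletHead, abelTail]
  simp only [Finset.Ico_self, Finset.sum_empty, zero_add]
  rw [Complex.im_tsum ((summable_abelTail (norm_sum_Ico_le hχ1) one_pos (by simpa using hσ)))]
  refine (tsum_congr fun n => ?_).trans tsum_zero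
  have h1 : (∑ i ∈ Finset.Ico 1 (1 + n + 1), χ i).im = 0 := by
    rw [Complex.im_sum]
    exact Finset.sum_eq_zero fun i _ => apply_im_eq_zero hχ _
  have h2 : ∀ m : ℕ, ((m : ℂ) ^ (-(σ : ℂ))).im = 0 := by
    intro m
    rw [← Complex.ofReal_natCast, ← Complex.ofReal_neg, ← Complex.ofReal_cpow (by positivity),
      Complex.ofReal_im]
  rw [Complex.mul_im, h1, Complex.sub_im, h2, h2]
  simp

/-- If there is no zero in `[σ, 1)`, the `L`-function of a quadratic character is positive at `σ`. -/
lemma LFunction_re_pos_of_forall_ne_zero {χ : DirichletCharacter ℂ q} (hχ : χ ^ 2 = 1)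
    (hχ1 : χ ≠ 1) {σ : ℝ} (hσ : 0 < σ) (h : ∀ β : ℝ, σ ≤ β → β < 1 → LFunction χ β ≠ 0) :
    0 < (LFunction χ σ).re := by
  by_contra! hneg
  have hcont : Continuous fun t : ℝ => (LFunction χ t).re :=
    Complex.continuous_re.comp ((differentiable_LFunction hχ1).continuous.comp
      Complex.continuous_ofReal)
  have h2pos : 0 < (LFunction χ (max σ 2 : ℝ)).re :=
    (Complex.pos_iff.1 (LFunction_pos_of_one_lt hχ (lt_of_lt_of_le one_lt_two
      (le_max_right σ 2)))).1
  obtain ⟨t, ht, ht0⟩ := intermediate_value_Icc (le_max_left σ 2) hcont.continuousOn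
    (show (0 : ℝ) ∈ Set.Icc _ _ from ⟨hneg, h2pos.le⟩)
  have hzero : LFunction χ t = 0 :=
    Complex.ext ht0 (LFunction_ofReal_im hχ hχ1 (lt_of_lt_of_le hσ ht.1))
  rcases lt_or_ge t 1 with h1 | h1
  · exact h t ht.1 h1 hzero
  · exact LFunction_ne_zero_of_one_le_re χ (.inl hχ1) (by simpa using h1) hzero

end DirichletCharacter

namespace DirichletCharacter

lemma LFunctionTrivChar₁_one_apply {s : ℂ} (hs : s ≠ 1) :
    LFunctionTrivChar₁ 1 s = (s - 1) * riemannZeta s := by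
  rw [LFunctionTrivChar₁, Function.update_of_ne hs, LFunctionTrivChar, LFunction_modOne_eq]

lemma LFunctionTrivChar₁_one_one : LFunctionTrivChar₁ 1 1 = 1 := by
  simp [LFunctionTrivChar₁]

lemma inv_zetaConst_le_norm_LFunction {q : ℕ} [NeZero q] (χ : DirichletCharacter ℂ q) {s : ℂ}
    (hs : 1 < s.re) : (zetaConst (s.re - 1))⁻¹ ≤ ‖LFunction χ s‖ := by
  have h1 := LSeries.mul_mu_eq_one χ hs
  rw [← χ.LFunction_eq_LSeries hs] at h1
  have h2 := norm_LSeries_le_zetaConst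
    (f := (fun n : ℕ => χ n) * fun n => ((ArithmeticFunction.moebius n : ℤ) : ℂ)) (s := s) (fun n => by
      rw [Pi.mul_apply, norm_mul]
      refine mul_le_one₀ (χ.norm_le_one _) (norm_nonneg _) ?_
      rw [Complex.norm_intCast]
      exact_mod_cast ArithmeticFunction.abs_moebius_le_one) hs
  have h3 : ‖LFunction χ s‖ * zetaConst (s.re - 1) ≥ 1 := by
    calc (1 : ℝ) = ‖LFunction χ s‖ * ‖LSeries ((fun n : ℕ => χ n) *
          fun n => ((ArithmeticFunction.moebius n : ℤ) : ℂ)) s‖ := by rw [← norm_mul, h1, norm_one]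
      _ ≤ _ := by gcongr
  have h4 : 0 < zetaConst (s.re - 1) := lt_of_lt_of_le one_pos (one_le_zetaConst (by linarith))
  rw [inv_le_iff_one_le_mul₀ h4]
  exact h3

lemma norm_LFunction_le_mul {q : ℕ} [NeZero q] {χ : DirichletCharacter ℂ q} (hχ : χ ≠ 1) {s : ℂ}
    (hs : 3 / 4 ≤ s.re) (hs4 : ‖s‖ ≤ 4) : ‖LFunction χ s‖ ≤ 20 * zetaConst (1 / 4) * q := by
  have h := norm_LFunction_le hχ (ε := 1 / 4) (by norm_num) le_rfl (s := s) (by linarith)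
  have hq := one_le_modulus (q := q)
  have hz := one_le_zetaConst (ε := 1 / 4) (by norm_num)
  have h1 : ((q : ℝ) * (‖s‖ + 1)) ^ (2 * (1 / 4) : ℝ) ≤ q * 5 := by
    calc _ ≤ ((q : ℝ) * (‖s‖ + 1)) ^ (1 : ℝ) := by
          apply Real.rpow_le_rpow_of_exponent_le
          · nlinarith [norm_nonneg s]
          · norm_num
      _ ≤ _ := by
          rw [Real.rpow_one]; gcongr; linarith
  calc _ ≤ _ := h
    _ ≤ 4 * zetaConst (1 / 4) * (q * 5) := by gcongr
    _ = _ := by ring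

section

variable {q₁ q₂ : ℕ} [NeZero q₁] [NeZero q₂] {χ₁ : DirichletCharacter ℂ q₁}
  {χ₂ : DirichletCharacter ℂ q₂}

lemma iteratedDeriv_quadruple_nonneg (h₁ : χ₁ ^ 2 = 1) (h₂ : χ₂ ^ 2 = 1) (k : ℕ) :
    0 ≤ (-1) ^ k * iteratedDeriv k (fun s => riemannZeta s *
      (LFunction χ₁ s * LFunction χ₂ s * LFunction (prodChar χ₁ χ₂) s)) 2 := by
  have hne : ∀ s : ℂ, 1 < s.re → s ≠ 1 := by
    rintro s hs rfl; simp at hs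
  set w₀ : ℕ → ℂ := fun n => (ArithmeticFunction.vonMangoldt n : ℂ) with hw₀
  have hΛ : ∀ s : ℂ, 1 < s.re → LSeriesSummable w₀ s := fun s hs =>
    ArithmeticFunction.LSeriesSummable_vonMangoldt hs
  have hs1 : ∀ s : ℂ, 1 < s.re → LSeriesSummable ((fun n : ℕ => χ₁ n) * w₀) s := fun s hs =>
    LSeriesSummable_twist_vonMangoldt χ₁ hs
  have hs2 : ∀ s : ℂ, 1 < s.re → LSeriesSummable ((fun n : ℕ => χ₂ n) * w₀) s := fun s hs =>
    LSeriesSummable_twist_vonMangoldt χ₂ hs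
  have hs3 : ∀ s : ℂ, 1 < s.re → LSeriesSummable ((fun n : ℕ => prodChar χ₁ χ₂ n) * w₀) s :=
    fun s hs => LSeriesSummable_twist_vonMangoldt _ hs
  refine iteratedDeriv_alternating_of_deriv_eq_neg_mul
    (w := w₀ + (fun n : ℕ => χ₁ n) * w₀ + ((fun n : ℕ => χ₂ n) * w₀ +
      (fun n : ℕ => prodChar χ₁ χ₂ n) * w₀)) ?_ ?_ ?_ ?_ ?_ k
  · intro n
    have e : (w₀ + (fun n : ℕ => χ₁ n) * w₀ + ((fun n : ℕ => χ₂ n) * w₀ +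
      (fun n : ℕ => prodChar χ₁ χ₂ n) * w₀)) n = (1 + χ₁ n) * (1 + χ₂ n) * w₀ n := by
      simp only [Pi.add_apply, Pi.mul_apply, prodChar_apply]; ring
    rw [e]
    refine mul_nonneg (mul_nonneg (one_add_apply_nonneg h₁ _) (one_add_apply_nonneg h₂ _)) ?_
    exact Complex.zero_le_real.2 ArithmeticFunction.vonMangoldt_nonneg
  · intro s hs
    exact ((hΛ s hs).add (hs1 s hs)).add ((hs2 s hs).add (hs3 s hs))
  · intro s hs
    have := hne s hs
    exact ((differentiableAt_riemannZeta this).mul (((differentiableAt_LFunction _ s (.inl this)).mul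
      (differentiableAt_LFunction _ s (.inl this))).mul
      (differentiableAt_LFunction _ s (.inl this)))).differentiableWithinAt
  · intro s hs
    have hs' := hne s hs
    have hder : ∀ {q : ℕ} [NeZero q] (χ : DirichletCharacter ℂ q),
        HasDerivAt (LFunction χ) (-(LFunction χ s * LSeries ((fun n : ℕ => χ n) * w₀) s)) s := by
      intro q _ χ
      have hn : LFunction χ s ≠ 0 := LFunction_ne_zero_of_one_le_re χ (.inr hs') (le_of_lt hs)
      have h := (differentiableAt_LFunction χ s (.inl hs')).hasDerivAt
      refine h.congr_deriv ?_
      rw [hw₀, LSeries_twist_vonMangoldt_eq χ hs, ← LFunction_eq_LSeries χ hs,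
        ← deriv_LFunction_eq_deriv_LSeries χ hs]
      field_simp

    have hz : HasDerivAt riemannZeta (-(riemannZeta s * LSeries w₀ s)) s := by
      refine (differentiableAt_riemannZeta hs').hasDerivAt.congr_deriv ?_
      rw [hw₀, ArithmeticFunction.LSeries_vonMangoldt_eq_deriv_riemannZeta_div hs]
      have := riemannZeta_ne_zero_of_one_lt_re hs
      field_simp
    have hall := hz.mul (((hder χ₁).mul (hder χ₂)).mul (hder (prodChar χ₁ χ₂)))
    rw [LSeries_add ((hΛ s hs).add (hs1 s hs)) ((hs2 s hs).add (hs3 s hs)),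
      LSeries_add (hΛ s hs) (hs1 s hs), LSeries_add (hs2 s hs) (hs3 s hs)]
    refine hall.deriv.trans ?_
    simp only [Pi.mul_apply]
    ring
  · have e : (2 : ℂ) = ((2 : ℝ) : ℂ) := by norm_num
    rw [e]
    exact (mul_pos (riemannZeta_pos one_lt_two) (mul_pos (mul_pos
      (LFunction_pos_of_one_lt h₁ one_lt_two) (LFunction_pos_of_one_lt h₂ one_lt_two))
      (LFunction_pos_of_one_lt (prodChar_sq h₁ h₂) one_lt_two))).le

lemma le_re_quadruple_two (h₁ : χ₁ ^ 2 = 1) (h₂ : χ₂ ^ 2 = 1) :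
    (zetaConst 1)⁻¹ ^ 3 ≤ (riemannZeta 2 *
      (LFunction χ₁ 2 * LFunction χ₂ 2 * LFunction (prodChar χ₁ χ₂) 2)).re := by
  have e : (2 : ℂ) = ((2 : ℝ) : ℂ) := by norm_num
  have hpos : 0 ≤ (riemannZeta 2 *
      (LFunction χ₁ 2 * LFunction χ₂ 2 * LFunction (prodChar χ₁ χ₂) 2)) := by
    simpa using iteratedDeriv_quadruple_nonneg h₁ h₂ 0
  have hre := Complex.re_eq_norm.2 hpos
  have hz : 1 ≤ ‖riemannZeta 2‖ := by
    have := riemannZeta_one_add_eq_zetaConst (δ := 1) one_pos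
    rw [show (1 : ℂ) + ((1 : ℝ) : ℂ) = 2 by norm_num] at this
    rw [this, Complex.norm_real, Real.norm_eq_abs]
    exact (one_le_zetaConst one_pos).trans (le_abs_self _)
  have hb : ∀ {q : ℕ} [NeZero q] (χ : DirichletCharacter ℂ q),
      (zetaConst 1)⁻¹ ≤ ‖LFunction χ 2‖ := by
    intro q _ χ
    have := inv_zetaConst_le_norm_LFunction χ (s := 2) (by simp)
    rwa [Complex.re_ofNat, show (2 : ℝ) - 1 = 1 by norm_num] at this
  have hz0 : 0 ≤ (zetaConst 1)⁻¹ := inv_nonneg.2 (zero_le_one.trans (one_le_zetaConst one_pos))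
  rw [hre, norm_mul, norm_mul, norm_mul]
  calc (zetaConst 1)⁻¹ ^ 3 = 1 * ((zetaConst 1)⁻¹ * (zetaConst 1)⁻¹ * (zetaConst 1)⁻¹) := by ring
    _ ≤ _ := by
      gcongr
      · exact hb _
      · exact hb _
      · exact hb _

end

lemma exists_norm_product_one_ge : ∃ c A : ℝ, 0 < c ∧ 1 ≤ A ∧
    ∀ (q₁ q₂ : ℕ) [NeZero q₁] [NeZero q₂] (χ₁ : DirichletCharacter ℂ q₁)
      (χ₂ : DirichletCharacter ℂ q₂), χ₁ ^ 2 = 1 → χ₂ ^ 2 = 1 → χ₁ ≠ 1 → χ₂ ≠ 1 →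
      prodChar χ₁ χ₂ ≠ 1 → ∀ β : ℝ, 15 / 16 ≤ β → β < 1 →
      0 ≤ (LFunctionTrivChar₁ 1 β *
        (LFunction χ₁ β * LFunction χ₂ β * LFunction (prodChar χ₁ χ₂) β)).re →
      c * (1 - β) * (A * ((q₁ : ℝ) * q₂) ^ 2) ^ (-(7 * (1 - β))) ≤
        ‖LFunction χ₁ 1 * LFunction χ₂ 1 * LFunction (prodChar χ₁ χ₂) 1‖ := by
  obtain ⟨M, hM⟩ := (isCompact_sphere (2 : ℂ) (5 / 4)).exists_bound_of_continuousOn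
    (differentiable_LFunctionTrivChar₁ 1).continuous.continuousOn
  set B := 20 * zetaConst (1 / 4) with hB
  set c₀ := (zetaConst 1)⁻¹ ^ 3 with hc₀
  have hB1 : 1 ≤ B := by
    have := one_le_zetaConst (ε := 1 / 4) (by norm_num)
    rw [hB]; linarith
  have hz1 : 1 ≤ zetaConst 1 := one_le_zetaConst one_pos
  have hc0 : 0 < c₀ := by positivity
  have hc1 : c₀ ≤ 1 := pow_le_one₀ (by positivity) (inv_le_one_of_one_le₀ hz1)
  set A₀ := 4 * ((|M| + 1) * B ^ 3) with hA₀
  have hA₀1 : 1 ≤ A₀ := by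
    have : 1 ≤ B ^ 3 := one_le_pow₀ hB1
    nlinarith [abs_nonneg M]
  refine ⟨c₀ / 6, 14 * A₀ / c₀, by positivity, ?_, ?_⟩
  · rw [le_div_iff₀ hc0]; linarith
  intro q₁ q₂ _ _ χ₁ χ₂ h₁ h₂ hn₁ hn₂ hn₃ β hβ hβ1 hre
  set P : ℂ → ℂ := fun s => LFunction χ₁ s * LFunction χ₂ s * LFunction (prodChar χ₁ χ₂) s with hP
  set Z : ℂ → ℂ := LFunctionTrivChar₁ 1 with hZ
  have hPd : Differentiable ℂ P := ((differentiable_LFunction hn₁).mul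
    (differentiable_LFunction hn₂)).mul (differentiable_LFunction hn₃)
  have hZd : Differentiable ℂ Z := differentiable_LFunctionTrivChar₁ 1
  have hZ1 : Z 1 = 1 := LFunctionTrivChar₁_one_one
  have hm1 : (1 : ℝ) ≤ (q₁ : ℝ) * q₂ := by
    have h1 := one_le_modulus (q := q₁)
    have h2 := one_le_modulus (q := q₂)
    nlinarith
  set m := (q₁ : ℝ) * q₂ with hm
  set h : ℂ → ℂ := dslope (fun s => Z s * P s) 1 with hh
  have hhd : Differentiable ℂ h := by
    rw [← differentiableOn_univ]
    exact (Complex.differentiableOn_dslope univ_mem).2 (hZd.mul hPd).differentiableOn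
  have hval : ∀ s : ℂ, s ≠ 1 → h s = (s - 1)⁻¹ * (Z s * P s - P 1) := by
    intro s hs
    rw [hh, dslope_of_ne _ hs, slope_def_module, smul_eq_mul, hZ1, one_mul]
  have hPb : ∀ s : ℂ, 3 / 4 ≤ s.re → ‖s‖ ≤ 4 → ‖P s‖ ≤ B ^ 3 * m ^ 2 := by
    intro s hs hs4
    have b1 := norm_LFunction_le_mul hn₁ hs hs4
    have b2 := norm_LFunction_le_mul hn₂ hs hs4
    have b3 := norm_LFunction_le_mul hn₃ hs hs4
    rw [Nat.cast_mul, ← hm] at b3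
    rw [hP]
    simp only [norm_mul]
    calc _ ≤ (B * q₁) * (B * q₂) * (B * m) := by gcongr
      _ = _ := by rw [hm]; ring
  have key := polar_residue_lower_bound (h := h) (f := fun s => riemannZeta s * P s)
    (lam := P 1) (A := A₀ * m ^ 2) (c := c₀) (β := β) hhd ?_
    (fun k => (Complex.nonneg_iff.1 (iteratedDeriv_quadruple_nonneg h₁ h₂ k)).1) hc0
    (le_re_quadruple_two h₁ h₂) ?_ ?_ hβ hβ1 ?_
  · refine le_trans (le_of_eq ?_) key
    congr 2
    ring
  · have : ∀ᶠ s : ℂ in 𝓝 2, s ≠ 1 := eventually_ne_nhds (by norm_num)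
    filter_upwards [this] with s hs
    have hs' : s - 1 ≠ 0 := sub_ne_zero.2 hs
    rw [hval s hs, hZ, LFunctionTrivChar₁_one_apply hs]
    field_simp
    ring
  · intro z hz
    have hz' : ‖z - 2‖ = 5 / 4 := by simpa [dist_eq_norm] using hz
    have hre1 := (abs_le.1 (Complex.abs_re_le_norm (z - 2))).1
    rw [hz', Complex.sub_re, Complex.re_ofNat] at hre1
    have hz4 : ‖z‖ ≤ 4 := by
      calc ‖z‖ = ‖(z - 2) + 2‖ := by ring_nf
        _ ≤ 5 / 4 + ‖(2 : ℂ)‖ := hz' ▸ norm_add_le _ _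
        _ ≤ 4 := by rw [Complex.norm_ofNat]; norm_num
    have hz1' : 1 / 4 ≤ ‖z - 1‖ := by
      have : ‖z - 2‖ ≤ ‖z - 1‖ + ‖(1 : ℂ)‖ := by
        rw [show z - 2 = (z - 1) - 1 by ring]; exact norm_sub_le _ _
      rw [hz', norm_one] at this
      linarith
    have hne : z ≠ 1 := by
      rintro rfl; norm_num at hz1'
    have hP1 := hPb 1 (by norm_num) (by norm_num)
    have hPz := hPb z (by linarith) hz4
    have hMz := (hM z hz).trans (le_abs_self M)
    rw [hval z hne, norm_mul, norm_inv]
    calc ‖z - 1‖⁻¹ * ‖Z z * P z - P 1‖ ≤ (1 / 4 : ℝ)⁻¹ * (|M| * (B ^ 3 * m ^ 2) + B ^ 3 * m ^ 2) := by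
          gcongr
          refine (norm_sub_le _ _).trans ?_
          rw [norm_mul]
          gcongr
      _ = _ := by rw [hA₀]; ring
  · have : 1 ≤ m ^ 2 := one_le_pow₀ hm1
    nlinarith
  · have hne : (β : ℂ) ≠ 1 := by exact_mod_cast hβ1.ne
    have hpos : 0 < 1 - β := by linarith
    rw [hval _ hne, show ((β : ℂ) - 1)⁻¹ = (((β - 1)⁻¹ : ℝ) : ℂ) by push_cast; ring,
      Complex.re_ofReal_mul, Complex.sub_re, le_div_iff₀ hpos]
    have e : (β - 1)⁻¹ * ((Z β * P β).re - (P 1).re) * (1 - β) = (P 1).re - (Z β * P β).re := by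
      have : β - 1 ≠ 0 := by linarith
      field_simp
      ring
    rw [e]
    linarith
end DirichletCharacter

end ComplexOrder

lemma exists_pow_card_primeFactors_le {B : ℝ} (hB : 1 ≤ B) {ε : ℝ} (hε : 0 < ε) :
    ∃ K : ℝ, 1 ≤ K ∧ ∀ n : ℕ, n ≠ 0 → B ^ n.primeFactors.card ≤ K * (n : ℝ) ^ ε := by
  set P : ℕ := ⌈B ^ ε⁻¹⌉₊ with hP
  refine ⟨B ^ P, one_le_pow₀ hB, fun n hn => ?_⟩
  have hlarge : ∀ p : ℕ, P ≤ p → B ≤ (p : ℝ) ^ ε := by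
    intro p hp
    have h1 : B ^ ε⁻¹ ≤ p := (Nat.le_ceil _).trans (by exact_mod_cast hp)
    calc B = (B ^ ε⁻¹) ^ ε := by rw [← Real.rpow_mul (by linarith), inv_mul_cancel₀ hε.ne', Real.rpow_one]
      _ ≤ _ := by gcongr
  have hone : ∀ p ∈ n.primeFactors, (1 : ℝ) ≤ (p : ℝ) ^ ε := fun p hp =>
    Real.one_le_rpow (by exact_mod_cast (Nat.prime_of_mem_primeFactors hp).one_lt.le) hε.le
  have hstep : ∀ p ∈ n.primeFactors, B ≤ (if p < P then B else 1) * (p : ℝ) ^ ε := by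
    intro p hp
    split_ifs with h
    · nlinarith [hone p hp]
    · rw [one_mul]; exact hlarge p (not_lt.1 h)
  calc B ^ n.primeFactors.card = ∏ p ∈ n.primeFactors, B := by simp
    _ ≤ ∏ p ∈ n.primeFactors, ((if p < P then B else 1) * (p : ℝ) ^ ε) :=
        Finset.prod_le_prod (fun _ _ => by linarith) hstep
    _ = (∏ p ∈ n.primeFactors, if p < P then B else 1) * ∏ p ∈ n.primeFactors, (p : ℝ) ^ ε :=
        Finset.prod_mul_distrib
    _ ≤ B ^ P * (n : ℝ) ^ ε := by
        have h1 : (∏ p ∈ n.primeFactors, if p < P then B else 1) ≤ B ^ P := by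
          rw [Finset.prod_ite, Finset.prod_const_one, mul_one, Finset.prod_const]
          refine pow_le_pow_right₀ hB ?_
          calc _ ≤ (Finset.range P).card := Finset.card_le_card fun p hp => by
                simpa using (Finset.mem_filter.1 hp).2
            _ = P := Finset.card_range P
        have h2 : ∏ p ∈ n.primeFactors, (p : ℝ) ^ ε ≤ (n : ℝ) ^ ε := by
          rw [Real.finsetProd_rpow _ _ (fun _ _ => by positivity)]
          gcongr
          rw [← Nat.cast_prod]
          exact_mod_cast Nat.le_of_dvd (Nat.pos_of_ne_zero hn) (Nat.prod_primeFactors_dvd n)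
        exact mul_le_mul h1 h2 (Finset.prod_nonneg fun _ _ => by positivity) (by positivity)

namespace DirichletCharacter

lemma norm_LFunction_one_changeLevel {q m : ℕ} [NeZero q] [NeZero m] (h : q ∣ m)
    {χ : DirichletCharacter ℂ q} (hχ : χ ≠ 1) :
    ‖LFunction (changeLevel h χ) 1‖ ≤ ‖LFunction χ 1‖ * 2 ^ m.primeFactors.card ∧
      ‖LFunction χ 1‖ ≤ ‖LFunction (changeLevel h χ) 1‖ * 2 ^ m.primeFactors.card := by
  have hb : ∀ p ∈ m.primeFactors, ‖χ (p : ZMod q) * (p : ℂ) ^ (-1 : ℂ)‖ ≤ 1 / 2 := by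
    intro p hp
    have hp2 : (2 : ℝ) ≤ p := by exact_mod_cast (Nat.prime_of_mem_primeFactors hp).two_le
    rw [Complex.cpow_neg_one, norm_mul, norm_inv, Complex.norm_natCast]
    calc _ ≤ 1 * (2 : ℝ)⁻¹ := by
          gcongr
          exact χ.norm_le_one _
      _ = _ := by norm_num
  rw [LFunction_changeLevel h χ (.inl hχ), norm_mul, norm_prod]
  constructor
  · gcongr
    rw [← Finset.prod_const]
    refine Finset.prod_le_prod (fun _ _ => norm_nonneg _) fun p hp => ?_
    have := norm_sub_le (1 : ℂ) (χ (p : ZMod q) * (p : ℂ) ^ (-1 : ℂ))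
    rw [norm_one] at this
    linarith [hb p hp]
  · rw [mul_assoc, ← Finset.prod_const, ← Finset.prod_mul_distrib]
    refine le_mul_of_one_le_right (norm_nonneg _) ?_
    rw [← Finset.prod_const_one (s := m.primeFactors)]
    refine Finset.prod_le_prod (fun _ _ => zero_le_one) fun p hp => ?_
    have := norm_sub_norm_le (1 : ℂ) (χ (p : ZMod q) * (p : ℂ) ^ (-1 : ℂ))
    rw [norm_one] at this
    linarith [hb p hp]

lemma prodChar_eq_one_iff {q₁ q₂ : ℕ} {χ₁ : DirichletCharacter ℂ q₁} {χ₂ : DirichletCharacter ℂ q₂}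
    (h₂ : χ₂ ^ 2 = 1) : prodChar χ₁ χ₂ = 1 ↔
      changeLevel (Nat.dvd_mul_right q₁ q₂) χ₁ = changeLevel (Nat.dvd_mul_left q₂ q₁) χ₂ := by
  have h : changeLevel (Nat.dvd_mul_left q₂ q₁) χ₂ * changeLevel (Nat.dvd_mul_left q₂ q₁) χ₂ = 1 := by
    rw [← map_mul, ← pow_two, h₂, map_one]
  rw [prodChar, mul_eq_one_iff_eq_inv, inv_eq_of_mul_eq_one_left h]

lemma exists_norm_LFunction_one_ge_of_fixed {c A ε : ℝ} (hc : 0 < c) (hA : 1 ≤ A) (hε : 0 < ε)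
    {q₁ : ℕ} [NeZero q₁] {χ₁ : DirichletCharacter ℂ q₁} (hχ₁ : χ₁ ≠ 1)
    {β : ℝ} (hβ : β < 1) (hβε : 14 * (1 - β) ≤ ε / 2) :
    ∃ c' : ℝ, 0 < c' ∧ ∀ (q₂ : ℕ) [NeZero q₂] (χ₂ : DirichletCharacter ℂ q₂), χ₂ ^ 2 = 1 → χ₂ ≠ 1 →
      (prodChar χ₁ χ₂ ≠ 1 → c * (1 - β) * (A * ((q₁ : ℝ) * q₂) ^ 2) ^ (-(7 * (1 - β))) ≤
        ‖LFunction χ₁ 1 * LFunction χ₂ 1 * LFunction (prodChar χ₁ χ₂) 1‖) →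
      c' * (q₂ : ℝ) ^ (-ε) ≤ ‖LFunction χ₂ 1‖ := by
  obtain ⟨K, hK, hKb⟩ := exists_pow_card_primeFactors_le (B := 4) (by norm_num) hε
  obtain ⟨K', hK', hKb'⟩ := exists_norm_iteratedDeriv_LFunction_le 0 (half_pos hε)
  have hL1 : 0 < ‖LFunction χ₁ 1‖ :=
    norm_pos_iff.2 (LFunction_ne_zero_of_one_le_re χ₁ (.inl hχ₁) (by simp))
  have hq₁ := one_le_modulus (q := q₁)
  have hβ' : 0 < 1 - β := by linarith
  set c₁ : ℝ := ‖LFunction χ₁ 1‖ / (K * (q₁ : ℝ) ^ ε) with hc₁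
  set c₂ : ℝ := c * (1 - β) * (A * (q₁ : ℝ) ^ 2) ^ (-(7 * (1 - β))) /
    (‖LFunction χ₁ 1‖ * (K' * (q₁ * 2) ^ (ε / 2))) with hc₂
  have hc1 : 0 < c₁ := by positivity
  have hc2 : 0 < c₂ := by positivity
  refine ⟨min c₁ c₂, lt_min hc1 hc2, fun q₂ _ χ₂ h₂ hχ₂ hmain => ?_⟩
  have hq₂ := one_le_modulus (q := q₂)
  have hq₂0 : (0 : ℝ) < q₂ := by linarith
  by_cases hψ : prodChar χ₁ χ₂ = 1
  · have heq := (prodChar_eq_one_iff h₂).1 hψ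
    have b1 := (norm_LFunction_one_changeLevel (Nat.dvd_mul_right q₁ q₂) hχ₁).2
    have b2 := (norm_LFunction_one_changeLevel (Nat.dvd_mul_left q₂ q₁) hχ₂).1
    rw [heq] at b1
    have b3 := hKb (q₁ * q₂) (NeZero.ne _)
    rw [Nat.cast_mul, Real.mul_rpow (by positivity) (by positivity)] at b3
    have b4 : ‖LFunction χ₁ 1‖ ≤ ‖LFunction χ₂ 1‖ * (K * ((q₁ : ℝ) ^ ε * (q₂ : ℝ) ^ ε)) := by
      calc _ ≤ _ := b1
        _ ≤ ‖LFunction χ₂ 1‖ * 2 ^ (q₁ * q₂).primeFactors.card * 2 ^ (q₁ * q₂).primeFactors.card := by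
            gcongr
        _ = ‖LFunction χ₂ 1‖ * 4 ^ (q₁ * q₂).primeFactors.card := by
            rw [mul_assoc, ← mul_pow]; norm_num
        _ ≤ _ := by gcongr
    calc min c₁ c₂ * (q₂ : ℝ) ^ (-ε) ≤ c₁ * (q₂ : ℝ) ^ (-ε) := by gcongr; exact min_le_left _ _
      _ ≤ _ := by
        rw [Real.rpow_neg (by positivity), hc₁, ← div_eq_mul_inv, div_div,
          div_le_iff₀ (by positivity)]
        linarith
  · have b1 := hmain hψ
    have b2 := hKb' (q₁ * q₂) (prodChar χ₁ χ₂) hψ 1 (by simp)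
    rw [iteratedDeriv_zero, norm_one, Nat.cast_mul] at b2
    rw [norm_mul, norm_mul] at b1
    have e1 : (A * ((q₁ : ℝ) * q₂) ^ 2) ^ (-(7 * (1 - β))) =
        (A * (q₁ : ℝ) ^ 2) ^ (-(7 * (1 - β))) * (q₂ : ℝ) ^ (-(14 * (1 - β))) := by
      rw [mul_pow, ← mul_assoc, Real.mul_rpow (by positivity) (by positivity)]
      congr 1
      rw [← Real.rpow_natCast, ← Real.rpow_mul (by positivity)]
      congr 1; push_cast; ring
    have e2 : ((q₁ : ℝ) * q₂ * (1 + 1)) ^ (ε / 2) = (q₁ * 2) ^ (ε / 2) * (q₂ : ℝ) ^ (ε / 2) := by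
      rw [← Real.mul_rpow (by positivity) (by positivity)]
      congr 1; ring
    rw [e2] at b2
    have e3 : (q₂ : ℝ) ^ (-ε) * (q₂ : ℝ) ^ (ε / 2) ≤ (q₂ : ℝ) ^ (-(14 * (1 - β))) := by
      rw [← Real.rpow_add hq₂0]
      exact Real.rpow_le_rpow_of_exponent_le hq₂ (by linarith)
    set T := c * (1 - β) * (A * (q₁ : ℝ) ^ 2) ^ (-(7 * (1 - β))) with hT
    have hT0 : 0 < T := by positivity
    have b3 : T * ((q₂ : ℝ) ^ (-ε) * (q₂ : ℝ) ^ (ε / 2)) ≤ ‖LFunction χ₁ 1‖ * ‖LFunction χ₂ 1‖ *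
        (K' * ((q₁ * 2) ^ (ε / 2) * (q₂ : ℝ) ^ (ε / 2))) := by
      calc _ ≤ T * (q₂ : ℝ) ^ (-(14 * (1 - β))) := by gcongr
        _ = c * (1 - β) * (A * ((q₁ : ℝ) * q₂) ^ 2) ^ (-(7 * (1 - β))) := by rw [e1, hT]; ring
        _ ≤ _ := b1
        _ ≤ _ := by gcongr
    have hq₂ε : 0 < (q₂ : ℝ) ^ (ε / 2) := by positivity
    have b4 : T * (q₂ : ℝ) ^ (-ε) ≤ ‖LFunction χ₁ 1‖ * ‖LFunction χ₂ 1‖ *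
        (K' * (q₁ * 2) ^ (ε / 2)) := by
      refine le_of_mul_le_mul_right ?_ hq₂ε
      linarith
    calc min c₁ c₂ * (q₂ : ℝ) ^ (-ε) ≤ c₂ * (q₂ : ℝ) ^ (-ε) := by gcongr; exact min_le_right _ _
      _ ≤ _ := by
        rw [hc₂, div_mul_eq_mul_div, div_le_iff₀ (by positivity)]
        linarith

/-- **Siegel's theorem**. -/
theorem exists_norm_LFunction_one_ge {ε : ℝ} (hε : 0 < ε) :
    ∃ c : ℝ, 0 < c ∧ ∀ (q : ℕ) [NeZero q] (χ : DirichletCharacter ℂ q), χ ^ 2 = 1 → χ ≠ 1 →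
      c * (q : ℝ) ^ (-ε) ≤ ‖LFunction χ 1‖ := by
  obtain ⟨c, A, hc, hA, hprod⟩ := exists_norm_product_one_ge
  have hcont : ContinuousAt (fun t : ℝ => (LFunctionTrivChar₁ 1 (t : ℂ)).re) 1 :=
    (Complex.continuous_re.comp ((differentiable_LFunctionTrivChar₁ 1).continuous.comp
      Complex.continuous_ofReal)).continuousAt
  have hpos : ∀ᶠ t : ℝ in 𝓝 1, 0 < (LFunctionTrivChar₁ 1 (t : ℂ)).re := by
    refine hcont.eventually_const_lt ?_
    simp only [Complex.ofReal_one, LFunctionTrivChar₁_one_one, Complex.one_re, zero_lt_one]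
  obtain ⟨δ₀, hδ₀, hδ₀'⟩ := Metric.eventually_nhds_iff.1 hpos
  set δ : ℝ := min (δ₀ / 2) (min (1 / 16) (ε / 28)) with hδ
  have hδpos : 0 < δ := by positivity
  have hδ1 : δ ≤ δ₀ / 2 := min_le_left _ _
  have hδ2 : δ ≤ 1 / 16 := (min_le_right _ _).trans (min_le_left _ _)
  have hδ3 : δ ≤ ε / 28 := (min_le_right _ _).trans (min_le_right _ _)
  by_cases hzero : ∃ (q₁ : ℕ) (_ : NeZero q₁) (χ₁ : DirichletCharacter ℂ q₁) (β : ℝ),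
      χ₁ ^ 2 = 1 ∧ χ₁ ≠ 1 ∧ 1 - δ ≤ β ∧ β < 1 ∧ LFunction χ₁ β = 0
  · obtain ⟨q₁, _, χ₁, β, h₁, hn₁, hβ, hβ1, hL⟩ := hzero
    obtain ⟨c', hc', h⟩ := exists_norm_LFunction_one_ge_of_fixed hc hA hε hn₁ hβ1 (by linarith)
    refine ⟨c', hc', fun q _ χ h₂ hn₂ => h q χ h₂ hn₂ fun hψ => ?_⟩
    refine hprod q₁ q χ₁ χ h₁ h₂ hn₁ hn₂ hψ β (by linarith) hβ1 ?_
    rw [hL]; simp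
  push Not at hzero
  by_cases hex : ∃ (q₁ : ℕ) (_ : NeZero q₁) (χ₁ : DirichletCharacter ℂ q₁), χ₁ ^ 2 = 1 ∧ χ₁ ≠ 1
  · obtain ⟨q₁, _, χ₁, h₁, hn₁⟩ := hex
    obtain ⟨c', hc', h⟩ := exists_norm_LFunction_one_ge_of_fixed (β := 1 - δ) hc hA hε hn₁
      (by linarith) (by linarith)
    refine ⟨c', hc', fun q _ χ h₂ hn₂ => h q χ h₂ hn₂ fun hψ => ?_⟩
    refine hprod q₁ q χ₁ χ h₁ h₂ hn₁ hn₂ hψ (1 - δ) (by linarith) (by linarith) ?_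
    have hreal : ∀ {q : ℕ} [NeZero q] (χ : DirichletCharacter ℂ q), χ ^ 2 = 1 → χ ≠ 1 →
        ∃ r : ℝ, 0 < r ∧ LFunction χ ((1 - δ : ℝ) : ℂ) = r := by
      intro q _ χ h hn
      refine ⟨_, LFunction_re_pos_of_forall_ne_zero h hn (σ := 1 - δ) (by linarith)
        (fun β hβ hβ1 => hzero q _ χ β h hn hβ hβ1), ?_⟩
      exact Complex.ext (by simp) (by
        rw [LFunction_ofReal_im h hn (by linarith)]; simp)
    obtain ⟨r₁, hr₁, e₁⟩ := hreal χ₁ h₁ hn₁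
    obtain ⟨r₂, hr₂, e₂⟩ := hreal χ h₂ hn₂
    obtain ⟨r₃, hr₃, e₃⟩ := hreal (prodChar χ₁ χ) (prodChar_sq h₁ h₂) hψ
    rw [e₁, e₂, e₃, ← Complex.ofReal_mul, ← Complex.ofReal_mul, mul_comm, Complex.re_ofReal_mul]
    refine mul_nonneg (by positivity) (hδ₀' ?_).le
    rw [Real.dist_eq, show 1 - δ - 1 = -δ by ring, abs_neg, abs_of_pos hδpos]
    linarith
  · push Not at hex
    exact ⟨1, one_pos, fun q hq χ h hn => absurd (hex q hq χ h) hn⟩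

end DirichletCharacter

namespace DirichletCharacter

set_option maxHeartbeats 2000000 in
/-- Lower bound for nonprincipal `L`-functions to the right of the line `Re s = 1`. -/
theorem exists_norm_LFunction_ge {ε : ℝ} (hε : 0 < ε) :
    ∃ c : ℝ, 0 < c ∧ ∀ (q : ℕ) [NeZero q] (χ : DirichletCharacter ℂ q), χ ≠ 1 → ∀ x y : ℝ,
      0 < x → x ≤ 1 → c * ((q : ℝ) * (|y| + 3)) ^ (-ε) ≤ ‖LFunction χ (1 + x + Complex.I * y)‖ := by
  set ε' : ℝ := min ε 1 / 12 with hε'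
  have hε'0 : 0 < ε' := by positivity
  have hε'1 : 12 * ε' ≤ ε := by rw [hε']; linarith [min_le_left ε 1]
  have hε'2 : ε' ≤ 1 / 12 := by rw [hε']; linarith [min_le_right ε 1]
  obtain ⟨K₁, hK₁, hK₁b⟩ := exists_norm_iteratedDeriv_LFunction_le 0 hε'0
  obtain ⟨K₂, hK₂, hK₂b⟩ := exists_norm_LFunction_sub_le hε'0
  obtain ⟨c₀, hc₀, hc₀b⟩ := exists_norm_LFunction_ge_of_upper_bounds
  obtain ⟨cS, hcS, hcSb⟩ := exists_norm_LFunction_one_ge hε'0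
  obtain ⟨K₄, hK₄, hK₄b⟩ := exists_zetaConst_le
  set K₃ := 8 * zetaConst (ε' / 2) with hK₃
  have hK₃0 : 1 ≤ K₃ := by
    have := one_le_zetaConst (half_pos hε'0); rw [hK₃]; linarith
  set K := 2 * (K₁ + K₂ + K₃) with hK
  have hK1 : 1 ≤ K := by rw [hK]; linarith
  set c₁ := min cS 1 with hc₁
  have hc1 : 0 < c₁ := by positivity
  have hc1' : c₁ ≤ 1 := min_le_right _ _
  set κ := min (c₀ / K ^ 4) (min (c₀ / (8 * K ^ 2 / c₁) ^ 4) (min (c₁ / 2) (c₁ / (4 * K * K₄))))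
    with hκ
  have hκ0 : 0 < κ := by positivity
  have hκ1 : κ ≤ c₀ / K ^ 4 := min_le_left _ _
  have hκ2 : κ ≤ c₀ / (8 * K ^ 2 / c₁) ^ 4 := (min_le_right _ _).trans (min_le_left _ _)
  have hκ3 : κ ≤ c₁ / 2 := (min_le_right _ _).trans ((min_le_right _ _).trans (min_le_left _ _))
  have hκ4 : κ ≤ c₁ / (4 * K * K₄) :=
    (min_le_right _ _).trans ((min_le_right _ _).trans (min_le_right _ _))
  refine ⟨κ, hκ0, fun q _ χ hχ x y hx hx1 => ?_⟩
  have hq := one_le_modulus (q := q)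
  set Q := (q : ℝ) * (|y| + 3) with hQ
  have hqQ : (q : ℝ) ≤ Q := by nlinarith [abs_nonneg y]
  have hQ1 : 1 ≤ Q := hq.trans hqQ
  have hQ0 : 0 < Q := by linarith
  set T := Q ^ ε' with hT
  have hT1 : 1 ≤ T := Real.one_le_rpow hQ1 hε'0.le
  have hT0 : 0 < T := by linarith
  -- it suffices to bound below by `κ / T ^ j` with `j ≤ 12`
  have hred : ∀ j : ℕ, j ≤ 12 → κ / T ^ j ≤ ‖LFunction χ (1 + x + Complex.I * y)‖ →
      κ * Q ^ (-ε) ≤ ‖LFunction χ (1 + x + Complex.I * y)‖ := by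
    intro j hj h
    refine le_trans ?_ h
    rw [div_eq_mul_inv]
    gcongr
    rw [hT, ← Real.rpow_natCast, ← Real.rpow_mul hQ0.le, ← Real.rpow_neg hQ0.le]
    apply Real.rpow_le_rpow_of_exponent_le hQ1
    have : (j : ℝ) ≤ 12 := by exact_mod_cast hj
    nlinarith
  have hbase : ∀ u : ℝ, 0 ≤ u → u ≤ 2 * (|y| + 3) → ((q : ℝ) * u) ^ ε' ≤ 2 * T := by
    intro u hu0 hu
    calc ((q : ℝ) * u) ^ ε' ≤ (2 * Q) ^ ε' := by
          apply Real.rpow_le_rpow (by positivity) _ hε'0.le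
          rw [hQ]; nlinarith
      _ = 2 ^ ε' * T := by rw [Real.mul_rpow (by norm_num) hQ0.le]
      _ ≤ 2 ^ (1 : ℝ) * T := by
          gcongr
          · norm_num
          · linarith
      _ = _ := by rw [Real.rpow_one]
  have hnorm : ∀ u : ℝ, 0 < u → u ≤ 1 → ‖(1 : ℂ) + u + 2 * Complex.I * y‖ + 1 ≤ 2 * (|y| + 3) := by
    intro u hu hu1
    have h1 : ‖(1 : ℂ) + u + 2 * Complex.I * y‖ ≤ 1 + u + 2 * |y| := by
      refine (norm_add₃_le).trans ?_
      rw [norm_one, Complex.norm_real, norm_mul, norm_mul, Complex.norm_ofNat, Complex.norm_I,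
        Complex.norm_real, Real.norm_eq_abs, Real.norm_eq_abs, abs_of_pos hu]
      linarith
    linarith
  have hdiff : ∀ s w : ℂ, s.re ∈ Set.Icc 1 2 → w.re ∈ Set.Icc 1 2 → |s.im| ≤ |y| → |w.im| ≤ |y| →
      ‖LFunction χ s - LFunction χ w‖ ≤ K * T * ‖s - w‖ := by
    intro s w hs hw hsi hwi
    refine (hK₂b q χ hχ |y| s w hs hw hsi hwi).trans ?_
    rw [← hQ, ← hT]
    gcongr
    rw [hK]; linarith
  have hlip : ∀ M : ℝ, K * T ≤ M → ∀ x x' : ℝ, 0 < x → x ≤ 1 → 0 < x' → x' ≤ 1 →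
      ‖LFunction χ (1 + x + Complex.I * y) - LFunction χ (1 + x' + Complex.I * y)‖ ≤
        M * |x - x'| := by
    intro M hM x x' hx hx1 hx' hx'1
    refine (hdiff _ _ ?_ ?_ ?_ ?_).trans ?_
    · constructor <;> simp <;> linarith
    · constructor <;> simp <;> linarith
    · simp
    · simp
    · have : (1 : ℂ) + x + Complex.I * y - (1 + x' + Complex.I * y) = ((x - x' : ℝ) : ℂ) := by
        push_cast; ring
      rw [this, Complex.norm_real, Real.norm_eq_abs]
      gcongr
  have hKT : 1 ≤ K * T := one_le_mul_of_one_le_of_one_le hK1 hT1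
  by_cases hsq : χ ^ 2 = 1
  swap
  · refine hred 4 (by norm_num) ?_
    have := hc₀b q χ y (K * T) hKT (fun u hu hu1 => ?_) (hlip _ le_rfl) x hx hx1
    · refine le_trans ?_ this
      rw [mul_pow, ← div_div]
      gcongr
    · have h := hK₁b q (χ ^ 2) hsq (1 + u + 2 * Complex.I * y) (by simpa using hu.le)
      rw [iteratedDeriv_zero] at h
      refine h.trans ?_
      calc _ ≤ K₁ * (2 * T) := by
            gcongr
            exact hbase _ (by positivity) (hnorm u hu hu1)
        _ ≤ K * T := by rw [hK]; nlinarith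
  set η := c₁ / (4 * K * T ^ 2) with hη
  have hη0 : 0 < η := by positivity
  have hη1 : η ≤ 1 := by
    rw [hη, div_le_one (by positivity)]
    have : 1 ≤ T ^ 2 := one_le_pow₀ hT1
    nlinarith
  rcases le_or_gt η |y| with hy | hy
  · refine hred 12 le_rfl ?_
    have hη2 : 2 * (K * T) / η = 8 * K ^ 2 / c₁ * T ^ 3 := by
      rw [hη]; field_simp; ring
    have hM : K * T ≤ 2 * (K * T) / η := by
      rw [le_div_iff₀ hη0]; nlinarith
    have := hc₀b q χ y (2 * (K * T) / η) (hKT.trans hM) (fun u hu hu1 => ?_) (hlip _ hM) x hx hx1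
    · refine le_trans ?_ this
      rw [hη2, mul_pow, ← div_div, ← pow_mul]
      gcongr
    · have hre : (1 : ℝ) < ((1 : ℂ) + u + 2 * Complex.I * y).re := by simpa using hu
      have h := norm_LFunction_one_le (q := q) (half_pos hε'0) (by linarith) hre
      rw [mul_div_cancel₀ _ (two_ne_zero' ℝ)] at h
      rw [hsq]
      have h2 : ‖(1 : ℂ) + u + 2 * Complex.I * y - 1‖⁻¹ ≤ η⁻¹ := by
        gcongr
        have h3 := Complex.abs_im_le_norm ((1 : ℂ) + u + 2 * Complex.I * y - 1)
        have h4 : ((1 : ℂ) + u + 2 * Complex.I * y - 1).im = 2 * y := by simp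
        rw [h4, abs_mul, abs_two] at h3
        linarith
      have h5 : K₃ * ((q : ℝ) * (‖(1 : ℂ) + u + 2 * Complex.I * y‖ + 1)) ^ ε' ≤ K * T := by
        calc _ ≤ K₃ * (2 * T) := by
              gcongr
              exact hbase _ (by positivity) (hnorm u hu hu1)
          _ ≤ K * T := by rw [hK]; nlinarith
      have h6 : 1 ≤ η⁻¹ := one_le_inv_iff₀.2 ⟨hη0, hη1⟩
      calc _ ≤ K * T + η⁻¹ := h.trans (add_le_add h5 h2)
        _ ≤ 2 * (K * T) / η := by rw [div_eq_mul_inv]; nlinarith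
  rcases le_or_gt η x with hxη | hxη
  · refine hred 2 (by norm_num) ?_
    have h := inv_zetaConst_le_norm_LFunction χ (s := 1 + x + Complex.I * y) (by simpa using hx)
    have hre : ((1 : ℂ) + x + Complex.I * y).re - 1 = x := by simp
    rw [hre] at h
    refine le_trans ?_ h
    have hz : 0 < zetaConst x := lt_of_lt_of_le one_pos (one_le_zetaConst hx)
    calc κ / T ^ 2 ≤ c₁ / (4 * K * K₄) / T ^ 2 := by gcongr
      _ = η / K₄ := by rw [hη]; field_simp
      _ ≤ x / K₄ := by gcongr
      _ ≤ (zetaConst x)⁻¹ := by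
        rw [div_le_iff₀ (by linarith), ← div_eq_inv_mul, le_div_iff₀ hz]
        have := hK₄b x hx hx1
        rw [le_div_iff₀ hx] at this
        linarith
  · refine hred 1 (by norm_num) ?_
    have h1 := hcSb q χ hsq hχ
    have h2 : c₁ / T ≤ ‖LFunction χ 1‖ := by
      refine le_trans ?_ h1
      rw [Real.rpow_neg (by linarith), ← div_eq_mul_inv]
      have : (q : ℝ) ^ ε' ≤ T := by rw [hT]; gcongr
      have : 0 < (q : ℝ) ^ ε' := by positivity
      gcongr
      exact min_le_left _ _
    have h3 := hdiff 1 (1 + x + Complex.I * y) (by simp) (by constructor <;> simp <;> linarith)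
      (by simp) (by simp)
    have h4 : ‖(1 : ℂ) - (1 + x + Complex.I * y)‖ ≤ 2 * η := by
      have : (1 : ℂ) - (1 + x + Complex.I * y) = -((x : ℂ) + Complex.I * y) := by ring
      rw [this, norm_neg]
      refine (norm_add_le _ _).trans ?_
      rw [Complex.norm_real, norm_mul, Complex.norm_I, Complex.norm_real, Real.norm_eq_abs,
        Real.norm_eq_abs, abs_of_pos hx]
      linarith
    have h5 : K * T * (2 * η) = c₁ / T / 2 := by rw [hη]; field_simp; ring
    have h6 : ‖LFunction χ 1‖ - ‖LFunction χ (1 + x + Complex.I * y)‖ ≤ c₁ / T / 2 := by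
      calc _ ≤ _ := norm_sub_norm_le _ _
        _ ≤ _ := h3
        _ ≤ K * T * (2 * η) := by gcongr
        _ = _ := h5
    have h7 : κ / T ^ 1 ≤ c₁ / T / 2 := by
      rw [pow_one, div_div, mul_comm T 2, ← div_div]
      gcongr
    linarith

end DirichletCharacter

theorem exists_norm_iteratedDeriv_logDeriv_le {B : ℝ} (hB : 0 ≤ B) (k : ℕ) :
    ∃ C : ℝ, 0 ≤ C ∧ ∀ (L : ℂ → ℂ) (s : ℂ) (W : ℝ), 1 ≤ W → AnalyticAt ℂ L s → L s ≠ 0 →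
      (∀ i ≤ k + 1, ‖iteratedDeriv i L s‖ ≤ B * W * ‖L s‖) →
      ‖iteratedDeriv k (fun z => deriv L z / L z) s‖ ≤ C * W ^ (k + 1) := by
  induction k using Nat.strong_induction_on with
  | _ k ih =>
    choose! C hC0 hC using ih
    refine ⟨B + ∑ i ∈ Finset.range k, (k.choose (i + 1) : ℝ) * B * C (k - (i + 1)), ?_, ?_⟩
    · refine add_nonneg hB (Finset.sum_nonneg fun i hi => ?_)
      have := hC0 (k - (i + 1)) (by have := Finset.mem_range.1 hi; omega)
      positivity
    intro L s W hW hL hLs hb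
    set v : ℂ → ℂ := fun z => deriv L z / L z with hv
    have hva : AnalyticAt ℂ v s := hL.deriv.div hL hLs
    have heq : (L * v) =ᶠ[𝓝 s] deriv L := by
      filter_upwards [hL.continuousAt.eventually_ne hLs] with z hz
      simp only [Pi.mul_apply, hv]
      field_simp
    have h1 := heq.iteratedDeriv_eq k
    rw [iteratedDeriv_mul hL.contDiffAt hva.contDiffAt, ← iteratedDeriv_succ',
      Finset.sum_range_succ'] at h1
    simp only [Nat.choose_zero_right, Nat.cast_one, one_mul, iteratedDeriv_zero, Nat.sub_zero] at h1
    have hLpos : 0 < ‖L s‖ := norm_pos_iff.2 hLs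
    have h2 : ‖L s‖ * ‖iteratedDeriv k v s‖ ≤ ‖iteratedDeriv (k + 1) L s‖ +
        ∑ i ∈ Finset.range k, ‖(k.choose (i + 1) : ℂ) * iteratedDeriv (i + 1) L s *
          iteratedDeriv (k - (i + 1)) v s‖ := by
      rw [← norm_mul, ← h1]
      refine le_trans ?_ (add_le_add_right (norm_sum_le _ _) _)
      refine le_trans (le_of_eq ?_) (norm_sub_le _ _)
      congr 1
      ring
    have hW0 : 0 < W := by linarith
    have h3 : ∀ i ∈ Finset.range k, ‖(k.choose (i + 1) : ℂ) * iteratedDeriv (i + 1) L s *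
          iteratedDeriv (k - (i + 1)) v s‖ ≤
        (k.choose (i + 1) : ℝ) * B * C (k - (i + 1)) * W ^ (k + 1) * ‖L s‖ := by
      intro i hi
      have hik := Finset.mem_range.1 hi
      have hlt : k - (i + 1) < k := by omega
      have ha := hC _ hlt L s W hW hL hLs (fun j hj => hb j (by omega))
      have hb' := hb (i + 1) (by omega)
      have hC0' := hC0 _ hlt
      rw [norm_mul, norm_mul, Complex.norm_natCast]
      calc _ ≤ (k.choose (i + 1) : ℝ) * (B * W * ‖L s‖) *
            (C (k - (i + 1)) * W ^ (k - (i + 1) + 1)) := by gcongr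
        _ = (k.choose (i + 1) : ℝ) * B * C (k - (i + 1)) * W ^ (k - (i + 1) + 2) * ‖L s‖ := by ring
        _ ≤ _ := by
          refine mul_le_mul_of_nonneg_right (mul_le_mul_of_nonneg_left
            (pow_le_pow_right₀ hW (by omega)) (by positivity)) (norm_nonneg _)
    have h4 := Finset.sum_le_sum h3
    have h5 : ‖iteratedDeriv (k + 1) L s‖ ≤ B * W ^ (k + 1) * ‖L s‖ := by
      refine (hb _ le_rfl).trans ?_
      gcongr
      exact le_self_pow₀ hW (by omega)
    rw [← Finset.sum_mul, ← Finset.sum_mul] at h4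
    have h6 : ‖L s‖ * ‖iteratedDeriv k v s‖ ≤ ‖L s‖ * ((B + ∑ i ∈ Finset.range k,
        (k.choose (i + 1) : ℝ) * B * C (k - (i + 1))) * W ^ (k + 1)) := by
      linarith
    exact le_of_mul_le_mul_left h6 hLpos

theorem exists_norm_iteratedDeriv_le_of_deriv_eq_mul {B : ℝ} (hB : 0 ≤ B) (k : ℕ) :
    ∃ C : ℝ, 0 ≤ C ∧ ∀ (G u : ℂ → ℂ) (s : ℂ) (U : ℝ), 1 ≤ U → AnalyticAt ℂ G s → AnalyticAt ℂ u s →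
      deriv G =ᶠ[𝓝 s] G * u → (∀ i < k, ‖iteratedDeriv i u s‖ ≤ B * U) →
      ‖iteratedDeriv k G s‖ ≤ C * U ^ k * ‖G s‖ := by
  induction k using Nat.strong_induction_on with
  | _ k ih =>
    rcases k with _ | k
    · exact ⟨1, by norm_num, fun G u s U _ _ _ _ _ => by simp⟩
    choose! C hC0 hC using ih
    refine ⟨∑ i ∈ Finset.range (k + 1), (k.choose i : ℝ) * C i * B, ?_, ?_⟩
    · refine Finset.sum_nonneg fun i hi => ?_
      have := hC0 i (by have := Finset.mem_range.1 hi; omega)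
      positivity
    intro G u s U hU hG hu hGu hb
    rw [iteratedDeriv_succ', hGu.iteratedDeriv_eq k, iteratedDeriv_mul hG.contDiffAt hu.contDiffAt]
    refine (norm_sum_le _ _).trans ?_
    rw [Finset.sum_mul, Finset.sum_mul]
    refine Finset.sum_le_sum fun i hi => ?_
    have hik := Finset.mem_range.1 hi
    have ha := hC i hik G u s U hU hG hu hGu (fun j hj => hb j (by omega))
    have hb' := hb (k - i) (by omega)
    have hC0' := hC0 _ hik
    rw [norm_mul, norm_mul, Complex.norm_natCast]
    calc _ ≤ (k.choose i : ℝ) * (C i * U ^ i * ‖G s‖) * (B * U) := by gcongr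
      _ = (k.choose i : ℝ) * C i * B * U ^ (i + 1) * ‖G s‖ := by ring
      _ ≤ _ := by
        refine mul_le_mul_of_nonneg_right (mul_le_mul_of_nonneg_left
          (pow_le_pow_right₀ hU (by omega)) ?_) (norm_nonneg _)
        positivity

namespace DirichletCharacter

variable {q : ℕ}

/-- The coefficients `μ²(n) χ(n) / τ(n)` restricted to integers coprime to `d`. -/
noncomputable def sqfreeTwist (χ : DirichletCharacter ℂ q) (d n : ℕ) : ℂ :=
  if n.Coprime d ∧ Squarefree n then χ n / n.divisors.card else 0

theorem norm_sqfreeTwist_le (χ : DirichletCharacter ℂ q) (d n : ℕ) : ‖sqfreeTwist χ d n‖ ≤ 1 := by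
  unfold sqfreeTwist
  split_ifs with h
  · rw [norm_div, Complex.norm_natCast]
    have h1 : 1 ≤ n.divisors.card :=
      Finset.card_pos.2 ⟨1, Nat.one_mem_divisors.2 h.2.ne_zero⟩
    have h2 : (1 : ℝ) ≤ n.divisors.card := by exact_mod_cast h1
    exact div_le_one_of_le₀ ((χ.norm_le_one _).trans h2) (by positivity)
  · simp

theorem sqfreeTwist_mul (χ : DirichletCharacter ℂ q) (d : ℕ) {m n : ℕ} (h : m.Coprime n) :
    sqfreeTwist χ d (m * n) = sqfreeTwist χ d m * sqfreeTwist χ d n := by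
  unfold sqfreeTwist
  simp only [Nat.squarefree_mul h, Nat.coprime_mul_iff_left, h.card_divisors_mul]
  split_ifs <;> first | (exfalso; tauto) | simp [mul_div_mul_comm]

theorem sqfreeTwist_prime (χ : DirichletCharacter ℂ q) (d : ℕ) {p : ℕ} (hp : p.Prime) :
    sqfreeTwist χ d p = if p ∣ d then 0 else χ p / 2 := by
  unfold sqfreeTwist
  simp only [hp.coprime_iff_not_dvd, hp.divisors]
  rw [Finset.card_pair hp.one_lt.ne]
  by_cases h : p ∣ d <;> simp [h, hp.prime.squarefree]

theorem sqfreeTwist_prime_pow (χ : DirichletCharacter ℂ q) (d : ℕ) {p e : ℕ} (hp : p.Prime)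
    (he : 2 ≤ e) : sqfreeTwist χ d (p ^ e) = 0 := by
  unfold sqfreeTwist
  rw [if_neg]
  rintro ⟨-, h⟩
  have := (Nat.squarefree_pow_iff hp.ne_one (by omega)).1 h
  omega

theorem hasProd_LSeries_sqfreeTwist (χ : DirichletCharacter ℂ q) (d : ℕ) {s : ℂ} (hs : 1 < s.re) :
    HasProd (fun p : Nat.Primes => 1 + sqfreeTwist χ d p * (p : ℂ) ^ (-s))
      (LSeries (sqfreeTwist χ d) s) := by
  have hsum : Summable (fun n => ‖LSeries.term (sqfreeTwist χ d) s n‖) :=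
    (LSeriesSummable_of_norm_le_one (norm_sqfreeTwist_le χ d) hs).norm
  have hterm : ∀ n, n ≠ 0 → LSeries.term (sqfreeTwist χ d) s n =
      sqfreeTwist χ d n * (n : ℂ) ^ (-s) := fun n hn => by
    rw [LSeries.term_of_ne_zero hn, Complex.cpow_neg, div_eq_mul_inv]
  have h := EulerProduct.eulerProduct_hasProd (f := LSeries.term (sqfreeTwist χ d) s)
    (by rw [hterm 1 one_ne_zero]; simp [sqfreeTwist]) (fun {m n} hmn => ?_) hsum
    (LSeries.term_zero _ _)
  · have key : ∀ p : Nat.Primes, ∑' e, LSeries.term (sqfreeTwist χ d) s ((p : ℕ) ^ e) =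
        1 + sqfreeTwist χ d p * (p : ℂ) ^ (-s) := fun p => ?_
    · simpa only [key] using! h
    rw [tsum_eq_sum (s := Finset.range 2)]
    · rw [Finset.sum_range_succ, Finset.sum_range_one, pow_zero, pow_one, hterm 1 one_ne_zero,
        hterm _ p.2.ne_zero]
      simp [sqfreeTwist]
    · intro e he
      rw [hterm _ (pow_ne_zero _ p.2.ne_zero), sqfreeTwist_prime_pow χ d p.2
        (by simpa using he : 1 < e), zero_mul]
  · rcases eq_or_ne m 0 with rfl | hm
    · simp
    rcases eq_or_ne n 0 with rfl | hn
    · simp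
    rw [hterm _ (mul_ne_zero hm hn), hterm _ hm, hterm _ hn, sqfreeTwist_mul χ d hmn, Nat.cast_mul,
      Complex.natCast_mul_natCast_cpow]
    ring

/-- The local factor at `p` of the logarithm of `LSeries (sqfreeTwist χ d) / L(·, χ)^(1/2)`. -/
noncomputable def localLog (χ : DirichletCharacter ℂ q) (d : ℕ) (p : Nat.Primes) (s : ℂ) : ℂ :=
  Complex.log (1 + sqfreeTwist χ d p * (p : ℂ) ^ (-s)) +
    Complex.log (1 - χ p * (p : ℂ) ^ (-s)) / 2

theorem norm_prime_cpow_le (p : Nat.Primes) {s : ℂ} (hs : 5 / 8 ≤ s.re) :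
    ‖((p : ℕ) : ℂ) ^ (-s)‖ ≤ (p : ℝ) ^ (-(5 / 8) : ℝ) ∧ (p : ℝ) ^ (-(5 / 8) : ℝ) ≤ 2 / 3 := by
  have h2 : (2 : ℝ) ≤ (p : ℕ) := by exact_mod_cast p.2.two_le
  constructor
  · rw [norm_natCast_cpow_neg p.2.pos]
    exact Real.rpow_le_rpow_of_exponent_le (by linarith) (by linarith)
  · calc ((p : ℕ) : ℝ) ^ (-(5 / 8) : ℝ) ≤ 2 ^ (-(5 / 8) : ℝ) :=
        Real.rpow_le_rpow_of_nonpos (by norm_num) h2 (by norm_num)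
      _ ≤ 2 / 3 := by
        have h3 : ((2 : ℝ) ^ (-(5 / 8) : ℝ)) ^ 8 ≤ (2 / 3) ^ 8 := by
          rw [← Real.rpow_natCast, ← Real.rpow_mul (by norm_num)]
          norm_num
        exact le_of_pow_le_pow_left₀ (by norm_num) (by norm_num) h3

theorem norm_char_mul_cpow_le (χ : DirichletCharacter ℂ q) (p : Nat.Primes) {s : ℂ}
    (hs : 5 / 8 ≤ s.re) : ‖χ p * ((p : ℕ) : ℂ) ^ (-s)‖ ≤ (p : ℝ) ^ (-(5 / 8) : ℝ) := by
  rw [norm_mul]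
  exact (mul_le_of_le_one_left (norm_nonneg _) (χ.norm_le_one _)).trans (norm_prime_cpow_le p hs).1

theorem norm_sqfreeTwist_mul_cpow_le (χ : DirichletCharacter ℂ q) (d : ℕ) (p : Nat.Primes) {s : ℂ}
    (hs : 5 / 8 ≤ s.re) : ‖sqfreeTwist χ d p * ((p : ℕ) : ℂ) ^ (-s)‖ ≤
      (p : ℝ) ^ (-(5 / 8) : ℝ) := by
  rw [norm_mul]
  exact (mul_le_of_le_one_left (norm_nonneg _)
    (norm_sqfreeTwist_le χ d p)).trans (norm_prime_cpow_le p hs).1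

theorem norm_log_one_add_sub_le_of_le {z : ℂ} {r : ℝ} (h : ‖z‖ ≤ r) (hr : r ≤ 2 / 3) :
    ‖Complex.log (1 + z) - z‖ ≤ 3 / 2 * r ^ 2 := by
  have hz : ‖z‖ < 1 := by linarith
  refine (Complex.norm_log_one_add_sub_self_le hz).trans ?_
  have h1 : (1 - ‖z‖)⁻¹ ≤ 3 := by
    rw [inv_le_comm₀ (by linarith) (by norm_num)]; linarith
  have h0 := norm_nonneg z
  calc ‖z‖ ^ 2 * (1 - ‖z‖)⁻¹ / 2 ≤ r ^ 2 * 3 / 2 := by gcongr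
    _ = _ := by ring

theorem norm_localLog_le (χ : DirichletCharacter ℂ q) (d : ℕ) (p : Nat.Primes) {s : ℂ}
    (hs : 5 / 8 ≤ s.re) :
    ‖localLog χ d p s‖ ≤ 9 / 4 * (p : ℝ) ^ (-(5 / 4) : ℝ) + if (p : ℕ) ∣ d then 1 else 0 := by
  have hr := (norm_prime_cpow_le p hs).2
  have hz := norm_char_mul_cpow_le χ p hs
  have hw := norm_sqfreeTwist_mul_cpow_le χ d p hs
  have h1 := norm_log_one_add_sub_le_of_le hw hr
  have h2 := norm_log_one_add_sub_le_of_le (z := -(χ p * ((p : ℕ) : ℂ) ^ (-s)))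
    (by rwa [norm_neg]) hr
  have hr2 : ((p : ℝ) ^ (-(5 / 8) : ℝ)) ^ 2 = (p : ℝ) ^ (-(5 / 4) : ℝ) := by
    rw [← Real.rpow_natCast, ← Real.rpow_mul (by positivity)]; norm_num
  rw [hr2] at h1 h2
  have h3 : localLog χ d p s = (Complex.log (1 + sqfreeTwist χ d p * (p : ℂ) ^ (-s)) -
        sqfreeTwist χ d p * (p : ℂ) ^ (-s)) +
      (Complex.log (1 + -(χ p * ((p : ℕ) : ℂ) ^ (-s))) - -(χ p * ((p : ℕ) : ℂ) ^ (-s))) / 2 +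
      (sqfreeTwist χ d p - χ p / 2) * (p : ℂ) ^ (-s) := by
    rw [localLog, ← sub_eq_add_neg]; ring
  have h4 : ‖(sqfreeTwist χ d p - χ p / 2) * ((p : ℕ) : ℂ) ^ (-s)‖ ≤
      if (p : ℕ) ∣ d then 1 else 0 := by
    rw [sqfreeTwist_prime χ d p.2]
    split_ifs
    · rw [zero_sub, neg_mul, norm_neg, div_mul_eq_mul_div, norm_div, Complex.norm_ofNat]
      linarith
    · simp
  rw [h3]
  refine (norm_add₃_le).trans ?_
  rw [norm_div, Complex.norm_ofNat]
  linarith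

theorem differentiableOn_localLog (χ : DirichletCharacter ℂ q) (d : ℕ) (p : Nat.Primes) :
    DifferentiableOn ℂ (localLog χ d p) {s | 5 / 8 < s.re} := by
  intro s hs
  have hs' : 5 / 8 ≤ s.re := le_of_lt hs
  have hr := (norm_prime_cpow_le p hs').2
  have hp0 : ((p : ℕ) : ℂ) ≠ 0 := by exact_mod_cast p.2.ne_zero
  have hc : DifferentiableAt ℂ (fun s : ℂ => ((p : ℕ) : ℂ) ^ (-s)) s :=
    differentiableAt_id.neg.const_cpow (Or.inl hp0)
  apply DifferentiableAt.differentiableWithinAt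
  unfold localLog
  refine DifferentiableAt.add (DifferentiableAt.clog ((hc.const_mul _).const_add _) ?_)
    (DifferentiableAt.div_const (DifferentiableAt.clog ((hc.const_mul _).const_sub _) ?_) _)
  · exact Complex.mem_slitPlane_of_norm_lt_one
      (lt_of_le_of_lt ((norm_sqfreeTwist_mul_cpow_le χ d p hs').trans hr) (by norm_num))
  · rw [sub_eq_add_neg]
    refine Complex.mem_slitPlane_of_norm_lt_one ?_
    rw [norm_neg]
    exact lt_of_le_of_lt ((norm_char_mul_cpow_le χ p hs').trans hr) (by norm_num)

theorem summable_localLog_bound {d : ℕ} (hd : d ≠ 0) :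
    Summable (fun p : Nat.Primes => 9 / 4 * (p : ℝ) ^ (-(5 / 4) : ℝ) +
      if (p : ℕ) ∣ d then 1 else 0) ∧
    ∑' p : Nat.Primes, (9 / 4 * (p : ℝ) ^ (-(5 / 4) : ℝ) + if (p : ℕ) ∣ d then 1 else 0) ≤
      9 / 4 * ∑' p : Nat.Primes, (p : ℝ) ^ (-(5 / 4) : ℝ) + d.primeFactors.card := by
  have h1 : Summable (fun p : Nat.Primes => (p : ℝ) ^ (-(5 / 4) : ℝ)) :=
    Nat.Primes.summable_rpow.2 (by norm_num)
  set S : Finset Nat.Primes := d.primeFactors.subtype Nat.Prime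
  have hS : ∀ p : Nat.Primes, p ∉ S → (if (p : ℕ) ∣ d then (1 : ℝ) else 0) = 0 := by
    intro p hp
    rw [if_neg]
    intro h
    exact hp (Finset.mem_subtype.2 (Nat.mem_primeFactors.2 ⟨p.2, h, hd⟩))
  have h2 : Summable (fun p : Nat.Primes => if (p : ℕ) ∣ d then (1 : ℝ) else 0) :=
    summable_of_ne_finset_zero hS
  refine ⟨(h1.mul_left _).add h2, ?_⟩
  rw [(h1.mul_left _).tsum_add h2, tsum_mul_left, tsum_eq_sum hS]
  gcongr
  calc ∑ p ∈ S, (if (p : ℕ) ∣ d then (1 : ℝ) else 0) ≤ ∑ p ∈ S, 1 := by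
        gcongr; split_ifs <;> norm_num
    _ = S.card := by simp
    _ ≤ _ := by
        have : S.card ≤ d.primeFactors.card := by
          rw [show S.card = _ from Finset.card_subtype _ _]; exact Finset.card_filter_le _ _
        exact_mod_cast this

/-- The logarithm of `LSeries (sqfreeTwist χ d) / L(·, χ)^(1/2)`. -/
noncomputable def corrLog (χ : DirichletCharacter ℂ q) (d : ℕ) (s : ℂ) : ℂ :=
  ∑' p : Nat.Primes, localLog χ d p s

theorem differentiableOn_corrLog (χ : DirichletCharacter ℂ q) {d : ℕ} (hd : d ≠ 0) :
    DifferentiableOn ℂ (corrLog χ d) {s | 5 / 8 < s.re} :=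
  Complex.differentiableOn_tsum_of_summable_norm (summable_localLog_bound hd).1
    (differentiableOn_localLog χ d) (isOpen_lt continuous_const Complex.continuous_re)
    fun p _ hs => norm_localLog_le χ d p (le_of_lt hs)

theorem norm_corrLog_le (χ : DirichletCharacter ℂ q) {d : ℕ} (hd : d ≠ 0) {s : ℂ}
    (hs : 5 / 8 ≤ s.re) : ‖corrLog χ d s‖ ≤
      9 / 4 * ∑' p : Nat.Primes, (p : ℝ) ^ (-(5 / 4) : ℝ) + d.primeFactors.card :=
  (tsum_of_norm_bounded (summable_localLog_bound hd).1.hasSum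
    fun p => norm_localLog_le χ d p hs).trans (summable_localLog_bound hd).2

theorem summable_prime_cpow {s : ℂ} (hs : 1 < s.re) {a : Nat.Primes → ℂ} (ha : ∀ p, ‖a p‖ ≤ 1) :
    Summable fun p : Nat.Primes => a p * ((p : ℕ) : ℂ) ^ (-s) := by
  refine Summable.of_norm_bounded (g := fun p : Nat.Primes => (p : ℝ) ^ (-s.re))
    (Nat.Primes.summable_rpow.2 (by linarith)) fun p => ?_
  rw [norm_mul, norm_natCast_cpow_neg p.2.pos]
  exact mul_le_of_le_one_left (by positivity) (ha p)

theorem LSeries_sqfreeTwist_sq (χ : DirichletCharacter ℂ q) [NeZero q] (d : ℕ) {s : ℂ}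
    (hs : 1 < s.re) : LSeries (sqfreeTwist χ d) s ≠ 0 ∧
      LSeries (sqfreeTwist χ d) s ^ 2 = Complex.exp (2 * corrLog χ d s) * LFunction χ s := by
  have hs' : 5 / 8 ≤ s.re := by linarith
  have hA : Summable fun p : Nat.Primes =>
      Complex.log (1 + sqfreeTwist χ d p * ((p : ℕ) : ℂ) ^ (-s)) :=
    Complex.summable_log_one_add_of_summable
      (summable_prime_cpow hs fun p => norm_sqfreeTwist_le χ d p)
  have hB : Summable fun p : Nat.Primes => Complex.log (1 - χ p * ((p : ℕ) : ℂ) ^ (-s)) := by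
    have := Complex.summable_log_one_add_of_summable
      (summable_prime_cpow hs (a := fun p => -χ p) fun p => by
        rw [norm_neg]; exact χ.norm_le_one _)
    refine this.congr fun p => ?_
    rw [neg_mul, ← sub_eq_add_neg]
  have hne : ∀ p : Nat.Primes, 1 + sqfreeTwist χ d p * ((p : ℕ) : ℂ) ^ (-s) ≠ 0 := fun p =>
    Complex.slitPlane_ne_zero (Complex.mem_slitPlane_of_norm_lt_one
      (lt_of_le_of_lt ((norm_sqfreeTwist_mul_cpow_le χ d p hs').trans
        (norm_prime_cpow_le p hs').2) (by norm_num)))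
  have h1 : Complex.exp (∑' p : Nat.Primes,
      Complex.log (1 + sqfreeTwist χ d p * ((p : ℕ) : ℂ) ^ (-s))) =
        LSeries (sqfreeTwist χ d) s := by
    rw [Complex.cexp_tsum_eq_tprod hne hA, (hasProd_LSeries_sqfreeTwist χ d hs).tprod_eq]
  have h2 := DirichletCharacter.LSeries_eulerProduct_exp_log χ hs
  rw [tsum_neg] at h2
  have h3 : corrLog χ d s = (∑' p : Nat.Primes,
      Complex.log (1 + sqfreeTwist χ d p * ((p : ℕ) : ℂ) ^ (-s))) +
      (∑' p : Nat.Primes, Complex.log (1 - χ p * ((p : ℕ) : ℂ) ^ (-s))) / 2 := by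
    rw [corrLog, ← tsum_div_const, ← hA.tsum_add (hB.div_const 2)]
    rfl
  refine ⟨h1 ▸ Complex.exp_ne_zero _, ?_⟩
  rw [LFunction_eq_LSeries χ hs, ← h2, ← h1, h3, ← Complex.exp_nat_mul, ← Complex.exp_add]
  congr 1
  push_cast
  ring

end DirichletCharacter

theorem exists_succ_pow_card_primeFactors_le (k : ℕ) : ∃ M : ℝ, 1 ≤ M ∧ ∀ d : ℕ, d ≠ 0 →
    ((d.primeFactors.card : ℝ) + 1) ^ k ≤ M * d.divisors.card := by
  obtain ⟨M, hM⟩ := (tendsto_pow_const_div_const_pow_of_one_lt k (one_lt_two (α := ℝ))).bddAbove_range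
  refine ⟨max 1 (M * 2), le_max_left _ _, fun d hd => ?_⟩
  have h1 := hM ⟨d.primeFactors.card + 1, rfl⟩
  simp only at h1
  rw [div_le_iff₀ (by positivity)] at h1
  push_cast at h1
  have h2 : 2 ^ d.primeFactors.card ≤ d.divisors.card := by
    rw [Nat.card_divisors hd]
    refine Finset.pow_card_le_prod _ _ _ fun p hp => ?_
    have := (Nat.prime_of_mem_primeFactors hp).factorization_pos_of_dvd hd
      (Nat.dvd_of_mem_primeFactors hp)
    omega
  have h3 : (2 : ℝ) ^ d.primeFactors.card ≤ d.divisors.card := by exact_mod_cast h2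
  calc _ ≤ M * 2 ^ (d.primeFactors.card + 1) := h1
    _ = M * 2 * 2 ^ d.primeFactors.card := by ring
    _ ≤ max 1 (M * 2) * d.divisors.card := by
      gcongr
      exact le_max_right _ _

namespace DirichletCharacter

variable {q : ℕ}

theorem analyticAt_LSeries_sqfreeTwist (χ : DirichletCharacter ℂ q) (d : ℕ) {s : ℂ}
    (hs : 1 < s.re) : LSeries.abscissaOfAbsConv (sqfreeTwist χ d) < s.re ∧
      AnalyticAt ℂ (LSeries (sqfreeTwist χ d)) s := by
  have h : LSeries.abscissaOfAbsConv (sqfreeTwist χ d) < s.re :=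
    lt_of_le_of_lt (LSeries.abscissaOfAbsConv_le_of_le_const
      ⟨1, fun n _ => norm_sqfreeTwist_le χ d n⟩) (by exact_mod_cast hs)
  exact ⟨h, LSeries_analyticOnNhd _ s h⟩

theorem analyticAt_corrLog (χ : DirichletCharacter ℂ q) {d : ℕ} (hd : d ≠ 0) {s : ℂ}
    (hs : 5 / 8 < s.re) : AnalyticAt ℂ (corrLog χ d) s :=
  (differentiableOn_corrLog χ hd).analyticAt
    ((isOpen_lt continuous_const Complex.continuous_re).mem_nhds hs)

theorem deriv_LSeries_sqfreeTwist (χ : DirichletCharacter ℂ q) [NeZero q] (hχ : χ ≠ 1) {d : ℕ}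
    (hd : d ≠ 0) {s : ℂ} (hs : 1 < s.re) :
    deriv (LSeries (sqfreeTwist χ d)) s = LSeries (sqfreeTwist χ d) s *
      (deriv (corrLog χ d) s + 2⁻¹ * (deriv (LFunction χ) s / LFunction χ s)) := by
  have hG := (analyticAt_LSeries_sqfreeTwist χ d hs).2.differentiableAt.hasDerivAt
  have hH := (analyticAt_corrLog χ hd (by linarith : 5 / 8 < s.re)).differentiableAt.hasDerivAt
  have hL := (differentiable_LFunction hχ s).hasDerivAt
  have hL0 : LFunction χ s ≠ 0 := LFunction_ne_zero_of_one_le_re χ (Or.inl hχ) hs.le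
  obtain ⟨hG0, hsq⟩ := LSeries_sqfreeTwist_sq χ d hs
  have h1 := hG.pow 2
  have h2 := ((hH.const_mul 2).cexp).mul hL
  have heq : (fun z => Complex.exp (2 * corrLog χ d z)) * LFunction χ =ᶠ[𝓝 s]
      LSeries (sqfreeTwist χ d) ^ 2 := by
    filter_upwards [(isOpen_lt continuous_const Complex.continuous_re).mem_nhds hs] with z hz
    exact (LSeries_sqfreeTwist_sq χ d hz).2.symm
  have h3 := h1.unique (h2.congr_of_eventuallyEq heq.symm)
  have h4 : Complex.exp (2 * corrLog χ d s) = LSeries (sqfreeTwist χ d) s ^ 2 / LFunction χ s := by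
    rw [hsq]; field_simp
  rw [h4] at h3
  apply mul_left_cancel₀ (mul_ne_zero two_ne_zero hG0)
  simp only [Nat.cast_ofNat, pow_one, Nat.add_one_sub_one] at h3
  rw [h3]
  field_simp

theorem norm_iteratedDeriv_corrLog_le (χ : DirichletCharacter ℂ q) {d : ℕ} (hd : d ≠ 0) (k : ℕ)
    {s : ℂ} (hs : 1 < s.re) : ‖iteratedDeriv k (corrLog χ d) s‖ ≤
      k.factorial * (9 / 4 * ∑' p : Nat.Primes, (p : ℝ) ^ (-(5 / 4) : ℝ) + d.primeFactors.card) /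
        (1 / 4) ^ k := by
  have hsub : ∀ z ∈ Metric.closedBall s (1 / 4), 5 / 8 < z.re := by
    intro z hz
    have h1 := (Complex.abs_re_le_norm (z - s)).trans (by simpa [dist_eq_norm] using hz)
    rw [Complex.sub_re] at h1
    have := (abs_le.1 h1).1
    linarith
  refine Complex.norm_iteratedDeriv_le_of_forall_mem_sphere_norm_le k (by norm_num)
    ((differentiableOn_corrLog χ hd).diffContOnCl_ball hsub) fun z hz => ?_
  exact norm_corrLog_le χ hd (hsub z (Metric.sphere_subset_closedBall hz)).le

theorem exists_norm_iteratedDeriv_logDeriv_LFunction_le (k : ℕ) {ε : ℝ} (hε : 0 < ε) :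
    ∃ C : ℝ, 0 ≤ C ∧ ∀ (q : ℕ) [NeZero q] (χ : DirichletCharacter ℂ q), χ ≠ 1 → ∀ s : ℂ,
      1 < s.re → s.re ≤ 2 → ‖iteratedDeriv k (fun z => deriv (LFunction χ) z / LFunction χ z) s‖ ≤
        C * (((q : ℝ) * (|s.im| + 3)) ^ ε) ^ (k + 1) := by
  choose K hK1 hK using fun i => exists_norm_iteratedDeriv_LFunction_le i (half_pos hε)
  obtain ⟨c, hc, hcb⟩ := exists_norm_LFunction_ge (half_pos hε)
  set B := (∑ i ∈ Finset.range (k + 2), K i) / c with hB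
  have hB0 : 0 ≤ B := div_nonneg (Finset.sum_nonneg fun i _ => by linarith [hK1 i]) hc.le
  obtain ⟨C, hC0, hC⟩ := exists_norm_iteratedDeriv_logDeriv_le hB0 k
  refine ⟨C, hC0, fun q _ χ hχ s hs hs2 => ?_⟩
  have hq := one_le_modulus (q := q)
  have hQ1 : 1 ≤ (q : ℝ) * (|s.im| + 3) := by nlinarith [abs_nonneg s.im]
  set Q := (q : ℝ) * (|s.im| + 3) with hQ
  have hQ0 : 0 < Q := by linarith
  refine hC _ s _ (Real.one_le_rpow hQ1 hε.le) ((differentiable_LFunction hχ).analyticAt s)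
    (LFunction_ne_zero_of_one_le_re χ (Or.inl hχ) hs.le) fun i hi => ?_
  have h1 := hK i q χ hχ s hs.le
  have h2 := hcb q χ hχ (s.re - 1) s.im (by linarith) (by linarith)
  have h3 : (1 : ℂ) + ((s.re - 1 : ℝ) : ℂ) + Complex.I * s.im = s := by
    apply Complex.ext <;> simp
  rw [h3, ← hQ] at h2
  have h4 : ‖s‖ + 1 ≤ |s.im| + 3 := by
    have := Complex.norm_le_abs_re_add_abs_im s
    rw [abs_of_pos (by linarith : 0 < s.re)] at this
    linarith
  have h5 : K i ≤ B * c := by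
    rw [hB, div_mul_cancel₀ _ hc.ne']
    exact Finset.single_le_sum (f := K) (fun j _ => by linarith [hK1 j])
      (Finset.mem_range.2 (by omega))
  have h6 : Q ^ (ε / 2) = Q ^ ε * Q ^ (-(ε / 2)) := by
    rw [← Real.rpow_add hQ0]; congr 1; ring
  calc _ ≤ K i * ((q : ℝ) * (‖s‖ + 1)) ^ (ε / 2) := h1
    _ ≤ B * c * Q ^ (ε / 2) := by
        have := hK1 i
        rw [hQ]
        gcongr
    _ = B * Q ^ ε * (c * Q ^ (-(ε / 2))) := by rw [h6]; ring
    _ ≤ _ := by gcongr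

theorem exists_norm_iteratedDeriv_LSeries_sqfreeTwist_le (k : ℕ) :
    ∃ C : ℝ, 0 ≤ C ∧ ∀ (q : ℕ) [NeZero q] (χ : DirichletCharacter ℂ q), χ ≠ 1 → ∀ d : ℕ, d ≠ 0 →
      ∀ s : ℂ, 1 < s.re → s.re ≤ 2 → ‖iteratedDeriv k (LSeries (sqfreeTwist χ d)) s‖ ≤
        C * d.divisors.card * ((q : ℝ) * (|s.im| + 3)) ^ (1 / 2 : ℝ) / (s.re - 1) := by
  set ε : ℝ := 1 / (2 * ((k + 1) * (k + 1))) with hε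
  have hε0 : 0 < ε := by positivity
  choose C hC0 hC using fun j => exists_norm_iteratedDeriv_logDeriv_LFunction_le j hε0
  set A : ℝ := 9 / 4 * ∑' p : Nat.Primes, (p : ℝ) ^ (-(5 / 4) : ℝ) with hA
  have hA0 : 0 ≤ A := mul_nonneg (by norm_num) (tsum_nonneg fun p => by positivity)
  set B : ℝ := ∑ i ∈ Finset.range k, ((i + 1).factorial * (A + 1) / (1 / 4) ^ (i + 1) + C i) with hB
  have hBi : ∀ i, 0 ≤ ((i + 1).factorial * (A + 1) / (1 / 4) ^ (i + 1) + C i : ℝ) := fun i => by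
    have := hC0 i; positivity
  have hB0 : 0 ≤ B := Finset.sum_nonneg fun i _ => hBi i
  obtain ⟨D, hD0, hD⟩ := exists_norm_iteratedDeriv_le_of_deriv_eq_mul hB0 k
  obtain ⟨M, hM1, hM⟩ := exists_succ_pow_card_primeFactors_le k
  obtain ⟨Z, hZ1, hZ⟩ := exists_zetaConst_le
  refine ⟨D * M * Z, by positivity, fun q _ χ hχ d hd s hs hs2 => ?_⟩
  have hq := one_le_modulus (q := q)
  have hQ1 : 1 ≤ (q : ℝ) * (|s.im| + 3) := by nlinarith [abs_nonneg s.im]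
  set Q := (q : ℝ) * (|s.im| + 3) with hQ
  have hQ0 : 0 < Q := by linarith
  have hW1 : 1 ≤ Q ^ ε := Real.one_le_rpow hQ1 hε0.le
  set W := Q ^ ε with hW
  set ω : ℝ := (d.primeFactors.card : ℝ) with hω
  have hω0 : 0 ≤ ω := by positivity
  have hW2 : 1 ≤ W ^ (k + 1) := one_le_pow₀ hW1
  have hL0 : LFunction χ s ≠ 0 := LFunction_ne_zero_of_one_le_re χ (Or.inl hχ) hs.le
  have hLa := (differentiable_LFunction hχ).analyticAt s
  have hv : AnalyticAt ℂ (fun z => deriv (LFunction χ) z / LFunction χ z) s := hLa.deriv.div hLa hL0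
  have hH := (analyticAt_corrLog χ hd (by linarith : 5 / 8 < s.re)).deriv
  have hv2 : AnalyticAt ℂ (fun z => 2⁻¹ * (deriv (LFunction χ) z / LFunction χ z)) s :=
    analyticAt_const.mul hv
  have key := hD (LSeries (sqfreeTwist χ d))
    (fun z => deriv (corrLog χ d) z + 2⁻¹ * (deriv (LFunction χ) z / LFunction χ z)) s
    ((ω + 1) * W ^ (k + 1)) (one_le_mul_of_one_le_of_one_le (by linarith) hW2)
    (analyticAt_LSeries_sqfreeTwist χ d hs).2 (hH.add hv2)
    (by
      filter_upwards [(isOpen_lt continuous_const Complex.continuous_re).mem_nhds hs] with z hz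
      exact deriv_LSeries_sqfreeTwist χ hχ hd hz)
    (fun i hi => by
      have e1 : iteratedDeriv i (fun z => deriv (corrLog χ d) z +
          2⁻¹ * (deriv (LFunction χ) z / LFunction χ z)) s = iteratedDeriv (i + 1) (corrLog χ d) s +
            2⁻¹ * iteratedDeriv i (fun z => deriv (LFunction χ) z / LFunction χ z) s := by
        rw [iteratedDeriv_succ', iteratedDeriv_fun_add hH.contDiffAt
          hv2.contDiffAt, iteratedDeriv_const_mul]
        exact hv.contDiffAt
      have e2 := norm_iteratedDeriv_corrLog_le χ hd (i + 1) hs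
      have e3 := hC i q χ hχ s hs hs2
      have e4 : ((i + 1).factorial * (A + 1) / (1 / 4) ^ (i + 1) + C i : ℝ) ≤ B :=
        Finset.single_le_sum (f := fun i : ℕ => ((i + 1).factorial * (A + 1) / (1 / 4) ^ (i + 1) + C i : ℝ))
          (fun j _ => hBi j) (Finset.mem_range.2 hi)
      rw [← hA, ← hω] at e2
      rw [← hQ, ← hW] at e3
      have hCi := hC0 i
      rw [e1]
      calc _ ≤ _ := norm_add_le _ _
        _ ≤ (i + 1).factorial * (A + ω) / (1 / 4) ^ (i + 1) + 1 * (C i * W ^ (i + 1)) := by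
          rw [norm_mul]
          gcongr
          rw [norm_inv, Complex.norm_ofNat]; norm_num
        _ ≤ (i + 1).factorial * ((A + 1) * ((ω + 1) * W ^ (k + 1))) / (1 / 4) ^ (i + 1) +
            C i * ((ω + 1) * W ^ (k + 1)) := by
          rw [one_mul]
          have f1 : A + ω ≤ (A + 1) * ((ω + 1) * W ^ (k + 1)) := by
            calc A + ω ≤ (A + 1) * (ω + 1) := by nlinarith
              _ ≤ (A + 1) * ((ω + 1) * W ^ (k + 1)) := by
                gcongr; exact le_mul_of_one_le_right (by positivity) hW2
          have f2 : W ^ (i + 1) ≤ (ω + 1) * W ^ (k + 1) := by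
            calc W ^ (i + 1) ≤ W ^ (k + 1) := pow_le_pow_right₀ hW1 (by omega)
              _ ≤ _ := le_mul_of_one_le_left (by positivity) (by linarith)
          gcongr
        _ = ((i + 1).factorial * (A + 1) / (1 / 4) ^ (i + 1) + C i : ℝ) *
            ((ω + 1) * W ^ (k + 1)) := by ring
        _ ≤ _ := by gcongr)
  have hG := (norm_LSeries_le_zetaConst (norm_sqfreeTwist_le χ d) hs).trans
    (hZ (s.re - 1) (by linarith) (by linarith))
  have hx : 0 < s.re - 1 := by linarith
  have hWk : (W ^ (k + 1)) ^ k ≤ Q ^ (1 / 2 : ℝ) := by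
    rw [← pow_mul, hW, ← Real.rpow_natCast, ← Real.rpow_mul hQ0.le]
    apply Real.rpow_le_rpow_of_exponent_le hQ1
    rw [hε, div_mul_eq_mul_div, div_le_div_iff₀ (by positivity) (by norm_num)]
    push_cast
    nlinarith
  calc _ ≤ _ := key
    _ = D * (ω + 1) ^ k * (W ^ (k + 1)) ^ k * ‖LSeries (sqfreeTwist χ d) s‖ := by
      rw [mul_pow]; ring
    _ ≤ D * (M * d.divisors.card) * Q ^ (1 / 2 : ℝ) * (Z / (s.re - 1)) := by
      have := hM d hd
      gcongr
    _ = _ := by ring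

end DirichletCharacter

section CesaroKernel

open MeasureTheory

/-- The kernel `max (1 - u) 0`. -/
noncomputable def cesaroKernel (u : ℝ) : ℂ :=
  Set.indicator (Set.Ioc 0 1) (fun _ => 1) u - Set.indicator (Set.Ioc 0 1) (fun t : ℝ => (t : ℂ) ^ (1 : ℂ)) u

theorem hasMellin_cesaroKernel {s : ℂ} (hs : 0 < s.re) :
    HasMellin cesaroKernel s (1 / (s * (s + 1))) := by
  have h1 := hasMellin_one_Ioc hs
  have h2 := hasMellin_cpow_Ioc (s := s) 1 (by simp; linarith)
  have h3 := hasMellin_sub h1.1 h2.1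
  have hs0 : s ≠ 0 := by rintro rfl; simp at hs
  have hs1 : s + 1 ≠ 0 := by
    intro h
    have := congrArg Complex.re h
    simp at this
    linarith
  rw [h1.2, h2.2] at h3
  have h4 : 1 / (s * (s + 1)) = 1 / s - 1 / (s + 1) := by field_simp; ring
  rw [h4]
  exact h3

theorem cesaroKernel_of_le {u : ℝ} (h0 : 0 < u) (h1 : u ≤ 1) : cesaroKernel u = 1 - u := by
  have h : u ∈ Set.Ioc (0 : ℝ) 1 := ⟨h0, h1⟩
  rw [cesaroKernel, Set.indicator_of_mem h, Set.indicator_of_mem h, Complex.cpow_one]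

theorem cesaroKernel_of_ge {u : ℝ} (h1 : 1 ≤ u) : cesaroKernel u = 0 := by
  rcases h1.eq_or_lt with rfl | h1
  · rw [cesaroKernel_of_le one_pos le_rfl]; simp
  · have : u ∉ Set.Ioc (0 : ℝ) 1 := fun h => not_lt.2 h.2 h1
    rw [cesaroKernel, Set.indicator_of_notMem this, Set.indicator_of_notMem this, sub_zero]

theorem continuousAt_cesaroKernel {u : ℝ} (h0 : 0 < u) : ContinuousAt cesaroKernel u := by
  have h : cesaroKernel =ᶠ[𝓝 u] fun u => ((max (1 - u) 0 : ℝ) : ℂ) := by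
    filter_upwards [lt_mem_nhds h0] with v hv
    rcases le_total v 1 with h | h
    · rw [cesaroKernel_of_le hv h, max_eq_left (by linarith)]; push_cast; ring
    · rw [cesaroKernel_of_ge h, max_eq_right (by linarith)]; simp
  refine ContinuousAt.congr ?_ h.symm
  fun_prop

theorem norm_perronWeight_le {σ : ℝ} (hσ : 1 ≤ σ) (y : ℝ) :
    ‖1 / (((σ : ℂ) + y * Complex.I) * ((σ : ℂ) + y * Complex.I + 1))‖ ≤ (1 + y ^ 2)⁻¹ := by
  rw [norm_div, norm_one, one_div, norm_mul]
  have h1 : ‖(σ : ℂ) + y * Complex.I‖ ^ 2 = σ ^ 2 + y ^ 2 := by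
    rw [Complex.sq_norm, Complex.normSq_add_mul_I]
  have h2 : ‖(σ : ℂ) + y * Complex.I + 1‖ ^ 2 = (σ + 1) ^ 2 + y ^ 2 := by
    rw [show (σ : ℂ) + y * Complex.I + 1 = ((σ + 1 : ℝ) : ℂ) + y * Complex.I by push_cast; ring,
      Complex.sq_norm, Complex.normSq_add_mul_I]
  have h3 : ‖(σ : ℂ) + y * Complex.I‖ ≤ ‖(σ : ℂ) + y * Complex.I + 1‖ :=
    le_of_sq_le_sq (by rw [h1, h2]; nlinarith) (norm_nonneg _)
  apply inv_anti₀ (by positivity)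
  calc 1 + y ^ 2 ≤ ‖(σ : ℂ) + y * Complex.I‖ ^ 2 := by rw [h1]; nlinarith
    _ ≤ _ := by rw [sq]; gcongr

theorem continuous_perronWeight {σ : ℝ} (hσ : 1 ≤ σ) : Continuous fun y : ℝ =>
    1 / (((σ : ℂ) + y * Complex.I) * ((σ : ℂ) + y * Complex.I + 1)) := by
  refine continuous_const.div (by fun_prop) fun y => mul_ne_zero ?_ ?_ <;>
  · intro h
    have := congrArg Complex.re h
    simp at this
    linarith

theorem integrable_perronWeight {σ : ℝ} (hσ : 1 ≤ σ) : Integrable fun y : ℝ =>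
    1 / (((σ : ℂ) + y * Complex.I) * ((σ : ℂ) + y * Complex.I + 1)) :=
  integrable_inv_one_add_sq.mono' (continuous_perronWeight hσ).aestronglyMeasurable
    (ae_of_all _ (norm_perronWeight_le hσ))

theorem integral_cpow_mul_perronWeight {σ : ℝ} (hσ : 1 ≤ σ) {u : ℝ} (hu : 0 < u) :
    ∫ y : ℝ, (u : ℂ) ^ (-((σ : ℂ) + y * Complex.I)) *
      (1 / (((σ : ℂ) + y * Complex.I) * ((σ : ℂ) + y * Complex.I + 1))) =
        2 * Real.pi * cesaroKernel u := by
  have hM : ∀ y : ℝ, mellin cesaroKernel ((σ : ℂ) + y * Complex.I) =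
      1 / (((σ : ℂ) + y * Complex.I) * ((σ : ℂ) + y * Complex.I + 1)) := fun y =>
    (hasMellin_cesaroKernel (by simp; linarith)).2
  have h := mellinInv_mellin_eq σ cesaroKernel hu
    (hasMellin_cesaroKernel (s := (σ : ℂ)) (by simp; linarith)).1
    (by
      unfold Complex.VerticalIntegrable
      simp only [hM]
      exact integrable_perronWeight hσ)
    (continuousAt_cesaroKernel hu)
  rw [mellinInv] at h
  simp only [hM, smul_eq_mul, Complex.real_smul] at h
  rw [← h]
  push_cast
  have : (Real.pi : ℂ) ≠ 0 := by exact_mod_cast Real.pi_ne_zero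
  rw [← mul_assoc, mul_one_div_cancel (mul_ne_zero two_ne_zero this), one_mul]

theorem cesaro_sum_eq_integral {a : ℕ → ℂ} {σ : ℝ} (hσ : 1 ≤ σ) (ha : LSeriesSummable a σ) {x : ℝ}
    (hx : 0 < x) : 2 * Real.pi * ∑ n ∈ Finset.Icc 1 ⌊x⌋₊, a n * (1 - n / x) =
      ∫ y : ℝ, (x : ℂ) ^ ((σ : ℂ) + y * Complex.I) * LSeries a ((σ : ℂ) + y * Complex.I) *
        (1 / (((σ : ℂ) + y * Complex.I) * ((σ : ℂ) + y * Complex.I + 1))) := by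
  set m : ℝ → ℂ := fun y => 1 / (((σ : ℂ) + y * Complex.I) * ((σ : ℂ) + y * Complex.I + 1)) with hm
  set F : ℕ → ℝ → ℂ := fun n y => (x : ℂ) ^ ((σ : ℂ) + y * Complex.I) *
    LSeries.term a ((σ : ℂ) + y * Complex.I) n * m y with hF
  have hx0 : (x : ℂ) ≠ 0 := by exact_mod_cast hx.ne'
  have hnorm : ∀ n y, ‖F n y‖ = x ^ σ * ‖LSeries.term a σ n‖ * ‖m y‖ := by
    intro n y
    rw [hF]
    simp only [norm_mul]
    rw [Complex.norm_cpow_eq_rpow_re_of_pos hx, LSeries.norm_term_eq, LSeries.norm_term_eq]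
    simp
  have hcont : ∀ n, Continuous (F n) := by
    intro n
    have h1 : Continuous fun y : ℝ => (x : ℂ) ^ ((σ : ℂ) + y * Complex.I) :=
      Continuous.const_cpow (by fun_prop) (Or.inl hx0)
    rcases eq_or_ne n 0 with rfl | hn
    · simp only [hF, LSeries.term_zero, mul_zero, zero_mul]; exact continuous_const
    have hn0 : (n : ℂ) ≠ 0 := by exact_mod_cast hn
    have h2 : Continuous fun y : ℝ => (n : ℂ) ^ ((σ : ℂ) + y * Complex.I) :=
      Continuous.const_cpow (by fun_prop) (Or.inl hn0)
    simp only [hF, LSeries.term_of_ne_zero hn]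
    exact (h1.mul (continuous_const.div h2 fun y => by simp [Complex.cpow_eq_zero_iff, hn0])).mul
      (continuous_perronWeight hσ)
  have hmint : Integrable m := integrable_perronWeight hσ
  have hFint : ∀ n, Integrable (F n) := by
    intro n
    refine (hmint.norm.const_mul (x ^ σ * ‖LSeries.term a σ n‖)).mono'
      (hcont n).aestronglyMeasurable (ae_of_all _ fun y => (hnorm n y).le)
  have hsum : Summable fun n => ∫ y, ‖F n y‖ := by
    simp only [hnorm, integral_const_mul]
    exact (ha.norm.mul_left _).mul_right _
  have key := hasSum_integral_of_summable_integral_norm hFint hsum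
  have hval : ∀ n, n ≠ 0 → ∫ y, F n y = 2 * Real.pi * (a n * cesaroKernel (n / x)) := by
    intro n hn
    have hn0 : (0 : ℝ) < n := by exact_mod_cast Nat.pos_of_ne_zero hn
    have h1 : ∀ y, F n y = a n * (((n / x : ℝ) : ℂ) ^ (-((σ : ℂ) + y * Complex.I)) * m y) := by
      intro y
      simp only [hF, LSeries.term_of_ne_zero hn]
      rw [div_eq_mul_inv (n : ℝ) x, Complex.ofReal_mul, Complex.mul_cpow_ofReal_nonneg hn0.le
        (by positivity), Complex.ofReal_inv, Complex.cpow_neg, Complex.inv_cpow _ _ (by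
          rw [Complex.arg_ofReal_of_nonneg hx.le]; exact Real.pi_ne_zero.symm), Complex.cpow_neg,
          inv_inv]
      push_cast
      ring
    simp only [h1]
    rw [integral_const_mul, integral_cpow_mul_perronWeight hσ (by positivity)]
    ring
  have h2 : ∫ y, ∑' n, F n y = ∫ y : ℝ, (x : ℂ) ^ ((σ : ℂ) + y * Complex.I) *
      LSeries a ((σ : ℂ) + y * Complex.I) * m y := by
    congr 1
    funext y
    simp only [hF]
    rw [tsum_mul_right, tsum_mul_left]
    rfl
  rw [← h2, ← key.tsum_eq, tsum_eq_sum (s := Finset.Icc 1 ⌊x⌋₊), Finset.mul_sum]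
  · refine Finset.sum_congr rfl fun n hn => ?_
    rw [Finset.mem_Icc] at hn
    have hn0 : (0 : ℝ) < n := by exact_mod_cast hn.1
    rw [hval n (by omega), cesaroKernel_of_le (by positivity)
      (div_le_one_of_le₀ (Nat.floor_le hx.le |>.trans' (by exact_mod_cast hn.2)) hx.le)]
    push_cast
    ring
  · intro n hn
    rcases eq_or_ne n 0 with rfl | hn0
    · simp [hF]
    rw [hval n hn0, cesaroKernel_of_ge, mul_zero, mul_zero]
    rw [Finset.mem_Icc, not_and, not_le] at hn
    rw [one_le_div hx]
    exact ((Nat.floor_lt hx.le).1 (hn (by omega))).le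

theorem integrable_rpow_half_div : Integrable fun y : ℝ => (|y| + 3) ^ (1 / 2 : ℝ) * (1 + y ^ 2)⁻¹ := by
  have h := (integrable_rpow_neg_one_add_norm_sq (E := ℝ) (μ := volume) (r := 3 / 2)
    (by simp; norm_num)).const_mul (18 : ℝ)
  refine h.mono' (by fun_prop (disch := positivity)) (ae_of_all _ fun y => ?_)
  have h0 : 0 < 1 + y ^ 2 := by positivity
  rw [Real.norm_eq_abs, abs_of_nonneg (by positivity), Real.norm_eq_abs, sq_abs]
  have h1 : |y| + 3 ≤ (18 * (1 + y ^ 2)) ^ (1 / 2 : ℝ) := by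
    rw [← Real.sqrt_eq_rpow]
    apply Real.le_sqrt_of_sq_le
    nlinarith [sq_nonneg (|y| - 3), sq_abs y]
  calc _ ≤ ((18 * (1 + y ^ 2)) ^ (1 / 2 : ℝ)) ^ (1 / 2 : ℝ) * (1 + y ^ 2)⁻¹ := by gcongr
    _ = 18 ^ (1 / 4 : ℝ) * ((1 + y ^ 2) ^ (1 / 4 : ℝ) * (1 + y ^ 2) ^ (-1 : ℝ)) := by
      rw [← Real.rpow_mul (by positivity), Real.mul_rpow (by norm_num) h0.le, Real.rpow_neg_one]
      norm_num [mul_assoc]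
    _ = 18 ^ (1 / 4 : ℝ) * (1 + y ^ 2) ^ (-(3 / 2 : ℝ) / 2) := by
      rw [← Real.rpow_add h0]; norm_num
    _ ≤ 18 * (1 + y ^ 2) ^ (-(3 / 2 : ℝ) / 2) := by
      gcongr
      calc (18 : ℝ) ^ (1 / 4 : ℝ) ≤ 18 ^ (1 : ℝ) :=
            Real.rpow_le_rpow_of_exponent_le (by norm_num) (by norm_num)
        _ = 18 := Real.rpow_one _

/-- Perron-type bound for Cesàro-weighted sums. -/
theorem exists_norm_cesaro_sum_le : ∃ J : ℝ, 0 ≤ J ∧ ∀ (a : ℕ → ℂ) (σ V x : ℝ), 1 ≤ σ → 0 < x →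
    LSeriesSummable a σ →
    (∀ y : ℝ, ‖LSeries a ((σ : ℂ) + y * Complex.I)‖ ≤ V * (|y| + 3) ^ (1 / 2 : ℝ)) →
    ‖∑ n ∈ Finset.Icc 1 ⌊x⌋₊, a n * (1 - n / x)‖ ≤ J * V * x ^ σ := by
  refine ⟨∫ y : ℝ, (|y| + 3) ^ (1 / 2 : ℝ) * (1 + y ^ 2)⁻¹,
    integral_nonneg fun y => by positivity, fun a σ V x hσ hx ha hb => ?_⟩
  have h := cesaro_sum_eq_integral hσ ha hx
  have h1 : ‖(2 * Real.pi : ℂ) * ∑ n ∈ Finset.Icc 1 ⌊x⌋₊, a n * (1 - n / x)‖ ≤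
      ∫ y : ℝ, x ^ σ * V * ((|y| + 3) ^ (1 / 2 : ℝ) * (1 + y ^ 2)⁻¹) := by
    rw [h]
    refine norm_integral_le_of_norm_le (integrable_rpow_half_div.const_mul _)
      (ae_of_all _ fun y => ?_)
    rw [norm_mul, norm_mul, Complex.norm_cpow_eq_rpow_re_of_pos hx]
    have h2 := norm_perronWeight_le hσ y
    have h3 := hb y
    have h4 : ((σ : ℂ) + y * Complex.I).re = σ := by simp
    rw [h4]
    have h5 : 0 ≤ V * (|y| + 3) ^ (1 / 2 : ℝ) := (norm_nonneg _).trans h3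
    calc _ ≤ x ^ σ * (V * (|y| + 3) ^ (1 / 2 : ℝ)) * (1 + y ^ 2)⁻¹ := by gcongr
      _ = _ := by ring
  rw [integral_const_mul, norm_mul] at h1
  have h2 : (1 : ℝ) ≤ ‖(2 * Real.pi : ℂ)‖ := by
    rw [norm_mul, Complex.norm_ofNat, Complex.norm_real, Real.norm_eq_abs, abs_of_pos Real.pi_pos]
    linarith [Real.pi_gt_three]
  calc _ ≤ ‖(2 * Real.pi : ℂ)‖ * _ := le_mul_of_one_le_left (norm_nonneg _) h2
    _ ≤ _ := h1
    _ = _ := by ring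

end CesaroKernel

theorem log_pow_le_factorial_mul_sqrt (j : ℕ) {x : ℝ} (hx : 1 ≤ x) :
    Real.log x ^ j ≤ 2 ^ j * j.factorial * Real.sqrt x := by
  have hl := Real.log_nonneg hx
  have h := Real.pow_div_factorial_le_exp (Real.log x / 2) (by positivity) j
  rw [div_pow, div_div, div_le_iff₀ (by positivity), ← Real.log_sqrt (by linarith),
    Real.exp_log (Real.sqrt_pos.2 (by linarith))] at h
  linarith

theorem mul_norm_sum_le_of_cesaro_bound {a : ℕ → ℂ} {x h L T : ℝ} (hx : 0 < x) (hh : 0 < h)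
    (ha : ∀ n : ℕ, 1 ≤ n → (n : ℝ) ≤ x + h → ‖a n‖ ≤ L)
    (h1 : ‖∑ n ∈ Finset.Icc 1 ⌊x⌋₊, a n * (x - n)‖ ≤ T)
    (h2 : ‖∑ n ∈ Finset.Icc 1 ⌊x + h⌋₊, a n * (((x + h : ℝ) : ℂ) - n)‖ ≤ T) (hL : 0 ≤ L) :
    h * ‖∑ n ∈ Finset.Icc 1 ⌊x⌋₊, a n‖ ≤ 2 * T + L * h * (h + 1) := by
  have hfl : ⌊x⌋₊ ≤ ⌊x + h⌋₊ := Nat.floor_le_floor (by linarith)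
  have hsplit : ∑ n ∈ Finset.Icc 1 ⌊x + h⌋₊, a n * (((x + h : ℝ) : ℂ) - n) =
      ∑ n ∈ Finset.Icc 1 ⌊x⌋₊, a n * (((x + h : ℝ) : ℂ) - n) +
        ∑ n ∈ Finset.Ioc ⌊x⌋₊ ⌊x + h⌋₊, a n * (((x + h : ℝ) : ℂ) - n) := by
    rw [← Finset.sum_union (by
      rw [Finset.disjoint_left]
      intro n hn hn'
      rw [Finset.mem_Icc] at hn
      rw [Finset.mem_Ioc] at hn'
      omega)]
    congr 1
    ext n
    simp only [Finset.mem_union, Finset.mem_Icc, Finset.mem_Ioc]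
    omega
  have hmain : (h : ℂ) * ∑ n ∈ Finset.Icc 1 ⌊x⌋₊, a n =
      ∑ n ∈ Finset.Icc 1 ⌊x + h⌋₊, a n * (((x + h : ℝ) : ℂ) - n) -
        ∑ n ∈ Finset.Icc 1 ⌊x⌋₊, a n * (x - n) -
        ∑ n ∈ Finset.Ioc ⌊x⌋₊ ⌊x + h⌋₊, a n * (((x + h : ℝ) : ℂ) - n) := by
    rw [hsplit, Finset.mul_sum, add_sub_right_comm, add_sub_cancel_right, ← Finset.sum_sub_distrib]
    refine Finset.sum_congr rfl fun n _ => ?_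
    push_cast
    ring
  have h3 : ‖∑ n ∈ Finset.Ioc ⌊x⌋₊ ⌊x + h⌋₊, a n * (((x + h : ℝ) : ℂ) - n)‖ ≤
      L * h * (h + 1) := by
    calc _ ≤ ∑ n ∈ Finset.Ioc ⌊x⌋₊ ⌊x + h⌋₊, L * h := by
          refine norm_sum_le_of_le _ fun n hn => ?_
          rw [Finset.mem_Ioc] at hn
          have e1 : x < n := (Nat.floor_lt hx.le).1 hn.1
          have e2 : (n : ℝ) ≤ x + h := (Nat.le_floor_iff (by positivity)).1 hn.2
          rw [norm_mul]
          have e3 : ‖((x + h : ℝ) : ℂ) - n‖ ≤ h := by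
            rw [← Complex.ofReal_natCast, ← Complex.ofReal_sub, Complex.norm_real,
              Real.norm_eq_abs, abs_of_nonneg (by linarith)]
            linarith
          have e4 := ha n (by omega) e2
          gcongr
      _ = L * h * ((⌊x + h⌋₊ : ℝ) - ⌊x⌋₊) := by
          rw [Finset.sum_const, Nat.card_Ioc, nsmul_eq_mul, Nat.cast_sub hfl]; ring
      _ ≤ L * h * (h + 1) := by
          gcongr
          have e1 := Nat.floor_le (show 0 ≤ x + h by positivity)
          have e2 := Nat.lt_floor_add_one x
          linarith
  calc h * ‖∑ n ∈ Finset.Icc 1 ⌊x⌋₊, a n‖ = ‖(h : ℂ) * ∑ n ∈ Finset.Icc 1 ⌊x⌋₊, a n‖ := by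
        rw [norm_mul, Complex.norm_real, Real.norm_eq_abs, abs_of_pos hh]
    _ ≤ T + T + L * h * (h + 1) := by
        rw [hmain]
        exact (norm_sub_le _ _).trans (add_le_add ((norm_sub_le _ _).trans (add_le_add h2 h1)) h3)
    _ = _ := by ring

theorem norm_sum_Ioc_mul_le_of_antitone {a : ℕ → ℂ} {w : ℕ → ℝ} {M N : ℕ} {D : ℝ} (hMN : M < N)
    (hw0 : ∀ n, M < n → 0 ≤ w n) (hw : ∀ n, M < n → w (n + 1) ≤ w n)
    (hD : ∀ n, M ≤ n → n ≤ N → ‖∑ i ∈ Finset.Icc 1 n, a i‖ ≤ D) :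
    ‖∑ n ∈ Finset.Ioc M N, (w n : ℂ) * a n‖ ≤ 2 * D * w (M + 1) := by
  have hD0 : 0 ≤ D := (norm_nonneg _).trans (hD M le_rfl hMN.le)
  have key : ∀ n, M + 1 ≤ n → n ≤ N →
      ‖∑ i ∈ Finset.Ioc M n, (w i : ℂ) * a i - w n * ∑ i ∈ Finset.Icc 1 n, a i‖ ≤
        D * (2 * w (M + 1) - w n) := by
    intro n hn
    induction n, hn using Nat.le_induction with
    | base =>
      intro _
      have h1 : ∑ i ∈ Finset.Ioc M (M + 1), (w i : ℂ) * a i -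
          w (M + 1) * ∑ i ∈ Finset.Icc 1 (M + 1), a i = -(w (M + 1) * ∑ i ∈ Finset.Icc 1 M, a i) := by
        rw [Finset.sum_Icc_succ_top (by omega), Nat.Ioc_succ_singleton, Finset.sum_singleton]
        ring
      rw [h1, norm_neg, norm_mul, Complex.norm_real, Real.norm_eq_abs,
        abs_of_nonneg (hw0 _ (by omega))]
      have := hD M le_rfl hMN.le
      have := hw0 (M + 1) (by omega)
      nlinarith
    | succ n hn ih =>
      intro hnN
      have h0 := ih (by omega)
      have h1 : ∑ i ∈ Finset.Ioc M (n + 1), (w i : ℂ) * a i -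
          w (n + 1) * ∑ i ∈ Finset.Icc 1 (n + 1), a i =
          (∑ i ∈ Finset.Ioc M n, (w i : ℂ) * a i - w n * ∑ i ∈ Finset.Icc 1 n, a i) +
            ((w n - w (n + 1) : ℝ) : ℂ) * ∑ i ∈ Finset.Icc 1 n, a i := by
        rw [Finset.sum_Icc_succ_top (by omega), Finset.sum_Ioc_succ_top (by omega)]
        push_cast
        ring
      have h2 : ‖((w n - w (n + 1) : ℝ) : ℂ) * ∑ i ∈ Finset.Icc 1 n, a i‖ ≤
          (w n - w (n + 1)) * D := by
        rw [norm_mul, Complex.norm_real, Real.norm_eq_abs,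
          abs_of_nonneg (sub_nonneg.2 (hw n (by omega)))]
        have := hD n (by omega) (by omega)
        have := sub_nonneg.2 (hw n (by omega))
        gcongr
      rw [h1]
      refine (norm_add_le _ _).trans ((add_le_add h0 h2).trans (le_of_eq ?_))
      ring
  have h1 := key N hMN le_rfl
  have h2 : ‖(w N : ℂ) * ∑ i ∈ Finset.Icc 1 N, a i‖ ≤ w N * D := by
    rw [norm_mul, Complex.norm_real, Real.norm_eq_abs, abs_of_nonneg (hw0 N hMN)]
    exact mul_le_mul_of_nonneg_left (hD N hMN.le le_rfl) (hw0 N hMN)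
  calc _ = ‖(∑ i ∈ Finset.Ioc M N, (w i : ℂ) * a i - w N * ∑ i ∈ Finset.Icc 1 N, a i) +
        w N * ∑ i ∈ Finset.Icc 1 N, a i‖ := by rw [sub_add_cancel]
    _ ≤ _ := (norm_add_le _ _).trans (add_le_add h1 h2)
    _ = _ := by ring

namespace DirichletCharacter

theorem exists_norm_cesaro_sum_logMul_le (k : ℕ) : ∃ C : ℝ, 0 ≤ C ∧ ∀ (q : ℕ) [NeZero q]
    (χ : DirichletCharacter ℂ q), χ ≠ 1 → ∀ d : ℕ, d ≠ 0 → ∀ x : ℝ, 3 ≤ x →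
      ‖∑ n ∈ Finset.Icc 1 ⌊x⌋₊, (LSeries.logMul^[k] (sqfreeTwist χ d)) n * (x - n)‖ ≤
        C * d.divisors.card * q * x ^ 2 * Real.log x := by
  obtain ⟨C, hC0, hC⟩ := exists_norm_iteratedDeriv_LSeries_sqfreeTwist_le k
  obtain ⟨J, hJ0, hJ⟩ := exists_norm_cesaro_sum_le
  refine ⟨J * C * Real.exp 1, by positivity, fun q _ χ hχ d hd x hx => ?_⟩
  have hq := one_le_modulus (q := q)
  have hx0 : 0 < x := by linarith
  have hl1 : 1 ≤ Real.log x := by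
    rw [Real.le_log_iff_exp_le hx0]
    linarith [Real.exp_one_lt_d9]
  have hl0 : 0 < Real.log x := by linarith
  set σ : ℝ := 1 + (Real.log x)⁻¹ with hσ
  have hσ1 : 1 < σ := by rw [hσ]; linarith [inv_pos.2 hl0]
  have hσ2 : σ ≤ 2 := by rw [hσ]; linarith [inv_le_one_of_one_le₀ hl1]
  have hab := (analyticAt_LSeries_sqfreeTwist χ d (s := (σ : ℂ)) (by simpa using hσ1)).1
  have hsum : LSeriesSummable (LSeries.logMul^[k] (sqfreeTwist χ d)) σ := by
    apply LSeriesSummable_of_abscissaOfAbsConv_lt_re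
    rw [LSeries.absicssaOfAbsConv_logPowMul]
    exact hab
  have hb : ∀ y : ℝ, ‖LSeries (LSeries.logMul^[k] (sqfreeTwist χ d)) ((σ : ℂ) + y * Complex.I)‖ ≤
      C * d.divisors.card * q * Real.log x * (|y| + 3) ^ (1 / 2 : ℝ) := by
    intro y
    have hre : ((σ : ℂ) + y * Complex.I).re = σ := by simp
    have him : ((σ : ℂ) + y * Complex.I).im = y := by simp
    have h1 := hC q χ hχ d hd ((σ : ℂ) + y * Complex.I) (by rwa [hre]) (by rwa [hre])
    rw [LSeries_iteratedDeriv k (by rw [hre]; simpa using hab), norm_mul, norm_pow, norm_neg,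
      norm_one, one_pow, one_mul, hre, him] at h1
    refine h1.trans ?_
    rw [hσ, add_sub_cancel_left, div_inv_eq_mul, Real.mul_rpow (by positivity) (by positivity)]
    have h2 : (q : ℝ) ^ (1 / 2 : ℝ) ≤ q := by
      calc (q : ℝ) ^ (1 / 2 : ℝ) ≤ (q : ℝ) ^ (1 : ℝ) :=
            Real.rpow_le_rpow_of_exponent_le hq (by norm_num)
        _ = q := Real.rpow_one _
    calc _ ≤ C * d.divisors.card * ((q : ℝ) * (|y| + 3) ^ (1 / 2 : ℝ)) * Real.log x := by gcongr
      _ = _ := by ring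
  have h := hJ _ σ _ x hσ1.le hx0 hsum hb
  have hxσ : x ^ σ = Real.exp 1 * x := by
    rw [hσ, Real.rpow_add hx0, Real.rpow_one, Real.rpow_inv_log hx0 (by linarith)]
    ring
  have hxc : (x : ℂ) ≠ 0 := by exact_mod_cast hx0.ne'
  have hS : ∑ n ∈ Finset.Icc 1 ⌊x⌋₊, (LSeries.logMul^[k] (sqfreeTwist χ d)) n * ((x : ℂ) - n) =
      x * ∑ n ∈ Finset.Icc 1 ⌊x⌋₊, (LSeries.logMul^[k] (sqfreeTwist χ d)) n * (1 - n / x) := by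
    rw [Finset.mul_sum]
    refine Finset.sum_congr rfl fun n _ => ?_
    field_simp
  rw [hS, norm_mul, Complex.norm_real, Real.norm_eq_abs, abs_of_pos hx0]
  calc _ ≤ x * (J * (C * d.divisors.card * q * Real.log x) * x ^ σ) := by gcongr
    _ = _ := by rw [hxσ]; ring

theorem logMul_iterate_apply (f : ℕ → ℂ) (k n : ℕ) :
    (LSeries.logMul^[k] f) n = ((Real.log n ^ k : ℝ) : ℂ) * f n := by
  induction k with
  | zero => simp
  | succ k ih =>
    rw [Function.iterate_succ_apply', LSeries.logMul, ih, ← Complex.natCast_log]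
    push_cast
    ring

theorem exists_norm_sum_logMul_le (m : ℕ) : ∃ C : ℝ, 0 ≤ C ∧ ∀ (q : ℕ) [NeZero q]
    (χ : DirichletCharacter ℂ q), χ ≠ 1 → ∀ d : ℕ, d ≠ 0 → ∀ x : ℝ, 3 ≤ x →
      ‖∑ n ∈ Finset.Icc 1 ⌊x⌋₊, (LSeries.logMul^[2 * m] (sqfreeTwist χ d)) n‖ ≤
        C * d.divisors.card * q * x * Real.log x ^ (m + 1) := by
  obtain ⟨C, hC0, hC⟩ := exists_norm_cesaro_sum_logMul_le (2 * m)
  set E : ℝ := 2 ^ (2 * m) * (2 * m).factorial with hE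
  refine ⟨16 * C + 2 ^ (2 * m) * (1 + E), by positivity, fun q _ χ hχ d hd x hx => ?_⟩
  have hq := one_le_modulus (q := q)
  have hx0 : 0 < x := by linarith
  have hl1 : 1 ≤ Real.log x := by
    rw [Real.le_log_iff_exp_le hx0]
    linarith [Real.exp_one_lt_d9]
  have hl0 : 0 < Real.log x := by linarith
  set l := Real.log x with hl
  have hlm : 1 ≤ l ^ m := one_le_pow₀ hl1
  obtain ⟨h, hh⟩ : ∃ h, h = x / l ^ m := ⟨_, rfl⟩
  have hh0 : 0 < h := by rw [hh]; positivity
  have hhx : h ≤ x := hh ▸ div_le_self hx0.le hlm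
  have hτ : (1 : ℝ) ≤ d.divisors.card := by
    exact_mod_cast Finset.card_pos.2 ⟨1, Nat.one_mem_divisors.2 hd⟩
  have hV : 1 ≤ (d.divisors.card : ℝ) * q := one_le_mul_of_one_le_of_one_le hτ hq
  set V := (d.divisors.card : ℝ) * q with hVdef
  have hlog : Real.log (x + h) ≤ 2 * l := by
    calc Real.log (x + h) ≤ Real.log (x ^ 2) := Real.log_le_log (by positivity) (by nlinarith)
      _ = 2 * l := by rw [Real.log_pow, ← hl]; norm_num
  have hT1 := hC q χ hχ d hd x hx
  have hT2 := hC q χ hχ d hd (x + h) (by linarith)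
  have hT : ∀ z, x ≤ z → z ≤ x + h → C * d.divisors.card * q * z ^ 2 * Real.log z ≤
      8 * C * V * x ^ 2 * l := by
    intro z hz1 hz2
    have h1 : Real.log z ≤ 2 * l := (Real.log_le_log (by linarith) hz2).trans hlog
    have h2 : z ≤ 2 * x := by linarith
    have h3 : 0 ≤ z := by linarith
    have h4 : 0 ≤ Real.log z := Real.log_nonneg (by linarith)
    calc _ = C * V * z ^ 2 * Real.log z := by rw [hVdef]; ring
      _ ≤ C * V * (2 * x) ^ 2 * (2 * l) := by gcongr
      _ = _ := by ring
  have key := mul_norm_sum_le_of_cesaro_bound (a := LSeries.logMul^[2 * m] (sqfreeTwist χ d))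
    (L := (2 * l) ^ (2 * m)) hx0 hh0 (fun n hn1 hn2 => by
      rw [logMul_iterate_apply, norm_mul, Complex.norm_real, Real.norm_eq_abs]
      have hn : (1 : ℝ) ≤ n := by exact_mod_cast hn1
      have h1 := Real.log_nonneg hn
      rw [abs_of_nonneg (by positivity)]
      calc _ ≤ Real.log n ^ (2 * m) * 1 := by gcongr; exact norm_sqfreeTwist_le χ d n
        _ ≤ _ := by
          rw [mul_one]
          gcongr
          exact (Real.log_le_log (by linarith) hn2).trans hlog)
    (hT1.trans (hT x le_rfl (by linarith))) (hT2.trans (hT (x + h) (by linarith) le_rfl))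
    (by positivity)
  have hlE : l ^ (2 * m) ≤ E * x := by
    refine (log_pow_le_factorial_mul_sqrt (2 * m) (by linarith : 1 ≤ x)).trans ?_
    rw [← hE]
    gcongr
    rw [Real.sqrt_le_left (by linarith)]
    nlinarith
  have hxh : x = h * l ^ m := by rw [hh]; field_simp
  have key2 : h * ‖∑ n ∈ Finset.Icc 1 ⌊x⌋₊, (LSeries.logMul^[2 * m] (sqfreeTwist χ d)) n‖ ≤
      h * (16 * C * V * x * l ^ (m + 1) + 2 ^ (2 * m) * (l ^ (2 * m) * h + l ^ (2 * m))) := by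
    refine key.trans (le_of_eq ?_)
    rw [mul_pow]
    have : 8 * C * V * x ^ 2 * l = h * (8 * C * V * x * l ^ (m + 1)) := by
      have : h * (8 * C * V * x * l ^ (m + 1)) = 8 * C * V * x * (h * l ^ m) * l := by ring
      rw [this, ← hxh]
      ring
    rw [this]
    ring
  refine (le_of_mul_le_mul_left key2 hh0).trans ?_
  have h1 : l ^ (2 * m) * h = x * l ^ m := by
    have : l ^ (2 * m) * h = h * l ^ m * l ^ m := by ring
    rw [this, ← hxh]
  clear hxh
  have h2 : x * l ^ m ≤ V * x * l ^ (m + 1) := by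
    rw [pow_succ]
    calc x * l ^ m ≤ V * (x * l ^ m) * l := by
          refine (le_mul_of_one_le_left (by positivity) hV).trans
            (le_mul_of_one_le_right (by positivity) hl1)
      _ = _ := by ring
  have h3 : E * x ≤ E * (V * x * l ^ (m + 1)) := by
    have : 1 ≤ l ^ (m + 1) := one_le_pow₀ hl1
    gcongr
    calc x ≤ V * x := le_mul_of_one_le_left hx0.le hV
      _ ≤ _ := le_mul_of_one_le_right (by positivity) this
  calc _ ≤ 16 * C * V * x * l ^ (m + 1) + 2 ^ (2 * m) *
        (V * x * l ^ (m + 1) + E * (V * x * l ^ (m + 1))) := by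
        rw [h1]
        have := hlE.trans h3
        gcongr
    _ = _ := by rw [hVdef]; ring

end DirichletCharacter

namespace DirichletCharacter

theorem norm_sum_sqfreeTwist_le_card {q : ℕ} (χ : DirichletCharacter ℂ q) (d N : ℕ) :
    ‖∑ n ∈ Finset.Icc 1 N, sqfreeTwist χ d n‖ ≤ N := by
  refine (norm_sum_le_of_le _ fun n _ => norm_sqfreeTwist_le χ d n).trans (le_of_eq ?_)
  simp

theorem exists_norm_sum_sqfreeTwist_le_pow (m : ℕ) : ∃ C : ℝ, 0 ≤ C ∧ ∀ (q : ℕ) [NeZero q]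
    (χ : DirichletCharacter ℂ q), χ ≠ 1 → ∀ d : ℕ, d ≠ 0 → ∀ x : ℝ, 9 ≤ x →
      ‖∑ n ∈ Finset.Icc 1 ⌊x⌋₊, sqfreeTwist χ d n‖ ≤
        C * d.divisors.card * q * x * (Real.log x ^ m)⁻¹ := by
  obtain ⟨C, hC0, hC⟩ := exists_norm_sum_logMul_le (m + 1)
  set E : ℝ := 2 ^ m * m.factorial with hE
  refine ⟨E + 2 * C * 4 ^ (m + 1), by positivity, fun q _ χ hχ d hd x hx => ?_⟩
  have hq := one_le_modulus (q := q)
  have hx0 : 0 < x := by linarith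
  have hl0 : 0 < Real.log x := Real.log_pos (by linarith)
  have hτ : (1 : ℝ) ≤ d.divisors.card := by
    exact_mod_cast Finset.card_pos.2 ⟨1, Nat.one_mem_divisors.2 hd⟩
  have hV : 1 ≤ (d.divisors.card : ℝ) * q := one_le_mul_of_one_le_of_one_le hτ hq
  obtain ⟨V, hVdef⟩ : ∃ V, V = (d.divisors.card : ℝ) * q := ⟨_, rfl⟩
  rw [← hVdef] at hV
  have hs3 : 3 ≤ √x := Real.le_sqrt_of_sq_le (by linarith)
  have hss : √x * √x = x := Real.mul_self_sqrt hx0.le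
  obtain ⟨M, hM⟩ : ∃ M, M = ⌊√x⌋₊ := ⟨_, rfl⟩
  obtain ⟨N, hN⟩ : ∃ N, N = ⌊x⌋₊ := ⟨_, rfl⟩
  have hM3 : 3 ≤ M := hM ▸ Nat.le_floor (by exact_mod_cast hs3)
  have hMs : (M : ℝ) ≤ √x := hM ▸ Nat.floor_le (by positivity)
  have hsM : √x < M + 1 := hM ▸ Nat.lt_floor_add_one _
  have hNx : (N : ℝ) ≤ x := hN ▸ Nat.floor_le hx0.le
  have hxN : x < N + 1 := hN ▸ Nat.lt_floor_add_one _
  have hMN : M < N := by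
    have : (M : ℝ) + 1 ≤ x := by nlinarith
    have h2 : M + 1 ≤ N := hN ▸ Nat.le_floor (by exact_mod_cast this)
    omega
  have hsplit : ∑ n ∈ Finset.Icc 1 N, sqfreeTwist χ d n =
      ∑ n ∈ Finset.Icc 1 M, sqfreeTwist χ d n + ∑ n ∈ Finset.Ioc M N, sqfreeTwist χ d n := by
    rw [← Finset.sum_union (by
      rw [Finset.disjoint_left]
      intro n hn hn'
      rw [Finset.mem_Icc] at hn
      rw [Finset.mem_Ioc] at hn'
      omega)]
    congr 1
    ext n
    simp only [Finset.mem_union, Finset.mem_Icc, Finset.mem_Ioc]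
    omega
  have hweight : ∑ n ∈ Finset.Ioc M N, sqfreeTwist χ d n =
      ∑ n ∈ Finset.Ioc M N, (((Real.log n ^ (2 * (m + 1)))⁻¹ : ℝ) : ℂ) *
        (LSeries.logMul^[2 * (m + 1)] (sqfreeTwist χ d)) n := by
    refine Finset.sum_congr rfl fun n hn => ?_
    rw [Finset.mem_Ioc] at hn
    have hn1 : (1 : ℝ) < n := by exact_mod_cast (by omega : 1 < n)
    have h0 : ((Real.log n ^ (2 * (m + 1)) : ℝ) : ℂ) ≠ 0 := by
      exact_mod_cast (pow_pos (Real.log_pos hn1) _).ne'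
    rw [logMul_iterate_apply, Complex.ofReal_inv, inv_mul_cancel_left₀ h0]
  have hlog2 : Real.log x / 2 ≤ Real.log ((M + 1 : ℕ) : ℝ) := by
    rw [← Real.log_sqrt hx0.le]
    push_cast
    exact Real.log_le_log (by linarith) hsM.le
  have hbig := norm_sum_Ioc_mul_le_of_antitone (a := LSeries.logMul^[2 * (m + 1)] (sqfreeTwist χ d))
    (w := fun n => (Real.log n ^ (2 * (m + 1)))⁻¹) (D := C * V * x * Real.log x ^ (m + 2)) hMN
    (fun n _ => by positivity)
    (fun n hn => by
      have hn1 : (1 : ℝ) < n := by exact_mod_cast (by omega : 1 < n)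
      have := Real.log_pos hn1
      gcongr
      simp)
    (fun n hn1 hn2 => by
      have hn : (3 : ℝ) ≤ n := by exact_mod_cast (by omega : 3 ≤ n)
      have hnx : (n : ℝ) ≤ x := le_trans (by exact_mod_cast hn2) hNx
      have h := hC q χ hχ d hd n hn
      rw [Nat.floor_natCast] at h
      have := Real.log_nonneg (by linarith : (1 : ℝ) ≤ n)
      refine h.trans ?_
      rw [mul_assoc C, ← hVdef]
      gcongr)
  have hw : (Real.log ((M + 1 : ℕ) : ℝ) ^ (2 * (m + 1)))⁻¹ ≤
      4 ^ (m + 1) * (Real.log x ^ (2 * (m + 1)))⁻¹ := by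
    have h4 : (4 : ℝ) ^ (m + 1) = 2 ^ (2 * (m + 1)) := by rw [pow_mul]; norm_num
    calc _ ≤ ((Real.log x / 2) ^ (2 * (m + 1)))⁻¹ := by gcongr
      _ = _ := by rw [h4, div_pow, inv_div, div_eq_mul_inv]
  have hbig2 : ‖∑ n ∈ Finset.Ioc M N, sqfreeTwist χ d n‖ ≤
      2 * C * 4 ^ (m + 1) * V * x * (Real.log x ^ m)⁻¹ := by
    rw [hweight]
    refine hbig.trans ?_
    calc _ ≤ 2 * (C * V * x * Real.log x ^ (m + 2)) *
          (4 ^ (m + 1) * (Real.log x ^ (2 * (m + 1)))⁻¹) := by gcongr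
      _ = 2 * C * 4 ^ (m + 1) * V * x * (Real.log x ^ (m + 2) *
          (Real.log x ^ (2 * (m + 1)))⁻¹) := by ring
      _ = _ := by
          congr 1
          rw [show 2 * (m + 1) = m + 2 + m by ring, pow_add _ (m + 2) m, mul_inv,
            mul_inv_cancel_left₀ (by positivity)]
  have hsmall : ‖∑ n ∈ Finset.Icc 1 M, sqfreeTwist χ d n‖ ≤ E * V * x * (Real.log x ^ m)⁻¹ := by
    refine (norm_sum_sqfreeTwist_le_card χ d M).trans (hMs.trans ?_)
    rw [← div_eq_mul_inv, le_div_iff₀ (by positivity)]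
    have h := log_pow_le_factorial_mul_sqrt m (by linarith : 1 ≤ x)
    rw [← hE] at h
    calc √x * Real.log x ^ m ≤ √x * (E * √x) := by gcongr
      _ = E * (√x * √x) := by ring
      _ = E * 1 * x := by rw [hss]; ring
      _ ≤ E * V * x := by gcongr
  rw [← hN, hsplit]
  refine (norm_add_le _ _).trans ((add_le_add hsmall hbig2).trans (le_of_eq ?_))
  rw [hVdef]
  ring

theorem exists_norm_sum_sqfreeTwist_le {C : ℝ} (hC : 0 < C) : ∃ K : ℝ, 0 < K ∧
    ∀ (q : ℕ) [NeZero q] (χ : DirichletCharacter ℂ q), χ ≠ 1 → ∀ d : ℕ, d ≠ 0 → ∀ x : ℝ, 2 ≤ x →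
      ‖∑ n ∈ Finset.Icc 1 ⌊x⌋₊, sqfreeTwist χ d n‖ ≤
        K * d.divisors.card * q * x * Real.log x ^ (-C) := by
  obtain ⟨m, hm⟩ := exists_nat_ge C
  obtain ⟨A, hA0, hA⟩ := exists_norm_sum_sqfreeTwist_le_pow m
  have h9 : 0 < Real.log 9 := Real.log_pos (by norm_num)
  refine ⟨A + Real.log 9 ^ C, by positivity, fun q _ χ hχ d hd x hx => ?_⟩
  have hq := one_le_modulus (q := q)
  have hx0 : 0 < x := by linarith
  have hl0 : 0 < Real.log x := Real.log_pos (by linarith)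
  have hτ : (1 : ℝ) ≤ d.divisors.card := by
    exact_mod_cast Finset.card_pos.2 ⟨1, Nat.one_mem_divisors.2 hd⟩
  have hV : 1 ≤ (d.divisors.card : ℝ) * q := one_le_mul_of_one_le_of_one_le hτ hq
  rcases le_or_gt 9 x with h | h
  · have hl1 : 1 ≤ Real.log x := by
      rw [Real.le_log_iff_exp_le hx0]
      linarith [Real.exp_one_lt_d9]
    have hpow : (Real.log x ^ m)⁻¹ ≤ Real.log x ^ (-C) := by
      rw [← Real.rpow_natCast, ← Real.rpow_neg hl0.le]
      exact Real.rpow_le_rpow_of_exponent_le hl1 (by linarith)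
    refine (hA q χ hχ d hd x h).trans ?_
    gcongr
    exact le_add_of_nonneg_right (by positivity)
  · have h1 : 1 ≤ Real.log 9 ^ C * Real.log x ^ (-C) := by
      rw [Real.rpow_neg hl0.le, ← div_eq_mul_inv, one_le_div (by positivity)]
      exact Real.rpow_le_rpow hl0.le (Real.log_le_log hx0 h.le) hC.le
    calc _ ≤ (⌊x⌋₊ : ℝ) := norm_sum_sqfreeTwist_le_card χ d _
      _ ≤ x := Nat.floor_le hx0.le
      _ ≤ ((d.divisors.card : ℝ) * q) * x * (Real.log 9 ^ C * Real.log x ^ (-C)) :=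
          (le_mul_of_one_le_left hx0.le hV).trans
            (le_mul_of_one_le_right (by positivity) h1)
      _ = Real.log 9 ^ C * d.divisors.card * q * x * Real.log x ^ (-C) := by ring
      _ ≤ _ := by
          gcongr
          exact le_add_of_nonneg_left hA0

end DirichletCharacter

namespace DirichletCharacter

theorem prodChar_ne_one {q₁ q₂ : ℕ} [NeZero q₁] [NeZero q₂] (h : q₁.Coprime q₂)
    (χ₁ : DirichletCharacter ℂ q₁) {χ₂ : DirichletCharacter ℂ q₂} (hχ : χ₂ ≠ 1) :
    prodChar χ₁ χ₂ ≠ 1 := by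
  obtain ⟨u, hu⟩ := MulChar.ne_one_iff.1 hχ
  obtain ⟨n, hn1, hn2⟩ := Nat.chineseRemainder h 1 (u : ZMod q₂).val
  have e1 : (n : ZMod q₁) = 1 := by
    simpa using (ZMod.natCast_eq_natCast_iff _ _ _).2 hn1
  have e2 : (n : ZMod q₂) = u := by
    simpa using (ZMod.natCast_eq_natCast_iff _ _ _).2 hn2
  intro hc
  have hcop : n.Coprime (q₁ * q₂) := by
    rw [Nat.coprime_mul_iff_right, ← ZMod.isUnit_iff_coprime, ← ZMod.isUnit_iff_coprime, e1, e2]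
    exact ⟨isUnit_one, u.isUnit⟩
  have h1 := prodChar_apply χ₁ χ₂ n
  rw [hc, MulChar.one_apply ((ZMod.isUnit_iff_coprime _ _).2 hcop), e1, e2, map_one, one_mul] at h1
  exact hu h1.symm

theorem totient_mul_sum_residue_eq {q₁ q₂ : ℕ} [NeZero q₁] {a : ZMod q₁} (ha : IsUnit a)
    (χ₂ : DirichletCharacter ℂ q₂) (d N : ℕ) :
    (q₁.totient : ℂ) * ∑ n ∈ Finset.Icc 1 N,
      (if n.Coprime d ∧ (n : ZMod q₁) = a then
        (if Squarefree n then (1 : ℂ) else 0) * χ₂ n / n.divisors.card else 0) =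
      ∑ ψ : DirichletCharacter ℂ q₁, ψ a⁻¹ *
        ∑ n ∈ Finset.Icc 1 N, sqfreeTwist (prodChar ψ χ₂) d n := by
  simp_rw [Finset.mul_sum]
  rw [Finset.sum_comm]
  refine Finset.sum_congr rfl fun n _ => ?_
  have h := sum_char_inv_mul_char_eq ℂ ha (n : ZMod q₁)
  have h2 : ∀ ψ : DirichletCharacter ℂ q₁, ψ a⁻¹ * sqfreeTwist (prodChar ψ χ₂) d n =
      ψ a⁻¹ * ψ n * (if n.Coprime d ∧ Squarefree n then χ₂ n / n.divisors.card else 0) := by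
    intro ψ
    rw [sqfreeTwist, prodChar_apply]
    split_ifs <;> ring
  simp_rw [h2]
  rw [← Finset.sum_mul, h]
  by_cases h3 : n.Coprime d <;> by_cases h4 : Squarefree n <;> by_cases h5 : (n : ZMod q₁) = a <;>
    simp [h3, h4, h5, eq_comm (a := a)]

end DirichletCharacter

end

/-- if `q = q₁q₂` with `gcd(q₁,q₂) = 1`, `gcd(ad, q) = 1` and `χ₂` is a
non-principal Dirichlet character mod `q₂`, then for any `C > 0` and `x ≥ 2`,
`∑_{n ≤ x, (n,d)=1, n ≡ a (q₁)} μ²(n) χ₂(n)/τ(n) ≪_C τ(d) q x (log x)^{-C}`,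
the implied constant depending only on `C`. -/
theorem stmt_8 (C : ℝ) (hC : 0 < C) :
    ∃ K : ℝ, 0 < K ∧
      ∀ (q₁ q₂ : ℕ), 0 < q₁ → 0 < q₂ → Nat.Coprime q₁ q₂ →
      ∀ (a : ℤ) (d : ℕ), Int.gcd (a * d) (q₁ * q₂) = 1 →
      ∀ χ₂ : DirichletCharacter ℂ q₂, χ₂ ≠ 1 →
      ∀ x : ℝ, 2 ≤ x →
      ‖∑ n ∈ Finset.Icc 1 ⌊x⌋₊,
          if Nat.Coprime n d ∧ ((n : ℤ) : ZMod q₁) = ((a : ℤ) : ZMod q₁) then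
            (if Squarefree n then (1 : ℂ) else 0) * χ₂ (n : ZMod q₂)
              / (n.divisors.card : ℂ)
          else 0‖
        ≤ K * d.divisors.card * (q₁ * q₂) * x * Real.log x ^ (-C) := by
  obtain ⟨K, hK0, hK⟩ := DirichletCharacter.exists_norm_sum_sqfreeTwist_le hC
  refine ⟨K, hK0, fun q₁ q₂ hq₁ hq₂ hcop a d hgcd χ₂ hχ x hx => ?_⟩
  have : NeZero q₁ := ⟨hq₁.ne'⟩
  have : NeZero q₂ := ⟨hq₂.ne'⟩
  have hgcd' : IsCoprime (a * d) ((q₁ : ℤ) * q₂) := Int.isCoprime_iff_gcd_eq_one.2 hgcd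
  have ha : IsUnit ((a : ℤ) : ZMod q₁) := by
    rw [ZMod.coe_int_isUnit_iff_isCoprime]
    exact hgcd'.of_mul_left_left.of_mul_right_left.symm
  have hd : d ≠ 0 := by
    rintro rfl
    have h1 : IsCoprime (0 : ℤ) (q₂ : ℤ) := by
      simpa using hgcd'.of_mul_right_right
    rw [isCoprime_zero_left, Int.isUnit_iff_natAbs_eq, Int.natAbs_natCast] at h1
    subst h1
    exact hχ (DirichletCharacter.level_one χ₂)
  have hφ : (0 : ℝ) < q₁.totient := by exact_mod_cast Nat.totient_pos.2 hq₁
  have key := congrArg norm (DirichletCharacter.totient_mul_sum_residue_eq ha χ₂ d ⌊x⌋₊)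
  rw [norm_mul, Complex.norm_natCast] at key
  have hb : ‖∑ ψ : DirichletCharacter ℂ q₁, ψ ((a : ℤ) : ZMod q₁)⁻¹ * ∑ n ∈ Finset.Icc 1 ⌊x⌋₊,
      (DirichletCharacter.prodChar ψ χ₂).sqfreeTwist d n‖ ≤
      q₁.totient * (K * d.divisors.card * (q₁ * q₂) * x * Real.log x ^ (-C)) := by
    rw [← DirichletCharacter.card_eq_totient_of_hasEnoughRootsOfUnity ℂ q₁, Nat.card_eq_fintype_card,
      ← Finset.card_univ, ← nsmul_eq_mul]
    refine (norm_sum_le _ _).trans (Finset.sum_le_card_nsmul _ _ _ fun ψ _ => ?_)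
    rw [norm_mul]
    have h1 := hK _ (DirichletCharacter.prodChar ψ χ₂)
      (DirichletCharacter.prodChar_ne_one hcop ψ hχ) d hd x hx
    rw [Nat.cast_mul] at h1
    exact (mul_le_of_le_one_left (norm_nonneg _) (ψ.norm_le_one _)).trans h1
  rw [← key] at hb
  simpa only [Int.cast_natCast] using le_of_mul_le_mul_left hb hφ
end

section
/- With the notation below, ∑_{(δ₂,δ₃) ∈ {±1}²} ∑_{μ,α,β ∈ {0,1}, μ+α+β ∈ {0,1}} 2^{−(μ+α+β)} ∑_{ε=(ε₁,ε₂,ε₃): (ε₁, δ₂ε₂, δ₃ε₃) ∈ E(μ,α,β)} u(ε₁,ε₂,ε₃)/c(δ,ε,μ,α,β) = 0, where the inner sum runs over triples ε of units modulo 8. -/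
open scoped Classical

/-- `ν(b) = 0` if `b ≡ 1 (mod 4)` and `ν(b) = 1` otherwise. -/
def nuFour (b : ℕ) : ℕ := if b % 4 = 1 then 0 else 1

/-- The quadratic-reciprocity factor
`u(k₁,k₂,k₃) = (-1)^{ν(k₁)ν(k₂)+ν(k₂)ν(k₃)+ν(k₃)ν(k₁)} (2^μ|k₂k₃)(2^α δ₂|k₃k₁)(2^β δ₃|k₁k₂)`,
where `(·|·)` is the Jacobi symbol. -/
def uFactor (δ₂ δ₃ : ℤ) (μ α β : ℕ) (k₁ k₂ k₃ : ℕ) : ℤ :=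
  (-1) ^ (nuFour k₁ * nuFour k₂ + nuFour k₂ * nuFour k₃ + nuFour k₃ * nuFour k₁) *
    jacobiSym (2 ^ μ) (k₂ * k₃) * jacobiSym (2 ^ α * δ₂) (k₃ * k₁) *
    jacobiSym (2 ^ β * δ₃) (k₁ * k₂)

/-- `u` evaluated on units mod 8, via their canonical odd representatives. -/
def uUnits (δ₂ δ₃ : ℤ) (μ α β : ℕ) (e₁ e₂ e₃ : (ZMod 8)ˣ) : ℤ :=
  uFactor δ₂ δ₃ μ α β (e₁ : ZMod 8).val (e₂ : ZMod 8).val (e₃ : ZMod 8).val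

/-- Reduction mod 4 of a residue mod 8. -/
def toZMod4 (e : ZMod 8) : ZMod 4 := ZMod.castHom (by norm_num : (4:ℕ) ∣ 8) (ZMod 4) e

/-- `E₁(0,0,0)`: all three residues agree mod 4. -/
def EOne (x y z : ZMod 8) : Prop := toZMod4 x = toZMod4 y ∧ toZMod4 y = toZMod4 z

/-- `E₂(0,0,0)`: two residues are equal mod 8 and opposite to the third mod 4. -/
def ETwo (x y z : ZMod 8) : Prop :=
  (x = y ∧ toZMod4 x = -toZMod4 z) ∨ (y = z ∧ toZMod4 y = -toZMod4 x) ∨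
    (z = x ∧ toZMod4 z = -toZMod4 y)

/-- The set `E(μ,α,β)` of admissible residue triples mod 8. -/
def EPred (μ α β : ℕ) (x y z : ZMod 8) : Prop :=
  if μ = 1 then y = z
  else if α = 1 then x = z
  else if β = 1 then x = y
  else EOne x y z ∨ ETwo x y z

/-- The constant `c(δ,ε,μ,α,β)`: `1` if `(ε₁, δ₂ε₂, δ₃ε₃) ∈ E₁(0,0,0)` and
`μ = α = β = 0`, and `4` otherwise. -/
noncomputable def cConst (δ₂ δ₃ : ℤ) (μ α β : ℕ) (e₁ e₂ e₃ : (ZMod 8)ˣ) : ℝ :=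
  if μ = 0 ∧ α = 0 ∧ β = 0 ∧
      EOne (e₁ : ZMod 8) ((δ₂ : ZMod 8) * (e₂ : ZMod 8)) ((δ₃ : ZMod 8) * (e₃ : ZMod 8))
    then 1 else 4

theorem jacobiSym_congr_mod_eight {a : ℤ} (ha : a.natAbs ∣ 2) {m n : ℕ} (hm : Odd m)
    (hmn : m ≡ n [MOD 8]) : jacobiSym a m = jacobiSym a n := by
  have hn : Odd n := by
    rw [Nat.odd_iff] at hm ⊢
    have := hmn.of_dvd (show 2 ∣ 8 by norm_num)
    rw [Nat.ModEq] at this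
    omega
  have h : m % (4 * a.natAbs) = n % (4 * a.natAbs) :=
    hmn.of_dvd (Nat.mul_dvd_mul_left 4 ha)
  rw [jacobiSym.mod_right a hm, jacobiSym.mod_right a hn, h]

theorem unit_val_odd (e : (ZMod 8)ˣ) : Odd (e : ZMod 8).val := by
  revert e
  decide

theorem nuFour_val_neg (e : (ZMod 8)ˣ) :
    nuFour ((-e : (ZMod 8)ˣ) : ZMod 8).val = 1 - nuFour (e : ZMod 8).val := by
  revert e
  decide

theorem nuFour_eq_zero_or_one (b : ℕ) : nuFour b = 0 ∨ nuFour b = 1 := by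
  unfold nuFour
  split_ifs <;> simp

theorem val_neg_mul_val_neg_modEq (x y : ZMod 8) :
    (-x).val * (-y).val ≡ x.val * y.val [MOD 8] := by
  rw [← ZMod.natCast_eq_natCast_iff]
  simp

theorem jacobiSym_val_neg_mul_val_neg {a : ℤ} (ha : a.natAbs ∣ 2) (e f : (ZMod 8)ˣ) :
    jacobiSym a (((-e : (ZMod 8)ˣ) : ZMod 8).val * ((-f : (ZMod 8)ˣ) : ZMod 8).val) =
      jacobiSym a ((e : ZMod 8).val * (f : ZMod 8).val) :=
  jacobiSym_congr_mod_eight ha ((unit_val_odd _).mul (unit_val_odd _)) <| by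
    simpa only [Units.val_neg] using val_neg_mul_val_neg_modEq (e : ZMod 8) f

theorem uUnits_neg {δ₂ δ₃ : ℤ} {μ α β : ℕ} (h₁ : ((2 : ℤ) ^ μ).natAbs ∣ 2)
    (h₂ : (2 ^ α * δ₂).natAbs ∣ 2) (h₃ : (2 ^ β * δ₃).natAbs ∣ 2) (e₁ e₂ e₃ : (ZMod 8)ˣ) :
    uUnits δ₂ δ₃ μ α β (-e₁) (-e₂) (-e₃) = -uUnits δ₂ δ₃ μ α β e₁ e₂ e₃ := by
  unfold uUnits uFactor
  rw [jacobiSym_val_neg_mul_val_neg h₁, jacobiSym_val_neg_mul_val_neg h₂,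
    jacobiSym_val_neg_mul_val_neg h₃, nuFour_val_neg, nuFour_val_neg, nuFour_val_neg]
  rcases nuFour_eq_zero_or_one (e₁ : ZMod 8).val with hx | hx <;>
  rcases nuFour_eq_zero_or_one (e₂ : ZMod 8).val with hy | hy <;>
  rcases nuFour_eq_zero_or_one (e₃ : ZMod 8).val with hz | hz <;>
  simp [hx, hy, hz]

theorem toZMod4_neg (x : ZMod 8) : toZMod4 (-x) = -toZMod4 x :=
  map_neg _ x

theorem EOne_neg (x y z : ZMod 8) : EOne (-x) (-y) (-z) ↔ EOne x y z := by
  simp only [EOne, toZMod4_neg, neg_inj]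

theorem EPred_neg (μ α β : ℕ) (x y z : ZMod 8) :
    EPred μ α β (-x) (-y) (-z) ↔ EPred μ α β x y z := by
  simp only [EPred, ETwo, EOne_neg, toZMod4_neg, neg_inj]

theorem cConst_neg (δ₂ δ₃ : ℤ) (μ α β : ℕ) (e₁ e₂ e₃ : (ZMod 8)ˣ) :
    cConst δ₂ δ₃ μ α β (-e₁) (-e₂) (-e₃) = cConst δ₂ δ₃ μ α β e₁ e₂ e₃ := by
  simp only [cConst, Units.val_neg, mul_neg, EOne_neg]

/-- The summand is odd under `ε ↦ -ε`, which preserves the index set. -/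
theorem sum_uUnits_div_cConst_eq_zero {δ₂ δ₃ : ℤ} {μ α β : ℕ}
    (h₁ : ((2 : ℤ) ^ μ).natAbs ∣ 2) (h₂ : (2 ^ α * δ₂).natAbs ∣ 2)
    (h₃ : (2 ^ β * δ₃).natAbs ∣ 2) :
    ∑ e ∈ (Finset.univ : Finset ((ZMod 8)ˣ × (ZMod 8)ˣ × (ZMod 8)ˣ)).filter
        (fun e => EPred μ α β (e.1 : ZMod 8)
          ((δ₂ : ZMod 8) * (e.2.1 : ZMod 8)) ((δ₃ : ZMod 8) * (e.2.2 : ZMod 8))),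
      (uUnits δ₂ δ₃ μ α β e.1 e.2.1 e.2.2 : ℝ) / cConst δ₂ δ₃ μ α β e.1 e.2.1 e.2.2 = 0 := by
  rw [← self_eq_neg, ← Finset.sum_neg_distrib]
  refine Finset.sum_equiv (Equiv.neg _) (fun e => ?_) (fun e _ => ?_)
  · simp only [Finset.mem_filter, Finset.mem_univ, true_and, Equiv.neg_apply, Prod.fst_neg,
      Prod.snd_neg, Units.val_neg, mul_neg, EPred_neg]
  · simp only [Equiv.neg_apply, Prod.fst_neg, Prod.snd_neg, uUnits_neg h₁ h₂ h₃, cConst_neg]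
    push_cast
    ring

/-- Lemma 4.5: the weighted sum of `u(ε)/c(δ,ε,μ,α,β)` over all signs,
exponents with `μ+α+β ∈ {0,1}`, and admissible residue triples, vanishes. -/
theorem stmt_12 :
    (∑ δ₂ ∈ ({1, -1} : Finset ℤ), ∑ δ₃ ∈ ({1, -1} : Finset ℤ),
      ∑ t ∈ ({(0, 0, 0), (1, 0, 0), (0, 1, 0), (0, 0, 1)} : Finset (ℕ × ℕ × ℕ)),
        (2 : ℝ) ^ (-((t.1 + t.2.1 + t.2.2 : ℕ) : ℤ)) *
          ∑ e ∈ (Finset.univ : Finset ((ZMod 8)ˣ × (ZMod 8)ˣ × (ZMod 8)ˣ)).filter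
              (fun e => EPred t.1 t.2.1 t.2.2 (e.1 : ZMod 8)
                ((δ₂ : ZMod 8) * (e.2.1 : ZMod 8)) ((δ₃ : ZMod 8) * (e.2.2 : ZMod 8))),
            (uUnits δ₂ δ₃ t.1 t.2.1 t.2.2 e.1 e.2.1 e.2.2 : ℝ) /
              cConst δ₂ δ₃ t.1 t.2.1 t.2.2 e.1 e.2.1 e.2.2) = 0 := by
  refine Finset.sum_eq_zero fun δ₂ h₂ => Finset.sum_eq_zero fun δ₃ h₃ =>
    Finset.sum_eq_zero fun t ht => ?_
  simp only [Finset.mem_insert, Finset.mem_singleton] at h₂ h₃ ht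
  rw [sum_uUnits_div_cConst_eq_zero, mul_zero] <;>
  rcases h₂ with rfl | rfl <;> rcases h₃ with rfl | rfl <;>
  rcases ht with rfl | rfl | rfl | rfl <;> decide
end
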